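/- Let K be a number field, S a finite set of places of K containing all archimedean places, and 𝔄 the ring of S-integers of K. For every g ≥ 1, the second integral group homology H₂(Sp(2g, 𝔄)) is a finitely generated abelian group. -/

import Mathlib

noncomputable section

namespace GpH2

open Finsupp

variable (G : Type) [Group G]

/-- Second boundary map of the bar complex: `(g,h) ↦ [h] - [gh] + [g]`. -/
def d2 : ((G × G) →₀ ℤ) →ₗ[ℤ] (G →₀ ℤ) :=
  Finsupp.linearCombination ℤ fun p : G × G =>
    Finsupp.single p.2 1 - Finsupp.single (p.1 * p.2) 1 + Finsupp.single p.1 1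

/-- Third boundary map of the bar complex:
`(g,h,k) ↦ [(h,k)] - [(gh,k)] + [(g,hk)] - [(g,h)]`. -/
def d3 : ((G × G × G) →₀ ℤ) →ₗ[ℤ] ((G × G) →₀ ℤ) :=
  Finsupp.linearCombination ℤ fun t : G × G × G =>
    Finsupp.single (t.2.1, t.2.2) 1 - Finsupp.single (t.1 * t.2.1, t.2.2) 1
      + Finsupp.single (t.1, t.2.1 * t.2.2) 1 - Finsupp.single (t.1, t.2.1) 1

/-- 2-cycles. -/
def Z2 : Submodule ℤ ((G × G) →₀ ℤ) := LinearMap.ker (d2 G)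

/-- 2-boundaries. -/
def B2 : Submodule ℤ ((G × G) →₀ ℤ) := LinearMap.range (d3 G)

/-- The second homology group of `G` with trivial integral coefficients,
defined via the bar resolution as 2-cycles modulo 2-boundaries. -/
abbrev H2 := ↥(Z2 G) ⧸ (B2 G).comap (Z2 G).subtype

variable {G} {H : Type} [Group H]

/-- The map induced on bar 2-chains by a group homomorphism. -/
def C2 (f : G →* H) : ((G × G) →₀ ℤ) →ₗ[ℤ] ((H × H) →₀ ℤ) :=
  Finsupp.lmapDomain ℤ ℤ (Prod.map f f)

def C1 (f : G →* H) : (G →₀ ℤ) →ₗ[ℤ] (H →₀ ℤ) :=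
  Finsupp.lmapDomain ℤ ℤ f

def C3 (f : G →* H) : ((G × G × G) →₀ ℤ) →ₗ[ℤ] ((H × H × H) →₀ ℤ) :=
  Finsupp.lmapDomain ℤ ℤ (Prod.map f (Prod.map f f))

@[simp] theorem C2_single (f : G →* H) (p : G × G) (n : ℤ) :
    C2 f (Finsupp.single p n) = Finsupp.single (f p.1, f p.2) n := by
  simp [C2, Finsupp.mapDomain_single, Prod.map]

@[simp] theorem C1_single (f : G →* H) (g : G) (n : ℤ) :
    C1 f (Finsupp.single g n) = Finsupp.single (f g) n := by
  simp [C1, Finsupp.mapDomain_single]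

@[simp] theorem C3_single (f : G →* H) (t : G × G × G) (n : ℤ) :
    C3 f (Finsupp.single t n) = Finsupp.single (f t.1, f t.2.1, f t.2.2) n := by
  simp [C3, Finsupp.mapDomain_single, Prod.map]

theorem d2_comm (f : G →* H) : (d2 H).comp (C2 f) = (C1 f).comp (d2 G) := by
  refine Finsupp.lhom_ext fun p n => ?_
  simp only [LinearMap.comp_apply, C2_single, d2, Finsupp.linearCombination_single,
    map_smul, map_sub, map_add, C1_single, map_mul]

theorem d3_comm (f : G →* H) : (d3 H).comp (C3 f) = (C2 f).comp (d3 G) := by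
  refine Finsupp.lhom_ext fun t n => ?_
  simp only [LinearMap.comp_apply, C3_single, d3, Finsupp.linearCombination_single,
    map_smul, map_sub, map_add, C2_single, map_mul]

theorem C2_mem_Z2 (f : G →* H) : ∀ x ∈ Z2 G, C2 f x ∈ Z2 H := by
  intro x hx
  have := congrArg (fun φ => φ x) (d2_comm f)
  simp only [LinearMap.comp_apply] at this
  simp only [Z2, LinearMap.mem_ker] at hx ⊢
  rw [this, hx, map_zero]

/-- The map induced by a group homomorphism on second homology. -/
def H2Map (f : G →* H) : H2 G →ₗ[ℤ] H2 H :=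
  Submodule.mapQ _ _ ((C2 f).restrict (C2_mem_Z2 f)) (by
    rintro ⟨x, hxZ⟩ hx
    simp only [Submodule.mem_comap, Submodule.subtype_apply] at hx ⊢
    simp only [LinearMap.restrict_apply]
    obtain ⟨w, hw⟩ := hx
    have := congrArg (fun φ => φ w) (d3_comm f)
    simp only [LinearMap.comp_apply] at this
    exact ⟨C3 f w, by rw [this, hw]⟩)

end GpH2



open Matrix

/-- The symplectic group `Sp(2g, R)`: matrices `M` (of size `2g`) with `Mᵀ * J * M = J`,
where `J` is the standard symplectic form (see `SymplecticGroup.mem_iff'`). -/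
abbrev Sp (g : ℕ) (R : Type) [CommRing R] : Submonoid (Matrix (Fin g ⊕ Fin g) (Fin g ⊕ Fin g) R) :=
  Matrix.symplecticGroup (Fin g) R

namespace SpAux

variable {g : ℕ} {R S : Type} [CommRing R] [CommRing S]

theorem J_map (f : R →+* S) : (Matrix.J (Fin g) R).map f = Matrix.J (Fin g) S := by
  ext i j
  rcases i with i | i <;> rcases j with j | j <;>
    simp [Matrix.J, Matrix.fromBlocks, Matrix.one_apply, apply_ite f]

theorem map_mem (f : R →+* S) {A : Matrix (Fin g ⊕ Fin g) (Fin g ⊕ Fin g) R}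
    (hA : A ∈ Sp g R) : A.map f ∈ Sp g S := by
  rw [SymplecticGroup.mem_iff] at hA ⊢
  rw [← J_map f, ← Matrix.transpose_map, ← Matrix.map_mul, ← Matrix.map_mul, hA]

/-- The homomorphism `Sp(2g, R) → Sp(2g, S)` induced by a ring homomorphism `R → S`
(entrywise application). -/
def SpMap (f : R →+* S) (g : ℕ) : Sp g R →* Sp g S where
  toFun A := ⟨Matrix.map A.1 f, map_mem f A.2⟩
  map_one' := Subtype.ext <| by
    show ((1 : Matrix _ _ R)).map f = (1 : Matrix _ _ S)
    exact Matrix.map_one f (map_zero f) (map_one f)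
  map_mul' A B := Subtype.ext <| by
    show Matrix.map (A.1 * B.1) f = Matrix.map A.1 f * Matrix.map B.1 f
    exact Matrix.map_mul

end SpAux

namespace GpH2

variable {Γ : Type} [Group Γ]

/-- The boundaries together with the bar 2-chains supported on `F × F`. -/
def relB2 (F : Set Γ) : Submodule ℤ ((Γ × Γ) →₀ ℤ) :=
  B2 Γ ⊔ Submodule.span ℤ (Set.image (fun p : Γ × Γ => Finsupp.single p (1 : ℤ)) (F ×ˢ F))

/-- The class of the bar 2-chain `(a, b)` modulo `relB2 F`. -/
def cls (F : Set Γ) (a b : Γ) : ((Γ × Γ) →₀ ℤ) ⧸ relB2 F :=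
  (relB2 F).mkQ (Finsupp.single (a, b) 1)

theorem cls_cocycle (F : Set Γ) (a b c : Γ) :
    cls F b c - cls F (a * b) c + cls F a (b * c) - cls F a b = 0 := by
  unfold cls
  rw [← map_sub, ← map_add, ← map_sub, Submodule.mkQ_apply, Submodule.Quotient.mk_eq_zero]
  refine Submodule.mem_sup_left ⟨Finsupp.single (a, b, c) 1, ?_⟩
  simp [d3]

theorem cls_eq_zero {F : Set Γ} {a b : Γ} (ha : a ∈ F) (hb : b ∈ F) : cls F a b = 0 := by
  unfold cls
  rw [Submodule.mkQ_apply, Submodule.Quotient.mk_eq_zero]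
  exact Submodule.mem_sup_right (Submodule.subset_span ⟨(a, b), ⟨ha, hb⟩, rfl⟩)

theorem H2_fg_of_Z2_le {F : Set Γ} (hF : F.Finite) (h : Z2 Γ ≤ relB2 F) :
    AddGroup.FG (H2 Γ) := by
  set P : Submodule ℤ ((Γ × Γ) →₀ ℤ) :=
    Submodule.span ℤ ((fun p : Γ × Γ => Finsupp.single p (1 : ℤ)) '' (F ×ˢ F)) with hP
  have hfg : (P.map (B2 Γ).mkQ).FG :=
    (Submodule.fg_span ((hF.prod hF).image _)).map _
  have hmap : Module.Finite ℤ ↥(P.map (B2 Γ).mkQ) := Module.Finite.iff_fg.mpr hfg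
  let φ : H2 Γ →ₗ[ℤ] ((Γ × Γ) →₀ ℤ) ⧸ B2 Γ := Submodule.mapQ _ _ (Z2 Γ).subtype le_rfl
  have hφ : Function.Injective φ := by
    rw [← LinearMap.ker_eq_bot]
    refine Submodule.ker_liftQ_eq_bot' _ _ ?_
    rw [LinearMap.ker_comp, Submodule.ker_mkQ]
  have hr : ∀ x, φ x ∈ P.map (B2 Γ).mkQ := by
    intro x
    obtain ⟨z, rfl⟩ := Submodule.Quotient.mk_surjective _ x
    obtain ⟨b, hb, p, hp, hbp⟩ := Submodule.mem_sup.1 (h z.2)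
    refine ⟨p, hp, ?_⟩
    change (B2 Γ).mkQ p = (B2 Γ).mkQ z
    rw [← hbp, map_add, Submodule.mkQ_apply _ b, (Submodule.Quotient.mk_eq_zero _).2 hb, zero_add]
  have : Module.Finite ℤ (H2 Γ) :=
    Module.Finite.of_injective (φ.codRestrict _ hr)
      (fun a b hab => hφ (congrArg Subtype.val hab))
  exact Module.Finite.iff_addGroup_fg.1 this

theorem H2_fg_of_cls_eq {F : Set Γ} (hF : F.Finite)
    (A B C : Γ → ((Γ × Γ) →₀ ℤ) ⧸ relB2 F)
    (h : ∀ a b, cls F a b = A (a * b) - B a - C b) : AddGroup.FG (H2 Γ) := by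
  refine H2_fg_of_Z2_le hF fun z hz => ?_
  have h1 : ∀ a, cls F a 1 = cls F 1 1 := fun a => by
    have := cls_cocycle F a 1 1
    simp only [mul_one] at this
    rw [sub_add_cancel, sub_eq_zero] at this
    exact this.symm
  have h2 : ∀ a, cls F 1 a = cls F 1 1 := fun a => by
    have := cls_cocycle F 1 1 a
    simp only [mul_one, one_mul] at this
    rw [sub_self, zero_add, sub_eq_zero] at this
    exact this
  set c := cls F 1 1 with hc
  have hB : ∀ a, B a = A a - C 1 - c := fun a => by
    have := h a 1
    rw [h1, mul_one] at this
    rw [this]; abel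
  have hC : ∀ a, C a = A a - B 1 - c := fun a => by
    have := h 1 a
    rw [h2, one_mul] at this
    rw [this]; abel
  set k := c + c + C 1 + B 1 with hk
  let ψ : (Γ →₀ ℤ) →ₗ[ℤ] ((Γ × Γ) →₀ ℤ) ⧸ relB2 F :=
    Finsupp.linearCombination ℤ fun a => k - A a
  have key : (relB2 F).mkQ = ψ.comp (d2 Γ) := by
    refine Finsupp.lhom_ext' fun p => LinearMap.ext_ring ?_
    obtain ⟨a, b⟩ := p
    have := h a b
    simp only [cls] at this
    simp only [LinearMap.comp_apply, Finsupp.lsingle_apply, this, d2, ψ,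
      Finsupp.linearCombination_single, one_smul, map_add, map_sub]
    rw [hB a, hC b, hk]
    abel
  rw [← Submodule.ker_mkQ (relB2 F), LinearMap.mem_ker, key, LinearMap.comp_apply,
    LinearMap.mem_ker.1 hz, map_zero]

end GpH2

namespace GpH2

open Topology unitInterval in
/-- On a contractible space, a locally constant cocycle with values in a discrete abelian group,
subordinate to an open cover, is a coboundary. -/
theorem exists_section_of_cocycle {ι X B : Type} [TopologicalSpace X] [AddCommGroup B]
    (H : C(I × X, X)) (x₀ : X) (h0 : ∀ x, H (0, x) = x₀) (h1 : ∀ x, H (1, x) = x)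
    (W : ι → Set X) (hW : ∀ i, IsOpen (W i)) (hcov : ∀ x, ∃ i, x ∈ W i) (w : ι → ι → B)
    (hw : ∀ i j k x, x ∈ W i → x ∈ W j → x ∈ W k → w i j + w j k = w i k) :
    ∃ s : ι → X → B, (∀ i j x, x ∈ W i → x ∈ W j → s j x = s i x + w i j) ∧
      ∀ i, ∀ x ∈ W i, ∀ᶠ y in 𝓝 x, s i y = s i x := by
  let _ : TopologicalSpace B := ⊥
  have : DiscreteTopology B := ⟨rfl⟩
  choose ix hix using hcov
  let Z : FiberBundleCore ι X B :=
    { baseSet := W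
      isOpen_baseSet := hW
      indexAt := ix
      mem_baseSet_at := hix
      coordChange := fun i j _ b => b + w i j
      coordChange_self := fun i x hx v => by
        have := hw i i i x hx hx hx
        simpa using this
      continuousOn_coordChange := fun i j =>
        (continuous_snd.add continuous_const).continuousOn
      coordChange_comp := fun i j k x hx v => by
        rw [add_assoc, hw i j k x hx.1.1 hx.1.2 hx.2] }
  have cov : IsCoveringMap Z.proj := FiberBundle.isCoveringMap (F := B) (E := Z.Fiber)
  let e₀ : Z.TotalSpace := ⟨x₀, (0 : B)⟩
  let f : C(X, Z.TotalSpace) := ContinuousMap.const X e₀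
  have hf : ∀ x, H (0, x) = Z.proj (f x) := fun x => h0 x
  let lft : X → Z.TotalSpace := fun x => cov.liftHomotopy H f hf (1, x)
  have hlc : Continuous lft :=
    (cov.liftHomotopy H f hf).continuous.comp (continuous_const.prodMk continuous_id)
  have hlft : ∀ x, Z.proj (lft x) = x := fun x =>
    (congr_fun (cov.liftHomotopy_lifts H f hf) (1, x)).trans (h1 x)
  refine ⟨fun i x => (Z.localTriv i (lft x)).2, fun i j x hi hj => ?_, fun i x hi => ?_⟩
  · simp only [FiberBundleCore.localTriv_apply]
    change _ + w _ _ = _ + w _ _ + w _ _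
    have hp : (lft x).1 = x := hlft x
    rw [hp]
    have e := hw _ i j x (hix x) hi hj
    have aux : ∀ b : B, b + w (ix x) j = b + w (ix x) i + w i j := fun b => by
      rw [add_assoc, e]
    exact aux _
  · have hs : lft x ∈ (Z.localTriv i).source := by
      rw [FiberBundleCore.mem_localTriv_source]
      exact (congrArg (· ∈ W i) (hlft x)).mpr hi
    have hc : ContinuousAt (fun y => (Z.localTriv i (lft y)).2) x :=
      continuous_snd.continuousAt.comp
        (((Z.localTriv i).continuousOn.continuousAt
          ((Z.localTriv i).open_source.mem_nhds hs)).comp hlc.continuousAt)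
    exact hc.eventually (IsOpen.mem_nhds (isOpen_discrete {(Z.localTriv i (lft x)).2}) rfl)

end GpH2

namespace GpH2

open Topology unitInterval

/-- A group `Γ` acting on a contractible space `X` and on a set `V` of vertices, with open sets
`W γ L` covering `X` for every vertex `L`, and a retraction of `V` to `L₀` by small steps. -/
structure CoverData (Γ X V : Type) [Group Γ] [TopologicalSpace X] [MulAction Γ X]
    [MulAction Γ V] where
  H : C(I × X, X)
  x₀ : X
  H_zero : ∀ x, H (0, x) = x₀
  H_one : ∀ x, H (1, x) = x
  adj₁ : V → V → Prop
  adj₂ : V → V → Prop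
  adj₁_refl : ∀ L, adj₁ L L
  adj₁_trans : ∀ L L' L'', adj₁ L L' → adj₁ L' L'' → adj₂ L L''
  adj₁_smul : ∀ (γ : Γ) (L L' : V), adj₁ L L' → adj₁ (γ • L) (γ • L')
  L₀ : V
  clip : V → ℕ → V
  clip_zero : ∀ L, clip L 0 = L₀
  clip_eventually : ∀ L, ∃ n, ∀ k, n ≤ k → clip L k = L
  clip_succ : ∀ L k, adj₁ (clip L k) (clip L (k + 1))
  clip_adj : ∀ L L' k, adj₁ L L' → adj₁ (clip L k) (clip L' k)
  W : Γ → V → Set X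
  W_open : ∀ γ L, IsOpen (W γ L)
  W_cover : ∀ L x, ∃ γ, x ∈ W γ L
  W_smul : ∀ (δ γ : Γ) (L : V) (x : X), x ∈ W γ L → δ • x ∈ W (δ * γ) (δ • L)

namespace CoverData

variable {Γ X V : Type} [Group Γ] [TopologicalSpace X] [MulAction Γ X] [MulAction Γ V]
  (D : CoverData Γ X V)

/-- The differences of group elements whose sets meet for nearby vertices. -/
def diffs : Set Γ :=
  {δ | ∃ γ η L L' x, D.adj₂ L L' ∧ x ∈ D.W γ L ∧ x ∈ D.W η L' ∧ δ = γ⁻¹ * η}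

/-- The transition cocycle. -/
def trans (γ γ' : Γ) : ((Γ × Γ) →₀ ℤ) ⧸ relB2 D.diffs := cls D.diffs γ (γ⁻¹ * γ')

theorem adj₁_adj₂ {L L' : V} (h : D.adj₁ L L') : D.adj₂ L L' :=
  D.adj₁_trans L L L' (D.adj₁_refl L) h

theorem adj₂_refl (L : V) : D.adj₂ L L := D.adj₁_adj₂ (D.adj₁_refl L)

theorem mem_diffs {γ γ' : Γ} {L L' : V} {x : X} (h : D.adj₂ L L') (hx : x ∈ D.W γ L)
    (hx' : x ∈ D.W γ' L') : γ⁻¹ * γ' ∈ D.diffs := ⟨γ, γ', L, L', x, h, hx, hx', rfl⟩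

theorem trans_add {γ γ' γ'' : Γ} (h : γ⁻¹ * γ' ∈ D.diffs) (h' : γ'⁻¹ * γ'' ∈ D.diffs) :
    D.trans γ γ' + D.trans γ' γ'' = D.trans γ γ'' := by
  have := cls_cocycle D.diffs γ (γ⁻¹ * γ') (γ'⁻¹ * γ'')
  rw [cls_eq_zero h h', mul_inv_cancel_left, show γ⁻¹ * γ' * (γ'⁻¹ * γ'') = γ⁻¹ * γ'' by group]
    at this
  unfold trans
  rw [← sub_eq_zero, ← neg_eq_zero, ← this]
  abel

theorem prop_of_locally {P : X → Prop}
    (h : ∀ (p : C(I, X)) (t : I), ∀ᶠ t' in 𝓝 t, (P (p t') ↔ P (p t))) (h₀ : P D.x₀) (x : X) :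
    P x := by
  let p : C(I, X) := D.H.comp (ContinuousMap.prodMk (ContinuousMap.id I) (ContinuousMap.const I x))
  have hl : IsLocallyConstant fun t => P (p t) :=
    (IsLocallyConstant.iff_eventually_eq _).2 fun t => (h p t).mono fun t' ht => propext ht
  have := hl.apply_eq_of_preconnectedSpace 0 1
  have e0 : p 0 = D.x₀ := D.H_zero x
  have e1 : p 1 = x := D.H_one x
  simp only [e0, e1] at this
  exact this ▸ h₀

theorem exists_sections : ∃ s : V → Γ → X → ((Γ × Γ) →₀ ℤ) ⧸ relB2 D.diffs,
    (∀ L γ γ' x, x ∈ D.W γ L → x ∈ D.W γ' L → s L γ' x = s L γ x + D.trans γ γ') ∧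
      ∀ L γ, ∀ x ∈ D.W γ L, ∀ᶠ y in 𝓝 x, s L γ y = s L γ x := by
  have := fun L => exists_section_of_cocycle D.H D.x₀ D.H_zero D.H_one (fun γ => D.W γ L)
    (fun γ => D.W_open γ L) (D.W_cover L) D.trans fun i j k x hi hj hk =>
      D.trans_add (D.mem_diffs (D.adj₂_refl L) hi hj) (D.mem_diffs (D.adj₂_refl L) hj hk)
  choose s hs using this
  exact ⟨s, fun L => (hs L).1, fun L => (hs L).2⟩

theorem exists_defect {s : V → Γ → X → ((Γ × Γ) →₀ ℤ) ⧸ relB2 D.diffs}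
    (hs : ∀ L γ γ' x, x ∈ D.W γ L → x ∈ D.W γ' L → s L γ' x = s L γ x + D.trans γ γ')
    (hl : ∀ L γ, ∀ x ∈ D.W γ L, ∀ᶠ y in 𝓝 x, s L γ y = s L γ x) (L L' : V) (h : D.adj₂ L L') :
    ∃ c, ∀ γ γ' x, x ∈ D.W γ L → x ∈ D.W γ' L' →
      s L' γ' x = s L γ x + D.trans γ γ' + c := by
  have key : ∀ γ γ' γ₁ γ₁' x, x ∈ D.W γ L → x ∈ D.W γ' L' → x ∈ D.W γ₁ L → x ∈ D.W γ₁' L' →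
      s L' γ' x - s L γ x - D.trans γ γ' = s L' γ₁' x - s L γ₁ x - D.trans γ₁ γ₁' := by
    intro γ γ' γ₁ γ₁' x h1 h2 h3 h4
    have e1 := D.trans_add (D.mem_diffs (D.adj₂_refl L) h1 h3) (D.mem_diffs h h3 h4)
    have e2 := D.trans_add (D.mem_diffs h h1 h2) (D.mem_diffs (D.adj₂_refl L') h2 h4)
    rw [hs L γ γ₁ x h1 h3, hs L' γ' γ₁' x h2 h4]
    rw [← e1] at e2
    rw [← sub_eq_zero] at e2 ⊢
    rw [← neg_eq_zero, ← e2]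
    abel
  obtain ⟨γ₀, h₀⟩ := D.W_cover L D.x₀
  obtain ⟨γ₀', h₀'⟩ := D.W_cover L' D.x₀
  refine ⟨s L' γ₀' D.x₀ - s L γ₀ D.x₀ - D.trans γ₀ γ₀', fun γ γ' x hx hx' => ?_⟩
  suffices hP : ∀ γ γ', x ∈ D.W γ L → x ∈ D.W γ' L' → s L' γ' x - s L γ x - D.trans γ γ' =
      s L' γ₀' D.x₀ - s L γ₀ D.x₀ - D.trans γ₀ γ₀' by
    rw [← hP γ γ' hx hx']; abel
  refine D.prop_of_locally (P := fun x => ∀ γ γ', x ∈ D.W γ L → x ∈ D.W γ' L' →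
    s L' γ' x - s L γ x - D.trans γ γ' =
      s L' γ₀' D.x₀ - s L γ₀ D.x₀ - D.trans γ₀ γ₀') (fun p t => ?_)
    (fun γ γ' h1 h2 => key _ _ _ _ _ h1 h2 h₀ h₀') x
  obtain ⟨γ₁, h₁⟩ := D.W_cover L (p t)
  obtain ⟨γ₁', h₁'⟩ := D.W_cover L' (p t)
  have hp := p.continuous.continuousAt (x := t)
  filter_upwards [hp.eventually (hl L γ₁ _ h₁), hp.eventually (hl L' γ₁' _ h₁'),
    hp.eventually ((D.W_open γ₁ L).mem_nhds h₁), hp.eventually ((D.W_open γ₁' L').mem_nhds h₁')]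
    with t' a1 a2 a3 a4
  constructor
  · intro hP γ γ' h1 h2
    rw [key _ _ _ _ _ h1 h2 h₁ h₁', ← hP _ _ a3 a4, a1, a2]
  · intro hP γ γ' h1 h2
    rw [key _ _ _ _ _ h1 h2 a3 a4, ← hP _ _ h₁ h₁', a1, a2]

theorem exists_compatible_sections : ∃ s : V → Γ → X → ((Γ × Γ) →₀ ℤ) ⧸ relB2 D.diffs,
    (∀ L L' γ γ' x, D.adj₁ L L' → x ∈ D.W γ L → x ∈ D.W γ' L' →
      s L' γ' x = s L γ x + D.trans γ γ') ∧
      ∀ L γ, ∀ x ∈ D.W γ L, ∀ᶠ y in 𝓝 x, s L γ y = s L γ x := by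
  obtain ⟨s, hs, hl⟩ := D.exists_sections
  have hc := D.exists_defect hs hl
  have hc' : ∀ L L', ∃ c, D.adj₂ L L' → ∀ γ γ' x, x ∈ D.W γ L → x ∈ D.W γ' L' →
      s L' γ' x = s L γ x + D.trans γ γ' + c := fun L L' => by
    by_cases h : D.adj₂ L L'
    · obtain ⟨c, hc⟩ := hc L L' h
      exact ⟨c, fun _ => hc⟩
    · exact ⟨0, fun h' => absurd h' h⟩
  choose c hc using hc'
  have cadd : ∀ L L' L'', D.adj₂ L L' → D.adj₂ L' L'' → D.adj₂ L L'' →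
      c L L' + c L' L'' = c L L'' := by
    intro L L' L'' h1 h2 h3
    obtain ⟨γ, h⟩ := D.W_cover L D.x₀
    obtain ⟨γ', h'⟩ := D.W_cover L' D.x₀
    obtain ⟨γ'', h''⟩ := D.W_cover L'' D.x₀
    have e1 := hc L L' h1 γ γ' _ h h'
    have e2 := hc L' L'' h2 γ' γ'' _ h' h''
    have e3 := hc L L'' h3 γ γ'' _ h h''
    rw [← D.trans_add (D.mem_diffs h1 h h') (D.mem_diffs h2 h' h''), e2, e1] at e3
    rw [← sub_eq_zero] at e3 ⊢
    rw [← e3]; abel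
  let q : V → ℕ → ((Γ × Γ) →₀ ℤ) ⧸ relB2 D.diffs := fun L n =>
    ∑ k ∈ Finset.range n, c (D.clip L k) (D.clip L (k + 1))
  have crefl : ∀ L, c L L = 0 := fun L => by
    have := cadd L L L (D.adj₂_refl L) (D.adj₂_refl L) (D.adj₂_refl L)
    simpa using this
  have tel : ∀ L L' n, D.adj₁ L L' → c (D.clip L n) (D.clip L' n) = q L' n - q L n := by
    intro L L' n h
    induction n with
    | zero => simp [q, D.clip_zero, crefl]
    | succ n ih =>
      have a := D.clip_adj L L' n h
      have b := D.clip_adj L L' (n + 1) h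
      have e1 := cadd _ _ _ (D.adj₁_adj₂ a) (D.adj₁_adj₂ (D.clip_succ L' n))
        (D.adj₁_trans _ _ _ a (D.clip_succ L' n))
      have e2 := cadd _ _ _ (D.adj₁_adj₂ (D.clip_succ L n)) (D.adj₁_adj₂ b)
        (D.adj₁_trans _ _ _ (D.clip_succ L n) b)
      simp only [q, Finset.sum_range_succ] at ih ⊢
      rw [← e1, ih, ← sub_eq_zero] at e2
      rw [← sub_eq_zero, ← e2]; abel
  choose n hn using D.clip_eventually
  have qconst : ∀ L m, n L ≤ m → q L m = q L (n L) := by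
    intro L m h
    induction m, h using Nat.le_induction with
    | base => rfl
    | succ m hm ih =>
      rw [← ih]
      simp only [q, Finset.sum_range_succ]
      rw [hn L m hm, hn L (m + 1) (by omega), crefl, add_zero]
  refine ⟨fun L γ x => s L γ x - q L (n L), fun L L' γ γ' x h hx hx' => ?_, fun L γ x hx => ?_⟩
  · have e1 := tel L L' (max (n L) (n L')) h
    rw [hn L _ (le_max_left _ _), hn L' _ (le_max_right _ _), qconst L _ (le_max_left _ _),
      qconst L' _ (le_max_right _ _)] at e1
    simp only [hc L L' (D.adj₁_adj₂ h) γ γ' x hx hx', e1]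
    abel
  · filter_upwards [hl L γ x hx] with y hy
    rw [hy]

variable [ContinuousConstSMul Γ X]

/-- If only finitely many differences occur, the second homology is finitely generated. -/
theorem H2_fg (hF : D.diffs.Finite) : AddGroup.FG (H2 Γ) := by
  obtain ⟨s, hs, hl⟩ := D.exists_compatible_sections
  obtain ⟨γ₀, h₀⟩ := D.W_cover D.L₀ D.x₀
  let S : Γ → ((Γ × Γ) →₀ ℤ) ⧸ relB2 D.diffs := fun γ => s (γ • D.L₀) (γ * γ₀) (γ • D.x₀)
  let good : V → X → Γ → Prop := fun L x η => ∃ κ, ∀ γ : Γ,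
    s (γ • L) (γ * η) (γ • x) = S γ + cls D.diffs γ η - cls D.diffs γ γ₀ + κ
  have step : ∀ L L' x η η', D.adj₁ L L' → x ∈ D.W η L → x ∈ D.W η' L' → good L x η →
      good L' x η' := by
    rintro L L' x η η' h hx hx' ⟨κ, hκ⟩
    refine ⟨κ + cls D.diffs η (η⁻¹ * η'), fun γ => ?_⟩
    have e := cls_cocycle D.diffs γ η (η⁻¹ * η')
    rw [hs _ _ (γ * η) (γ * η') _ (D.adj₁_smul γ _ _ h) (D.W_smul γ η L x hx)
      (D.W_smul γ η' L' x hx'), hκ γ, trans, show (γ * η)⁻¹ * (γ * η') = η⁻¹ * η' by group]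
    rw [mul_inv_cancel_left] at e
    rw [← sub_eq_zero, ← neg_eq_zero, ← e]
    abel
  have base : ∀ η, D.x₀ ∈ D.W η D.L₀ → good D.L₀ D.x₀ η := fun η hη =>
    step _ _ _ _ _ (D.adj₁_refl _) h₀ hη ⟨0, fun γ => by simp [S]⟩
  have move : ∀ x η, x ∈ D.W η D.L₀ → good D.L₀ x η := by
    intro x
    refine D.prop_of_locally (P := fun x => ∀ η, x ∈ D.W η D.L₀ → good D.L₀ x η)
      (fun p t => ?_) base x
    obtain ⟨η, hη⟩ := D.W_cover D.L₀ (p t)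
    have hU : p ⁻¹' D.W η D.L₀ ∈ 𝓝 t :=
      ((D.W_open η D.L₀).preimage p.continuous).mem_nhds hη
    obtain ⟨ε, hε, hUs⟩ := Metric.mem_nhds_iff.1 hU
    set U := Metric.ball t ε with hUdef
    have htU : t ∈ U := Metric.mem_ball_self hε
    have hUo : IsOpen U := Metric.isOpen_ball
    have hUc : IsPreconnected U := by
      rw [← Topology.IsInducing.subtypeVal.isPreconnected_image]
      have : (Subtype.val '' U : Set ℝ) = Metric.ball (t : ℝ) ε ∩ Set.Icc 0 1 := by
        ext r
        constructor
        · rintro ⟨u, hu, rfl⟩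
          exact ⟨hu, u.2⟩
        · rintro ⟨h1, h2⟩
          exact ⟨⟨r, h2⟩, h1, rfl⟩
      rw [this]
      exact ((convex_ball _ _).inter (convex_Icc 0 1)).isPreconnected
    have hconst : ∀ t' ∈ U, ∀ γ : Γ, s (γ • D.L₀) (γ * η) (γ • p t') =
        s (γ • D.L₀) (γ * η) (γ • p t) := by
      intro t' ht' γ
      let _ : TopologicalSpace (((Γ × Γ) →₀ ℤ) ⧸ relB2 D.diffs) := ⊥
      have : DiscreteTopology (((Γ × Γ) →₀ ℤ) ⧸ relB2 D.diffs) := ⟨rfl⟩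
      refine hUc.constant (f := fun t' => s (γ • D.L₀) (γ * η) (γ • p t'))
        (fun u hu => ?_) ht' htU
      have hc : ContinuousAt (fun u => γ • p u) u :=
        (p.continuous.continuousAt.const_smul γ)
      refine ContinuousAt.continuousWithinAt ?_
      exact (continuousAt_const (y := s (γ • D.L₀) (γ * η) (γ • p u))).congr
        ((hc.eventually (hl _ _ _ (D.W_smul γ η _ _ (hUs hu)))).mono fun _ h => h.symm)
    filter_upwards [hUo.mem_nhds htU] with t' ht'
    have hη' : p t' ∈ D.W η D.L₀ := hUs ht'
    have tr : ∀ a b, good D.L₀ a η → (∀ γ : Γ, s (γ • D.L₀) (γ * η) (γ • b) =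
        s (γ • D.L₀) (γ * η) (γ • a)) → good D.L₀ b η := by
      rintro a b ⟨κ, hκ⟩ hab
      exact ⟨κ, fun γ => by rw [hab, hκ]⟩
    constructor
    · intro hP η' h'
      exact step _ _ _ _ _ (D.adj₁_refl _) hη h'
        (tr _ _ (hP η hη') fun γ => (hconst t' ht' γ).symm)
    · intro hP η' h'
      exact step _ _ _ _ _ (D.adj₁_refl _) hη' h' (tr _ _ (hP η hη) (hconst t' ht'))
  have all : ∀ L x η, x ∈ D.W η L → good L x η := by
    intro L x
    have : ∀ k η, x ∈ D.W η (D.clip L k) → good (D.clip L k) x η := by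
      intro k
      induction k with
      | zero => rw [D.clip_zero]; exact move x
      | succ k ih =>
        intro η hη
        obtain ⟨η', hη'⟩ := D.W_cover (D.clip L k) x
        exact step _ _ _ _ _ (D.clip_succ L k) hη' hη (ih η' hη')
    obtain ⟨n, hn⟩ := D.clip_eventually L
    have h := this n
    rwa [hn n le_rfl] at h
  choose κ hκ using fun δ : Γ =>
    all (δ • D.L₀) (δ • D.x₀) (δ * γ₀) (D.W_smul δ γ₀ _ _ h₀)
  refine H2_fg_of_cls_eq hF (fun γ => S (γ * γ₀⁻¹)) (fun γ => S γ - cls D.diffs γ γ₀)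
    (fun η => κ (η * γ₀⁻¹)) fun a b => ?_
  have e := hκ (b * γ₀⁻¹) a
  rw [smul_smul, smul_smul, inv_mul_cancel_right] at e
  have e2 : S (a * b * γ₀⁻¹) = s ((a * (b * γ₀⁻¹)) • D.L₀) (a * b) ((a * (b * γ₀⁻¹)) • D.x₀) := by
    simp only [S, mul_assoc]
    simp
  change _ = S _ - _ - _
  rw [e2, e]
  abel

end CoverData

end GpH2

namespace NFLattice

open NumberField NumberField.InfinitePlace NumberField.mixedEmbedding Module
open NumberField.ComplexEmbedding (conjugate)
open scoped nonZeroDivisors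

variable (K : Type) [Field K] [NumberField K]

/-- Minkowski's convex body theorem for fractional ideals and boxes. -/
theorem exists_mem_ideal_lt : ∃ C : ℝ, 0 < C ∧ ∀ (I : (FractionalIdeal (𝓞 K)⁰ K)ˣ)
    (f : InfinitePlace K → ℝ), (∀ w, 0 ≤ f w) →
    C * (FractionalIdeal.absNorm (I : FractionalIdeal (𝓞 K)⁰ K) : ℝ) ≤ ∏ w, f w ^ mult w →
    ∃ a ∈ (I : FractionalIdeal (𝓞 K)⁰ K), a ≠ 0 ∧ ∀ w : InfinitePlace K, w a < f w := by
  classical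
  have hlt := minkowskiBound_lt_top K (1 : (FractionalIdeal (𝓞 K)⁰ K)ˣ)
  set M : ℝ := (minkowskiBound K (1 : (FractionalIdeal (𝓞 K)⁰ K)ˣ)).toReal with hM
  have hM0 : 0 ≤ M := ENNReal.toReal_nonneg
  refine ⟨M + 1, by linarith, fun I f hf h => ?_⟩
  let f' : InfinitePlace K → NNReal := fun w => ⟨f w, hf w⟩
  have hN : 0 < (FractionalIdeal.absNorm (I : FractionalIdeal (𝓞 K)⁰ K) : ℝ) := by
    have h1 : (0:ℚ) ≤ FractionalIdeal.absNorm (I : FractionalIdeal (𝓞 K)⁰ K) :=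
      FractionalIdeal.absNorm_nonneg _
    have h2 : FractionalIdeal.absNorm (I : FractionalIdeal (𝓞 K)⁰ K) ≠ 0 := by
      rw [ne_eq, FractionalIdeal.absNorm_eq_zero_iff]
      exact I.ne_zero
    exact_mod_cast lt_of_le_of_ne h1 h2.symm
  refine exists_ne_zero_mem_ideal_lt K (f := f') I ?_
  rw [convexBodyLT_volume]
  have e1 : minkowskiBound K I = ENNReal.ofReal
      (FractionalIdeal.absNorm (I : FractionalIdeal (𝓞 K)⁰ K) * M) := by
    rw [ENNReal.ofReal_mul hN.le, hM, ENNReal.ofReal_toReal hlt.ne, minkowskiBound, minkowskiBound,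
      volume_fundamentalDomain_fractionalIdealLatticeBasis,
      volume_fundamentalDomain_fractionalIdealLatticeBasis]
    simp [mul_assoc]
  have e2 : ((∏ w, (f' w) ^ mult w : NNReal) : ENNReal) = ENNReal.ofReal (∏ w, f w ^ mult w) := by
    rw [ENNReal.ofReal, ENNReal.coe_inj]
    refine NNReal.coe_injective ?_
    rw [Real.coe_toNNReal _ (Finset.prod_nonneg fun w _ => pow_nonneg (hf w) _)]
    rw [NNReal.coe_prod]
    exact Finset.prod_congr rfl fun w _ => NNReal.coe_pow _ _
  rw [e1]
  have e3 : (1 : ENNReal) ≤ convexBodyLTFactor K := by exact_mod_cast one_le_convexBodyLTFactor K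
  refine lt_of_lt_of_le ?_ (mul_le_mul_left e3 _)
  rw [one_mul]
  rw [e2]
  refine (ENNReal.ofReal_lt_ofReal_iff_of_nonneg (by positivity)).2 ?_
  nlinarith

variable {K}

theorem prod_embeddings_eq {a : (K →+* ℂ) → ℝ} (ha : ∀ σ, a (conjugate σ) = a σ) :
    ∏ σ, a σ = ∏ w : InfinitePlace K, a w.embedding ^ mult w := by
  classical
  rw [← Finset.prod_fiberwise Finset.univ InfinitePlace.mk a]
  refine Finset.prod_congr rfl fun w _ => ?_
  have : ∀ φ ∈ ({φ | InfinitePlace.mk φ = w} : Finset (K →+* ℂ)), a φ = a w.embedding := by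
    intro φ hφ
    rw [← (Finset.mem_filter.mp hφ).2]
    rcases embedding_mk_eq φ with h | h <;> rw [h]
    exact (ha φ).symm
  rw [Finset.prod_congr rfl this, Finset.prod_const, card_filter_mk_eq]

theorem prod_norm_eq_abs_norm (x : K) : ∏ σ : K →+* ℂ, ‖σ x‖ = |(Algebra.norm ℚ x : ℝ)| := by
  rw [prod_embeddings_eq (a := fun σ => ‖σ x‖) (fun σ => by simp)]
  have := prod_eq_abs_norm x
  push_cast at this
  rw [← this]
  simp [norm_embedding_eq]

theorem one_le_prod_norm {x : 𝓞 K} (hx : x ≠ 0) : 1 ≤ ∏ σ : K →+* ℂ, ‖σ x‖ := by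
  rw [prod_norm_eq_abs_norm]
  have h : Algebra.norm ℤ x ≠ 0 := Algebra.norm_ne_zero_iff.2 hx
  have e : (Algebra.norm ℚ (x : K)) = (Algebra.norm ℤ x : ℚ) := by
    rw [← Algebra.coe_norm_int]
  rw [e]
  have := Int.one_le_abs h
  exact_mod_cast this

theorem card_embeddings : Fintype.card (K →+* ℂ) = finrank ℚ K := Embeddings.card K ℂ

variable (K) in
/-- A family of positive weights can be levelled by a nonzero integer. -/
theorem exists_scaling : ∃ C : ℝ, 0 < C ∧ ∀ (a : (K →+* ℂ) → ℝ) (t : ℝ), (∀ σ, 0 < a σ) →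
    (∀ σ, a (conjugate σ) = a σ) → 0 < t → C * ∏ σ, a σ ≤ t ^ finrank ℚ K →
    ∃ u : 𝓞 K, u ≠ 0 ∧ ∀ σ : K →+* ℂ, ‖σ u‖ ^ 2 * a σ ≤ t := by
  obtain ⟨C, hC, h⟩ := exists_mem_ideal_lt K
  refine ⟨C ^ 2, by positivity, fun a t ha hconj ht hle => ?_⟩
  have hprod : C * (FractionalIdeal.absNorm ((1 : (FractionalIdeal (𝓞 K)⁰ K)ˣ) :
      FractionalIdeal (𝓞 K)⁰ K) : ℝ) ≤ ∏ w : InfinitePlace K, Real.sqrt (t / a w.embedding) ^ mult w := by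
    have e : (∏ w : InfinitePlace K, Real.sqrt (t / a w.embedding) ^ mult w) =
        Real.sqrt (t ^ finrank ℚ K / ∏ σ, a σ) := by
      rw [← card_embeddings, prod_embeddings_eq hconj]
      have e1 : t ^ Fintype.card (K →+* ℂ) = ∏ w : InfinitePlace K, t ^ mult w := by
        rw [← prod_embeddings_eq (a := fun _ => t) (fun _ => rfl)]
        simp
      rw [e1, ← Finset.prod_div_distrib]
      simp_rw [← div_pow]
      refine (Real.sqrt_eq_iff_mul_self_eq (Finset.prod_nonneg fun w _ => ?_)
        (Finset.prod_nonneg fun w _ => ?_)).2 ?_ |>.symm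
      · exact pow_nonneg (div_nonneg ht.le (ha _).le) _
      · positivity
      · rw [← Finset.prod_mul_distrib]
        refine Finset.prod_congr rfl fun w _ => ?_
        rw [← mul_pow, Real.mul_self_sqrt (div_nonneg ht.le (ha _).le)]
    rw [e]
    refine Real.le_sqrt_of_sq_le ?_
    have hp : 0 < ∏ σ, a σ := Finset.prod_pos fun σ _ => ha σ
    rw [le_div_iff₀ hp]
    simpa using hle
  obtain ⟨u, hu, hu0, hult⟩ := h 1 (fun w => Real.sqrt (t / a w.embedding))
    (fun w => Real.sqrt_nonneg _) hprod
  obtain ⟨u, rfl⟩ := (FractionalIdeal.mem_one_iff (𝓞 K)⁰).mp (by rwa [Units.val_one] at hu)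
  refine ⟨u, by simpa using hu0, fun σ => ?_⟩
  have hw := hult (InfinitePlace.mk σ)
  rw [InfinitePlace.apply] at hw
  have ea : a (InfinitePlace.mk σ).embedding = a σ := by
    rcases embedding_mk_eq σ with h | h <;> rw [h]
    exact hconj σ
  rw [ea] at hw
  have h2 := Real.lt_sqrt (norm_nonneg _) |>.1 hw
  rw [lt_div_iff₀ (ha σ)] at h2
  exact h2.le

variable (K) in
/-- Nonzero elements of small norm in the inverse of an ideal. -/
theorem exists_mem_ideal_norm_le : ∃ C : ℝ, 0 < C ∧ ∀ (I : (FractionalIdeal (𝓞 K)⁰ K)ˣ),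
    ∃ a ∈ (I : FractionalIdeal (𝓞 K)⁰ K), a ≠ 0 ∧ ∏ σ : K →+* ℂ, ‖σ a‖ ≤
      C * (FractionalIdeal.absNorm (I : FractionalIdeal (𝓞 K)⁰ K) : ℝ) := by
  obtain ⟨C, hC, h⟩ := exists_mem_ideal_lt K
  refine ⟨C, hC, fun I => ?_⟩
  have hN : 0 ≤ (FractionalIdeal.absNorm (I : FractionalIdeal (𝓞 K)⁰ K) : ℝ) := by
    exact_mod_cast FractionalIdeal.absNorm_nonneg (I : FractionalIdeal (𝓞 K)⁰ K)
  set R := C * (FractionalIdeal.absNorm (I : FractionalIdeal (𝓞 K)⁰ K) : ℝ) with hR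
  have hR0 : 0 ≤ R := by positivity
  set r : ℝ := R ^ ((finrank ℚ K : ℝ)⁻¹) with hr
  have hr0 : 0 ≤ r := Real.rpow_nonneg hR0 _
  have hrd : r ^ finrank ℚ K = R := Real.rpow_inv_natCast_pow hR0 finrank_pos.ne'
  have e : ∏ w : InfinitePlace K, r ^ mult w = R := by
    rw [← prod_embeddings_eq (a := fun _ => r) (fun _ => rfl), ← hrd, ← card_embeddings]
    simp
  obtain ⟨a, ha, ha0, hlt⟩ := h I (fun _ => r) (fun _ => hr0) (by rw [e])
  refine ⟨a, ha, ha0, ?_⟩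
  rw [← hrd, ← card_embeddings, ← Finset.card_univ, ← Finset.prod_const]
  refine Finset.prod_le_prod (fun _ _ => norm_nonneg _) fun σ _ => ?_
  have := hlt (InfinitePlace.mk σ)
  rw [InfinitePlace.apply] at this
  exact this.le

variable (K) in
/-- Real coordinates of conjugation-compatible families. -/
theorem exists_real_coords : ∃ (n : ℕ) (b : Fin n → 𝓞 K), ∀ a : (K →+* ℂ) → ℂ,
    (∀ σ, a (conjugate σ) = starRingEnd ℂ (a σ)) →
    ∃ r : Fin n → ℝ, ∀ σ : K →+* ℂ, a σ = ∑ i, (r i : ℂ) * σ (b i) := by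
  let e := Fintype.equivFin (Free.ChooseBasisIndex ℤ (𝓞 K))
  refine ⟨_, fun i => RingOfIntegers.basis K (e.symm i), fun a ha => ?_⟩
  let B := canonicalEmbedding.latticeBasis K
  have h1 : ∀ σ : K →+* ℂ, a σ = ∑ i, B.repr a i * σ (RingOfIntegers.basis K i) := fun σ => by
    conv_lhs => rw [← B.sum_repr a]
    simp [B, Finset.sum_apply, canonicalEmbedding.latticeBasis_apply, integralBasis_apply]
  refine ⟨fun i => (B.repr a (e.symm i)).re, fun σ => ?_⟩
  rw [e.symm.sum_comp (fun i => ((B.repr a i).re : ℂ) * σ (RingOfIntegers.basis K i))]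
  have h2 := ha σ
  have h3 : a σ = ∑ i, starRingEnd ℂ (B.repr a i) * σ (RingOfIntegers.basis K i) := by
    have := h1 (conjugate σ)
    rw [ha σ] at this
    have h4 := congrArg (starRingEnd ℂ) this
    simpa [map_sum] using h4
  have h5 : (2 : ℂ) * a σ = 2 * ∑ i, ((B.repr a i).re : ℂ) * σ (RingOfIntegers.basis K i) := by
    rw [two_mul]
    nth_rw 1 [h1 σ]
    rw [h3, ← Finset.sum_add_distrib, Finset.mul_sum]
    refine Finset.sum_congr rfl fun i _ => ?_
    rw [← add_mul, Complex.add_conj]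
    push_cast; ring
  exact mul_left_cancel₀ two_ne_zero h5

variable (K) in
/-- Approximation of conjugation-compatible families by integers. -/
theorem exists_rounding : ∃ ρ : ℝ, 1 ≤ ρ ∧ ∀ a : (K →+* ℂ) → ℂ,
    (∀ σ, a (conjugate σ) = starRingEnd ℂ (a σ)) →
    ∃ x : 𝓞 K, ∀ σ : K →+* ℂ, ‖a σ + σ x‖ ≤ ρ := by
  obtain ⟨n, b, hb⟩ := exists_real_coords K
  refine ⟨1 + ∑ i, ∑ σ : K →+* ℂ, ‖σ (b i)‖, ?_, fun a ha => ?_⟩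
  · have : 0 ≤ ∑ i, ∑ σ : K →+* ℂ, ‖σ (b i)‖ := by positivity
    linarith
  obtain ⟨r, hr⟩ := hb a ha
  refine ⟨-∑ i, ⌊r i⌋ • b i, fun σ => ?_⟩
  have e : a σ + σ ((-∑ i, ⌊r i⌋ • b i : 𝓞 K) : K) = ∑ i, ((Int.fract (r i) : ℝ) : ℂ) * σ (b i) := by
    rw [hr σ]
    push_cast [Int.fract]
    simp [map_sum, sub_mul]
    abel
  rw [e]
  refine (norm_sum_le _ _).trans ?_
  have : ∑ i, ‖((Int.fract (r i) : ℝ) : ℂ) * σ (b i)‖ ≤ ∑ i, ∑ σ : K →+* ℂ, ‖σ (b i)‖ := by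
    refine Finset.sum_le_sum fun i _ => ?_
    rw [norm_mul, Complex.norm_real, Real.norm_of_nonneg (Int.fract_nonneg _)]
    refine (mul_le_of_le_one_left (norm_nonneg _) (Int.fract_lt_one _).le).trans ?_
    exact Finset.single_le_sum (f := fun σ : K →+* ℂ => ‖σ (b i)‖) (fun _ _ => norm_nonneg _)
      (Finset.mem_univ σ)
  linarith

theorem exists_simultaneous_approx (n Q : ℕ) (hQ : 0 < Q) (r : Fin n → ℝ) :
    ∃ m : ℕ, 1 ≤ m ∧ m ≤ Q ^ n ∧ ∃ z : Fin n → ℤ, ∀ i, |m * r i - z i| ≤ 1 / Q := by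
  have hQ' : (0 : ℝ) < Q := by exact_mod_cast hQ
  let φ : Fin (Q ^ n + 1) → Fin n → Fin Q := fun m i =>
    ⟨⌊Q * Int.fract (m * r i)⌋₊, by
      rw [Nat.floor_lt (mul_nonneg hQ'.le (Int.fract_nonneg _))]
      nlinarith [Int.fract_lt_one ((m : ℝ) * r i)]⟩
  obtain ⟨m, m', hne, heq⟩ := Fintype.exists_ne_map_eq_of_card_lt φ (by simp)
  wlog hlt : m < m' generalizing m m'
  · exact this m' m hne.symm heq.symm (lt_of_le_of_ne (not_lt.1 hlt) hne.symm)
  have hlt' : (m : ℕ) < m' := hlt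
  refine ⟨m' - m, by omega, by omega, fun i => ⌊(m' : ℝ) * r i⌋ - ⌊(m : ℝ) * r i⌋, fun i => ?_⟩
  have h := congrArg Fin.val (congrFun heq i)
  simp only [φ] at h
  have e : (((m' : ℕ) - (m : ℕ) : ℕ) : ℝ) * r i - ((⌊(m' : ℝ) * r i⌋ - ⌊(m : ℝ) * r i⌋ : ℤ) : ℝ) =
      Int.fract ((m' : ℝ) * r i) - Int.fract ((m : ℝ) * r i) := by
    rw [Nat.cast_sub hlt'.le]
    push_cast [Int.fract]
    ring
  rw [e]
  have a1 := Nat.floor_le (mul_nonneg hQ'.le (Int.fract_nonneg ((m : ℝ) * r i)))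
  have a2 := Nat.lt_floor_add_one (Q * Int.fract ((m : ℝ) * r i))
  have b1 := Nat.floor_le (mul_nonneg hQ'.le (Int.fract_nonneg ((m' : ℝ) * r i)))
  have b2 := Nat.lt_floor_add_one (Q * Int.fract ((m' : ℝ) * r i))
  rw [h] at a1 a2
  rw [abs_le]
  constructor
  · rw [neg_le_iff_add_nonneg, ← mul_le_mul_iff_right₀ hQ']
    rw [mul_zero, mul_add, mul_one_div_cancel hQ'.ne', mul_sub]
    linarith
  · rw [← mul_le_mul_iff_right₀ hQ', mul_one_div_cancel hQ'.ne', mul_sub]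
    linarith

variable (K) in
/-- Dirichlet approximation for conjugation-compatible families. -/
theorem exists_dirichlet {ε : ℝ} (hε : 0 < ε) : ∃ M : ℕ, 1 ≤ M ∧ ∀ a : (K →+* ℂ) → ℂ,
    (∀ σ, a (conjugate σ) = starRingEnd ℂ (a σ)) →
    ∃ m : ℕ, 1 ≤ m ∧ m ≤ M ∧ ∃ x : 𝓞 K, ∀ σ : K →+* ℂ, ‖m * a σ + σ x‖ ≤ ε := by
  obtain ⟨n, b, hb⟩ := exists_real_coords K
  set T : ℝ := 1 + ∑ i, ∑ σ : K →+* ℂ, ‖σ (b i)‖ with hT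
  have hS0 : 0 ≤ ∑ i, ∑ σ : K →+* ℂ, ‖σ (b i)‖ := by positivity
  have hT0 : 0 < T := by linarith
  obtain ⟨Q, hQ⟩ := exists_nat_gt (T / ε)
  have hQ0 : (0 : ℝ) < Q := lt_trans (div_pos hT0 hε) hQ
  have hQ1 : 0 < Q := by exact_mod_cast hQ0
  refine ⟨Q ^ n, Nat.one_le_pow _ _ hQ1, fun a ha => ?_⟩
  obtain ⟨r, hr⟩ := hb a ha
  obtain ⟨m, h1, h2, z, hz⟩ := exists_simultaneous_approx n Q hQ1 r
  refine ⟨m, h1, h2, -∑ i, z i • b i, fun σ => ?_⟩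
  have e : m * a σ + σ ((-∑ i, z i • b i : 𝓞 K) : K) =
      ∑ i, ((m * r i - z i : ℝ) : ℂ) * σ (b i) := by
    rw [hr σ]
    simp [map_sum, sub_mul, Finset.mul_sum, mul_assoc]
    abel
  rw [e]
  refine (norm_sum_le _ _).trans ?_
  have h3 : ∑ i, ‖((m * r i - z i : ℝ) : ℂ) * σ (b i)‖ ≤
      ∑ i, 1 / Q * ∑ σ : K →+* ℂ, ‖σ (b i)‖ := by
    refine Finset.sum_le_sum fun i _ => ?_
    rw [norm_mul, Complex.norm_real, Real.norm_eq_abs]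
    refine mul_le_mul (hz i) ?_ (norm_nonneg _) (by positivity)
    exact Finset.single_le_sum (f := fun σ : K →+* ℂ => ‖σ (b i)‖) (fun _ _ => norm_nonneg _)
      (Finset.mem_univ σ)
  refine h3.trans ?_
  rw [← Finset.mul_sum, one_div, inv_mul_le_iff₀ hQ0]
  rw [div_lt_iff₀ hε] at hQ
  linarith

end NFLattice

namespace SympRed

open Sum

section Form

variable {ι : Type} [Fintype ι] [DecidableEq ι] {R : Type} [CommRing R]

/-- The standard symplectic form on column vectors. -/
def om : (ι ⊕ ι → R) →ₗ[R] (ι ⊕ ι → R) →ₗ[R] R :=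
  LinearMap.mk₂ R (fun x y => ∑ i, (x (inl i) * y (inr i) - x (inr i) * y (inl i)))
    (fun x x' y => by
      rw [← Finset.sum_add_distrib]; exact Finset.sum_congr rfl fun i _ => by simp; ring)
    (fun c x y => by
      rw [Finset.smul_sum]; exact Finset.sum_congr rfl fun i _ => by simp; ring)
    (fun x y y' => by
      rw [← Finset.sum_add_distrib]; exact Finset.sum_congr rfl fun i _ => by simp; ring)
    (fun c x y => by
      rw [Finset.smul_sum]; exact Finset.sum_congr rfl fun i _ => by simp; ring)

omit [DecidableEq ι] in
theorem om_apply (x y : ι ⊕ ι → R) :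
    om x y = ∑ i, (x (inl i) * y (inr i) - x (inr i) * y (inl i)) := rfl

omit [DecidableEq ι] in
theorem om_swap (x y : ι ⊕ ι → R) : om x y = -om y x := by
  rw [om_apply, om_apply, ← Finset.sum_neg_distrib]
  exact Finset.sum_congr rfl fun i _ => by ring

omit [DecidableEq ι] in
@[simp] theorem om_self (x : ι ⊕ ι → R) : om x x = 0 := by
  rw [om_apply]
  exact Finset.sum_eq_zero fun i _ => by ring

theorem om_single_inr (x : ι ⊕ ι → R) (i : ι) : om x (Pi.single (inr i) 1) = x (inl i) := by
  rw [om_apply, Finset.sum_eq_single i] <;> simp +contextual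

theorem om_single_inl (x : ι ⊕ ι → R) (i : ι) : om x (Pi.single (inl i) 1) = -x (inr i) := by
  rw [om_apply, Finset.sum_eq_single i] <;> simp +contextual

theorem om_single_inr_left (x : ι ⊕ ι → R) (i : ι) :
    om (Pi.single (inr i) 1) x = -x (inl i) := by rw [om_swap, om_single_inr]

theorem om_single_inl_left (x : ι ⊕ ι → R) (i : ι) :
    om (Pi.single (inl i) 1) x = x (inr i) := by rw [om_swap, om_single_inl, neg_neg]

omit [DecidableEq ι] in
theorem om_map {S : Type} [CommRing S] (f : R →+* S) (x y : ι ⊕ ι → R) :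
    om (fun i => f (x i)) (fun i => f (y i)) = f (om x y) := by
  simp [om_apply, map_sum]

theorem om_eq_J (x y : ι ⊕ ι → R) : om x y = -(x ⬝ᵥ (J ι R *ᵥ y)) := by
  simp [om_apply, dotProduct, J, mulVec, fromBlocks, one_apply, Finset.sum_sub_distrib]
  ring

theorem om_mulVec {b : Matrix (ι ⊕ ι) (ι ⊕ ι) R} (hb : b ∈ symplecticGroup ι R)
    (x y : ι ⊕ ι → R) : om (b *ᵥ x) (b *ᵥ y) = om x y := by
  rw [om_eq_J, om_eq_J, mulVec_mulVec, ← vecMul_transpose, ← dotProduct_mulVec, mulVec_mulVec,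
    ← mul_assoc, SymplecticGroup.mem_iff'.1 hb]

theorem mulVec_single (b : Matrix (ι ⊕ ι) (ι ⊕ ι) R) (j : ι ⊕ ι) :
    b *ᵥ Pi.single j 1 = bᵀ j := by ext i; simp

theorem mem_iff_om {b : Matrix (ι ⊕ ι) (ι ⊕ ι) R} : b ∈ symplecticGroup ι R ↔
    ∀ i j, om (bᵀ i) (bᵀ j) = om (Pi.single i 1) (Pi.single j (1 : R)) := by
  constructor
  · intro hb i j
    rw [← mulVec_single, ← mulVec_single, om_mulVec hb]
  · intro h
    rw [SymplecticGroup.mem_iff']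
    ext i j
    have := h i j
    rw [om_eq_J, om_eq_J, neg_inj] at this
    have e1 : (bᵀ * J ι R * b) i j = bᵀ i ⬝ᵥ (J ι R *ᵥ bᵀ j) := by
      rw [mul_assoc, mul_apply]
      rfl
    rw [e1, this]
    simp

omit [DecidableEq ι] in
theorem mulVec_eq_sum (b : Matrix (ι ⊕ ι) (ι ⊕ ι) R) (y : ι ⊕ ι → R) :
    b *ᵥ y = ∑ j, y j • bᵀ j := by
  ext k
  simp [mulVec, dotProduct, mul_comm]

end Form

section Field

variable {ι : Type} [Fintype ι] [DecidableEq ι] {K : Type} [Field K]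

/-- The matrix of the symplectic transvection `x ↦ x + c ω(x, v) v`. -/
def transvec (c : K) (v : ι ⊕ ι → K) : Matrix (ι ⊕ ι) (ι ⊕ ι) K :=
  Matrix.of fun i j => (Pi.single j 1 + (c * om (Pi.single j 1) v) • v : ι ⊕ ι → K) i

theorem transvec_mulVec (c : K) (v x : ι ⊕ ι → K) :
    transvec c v *ᵥ x = x + (c * om x v) • v := by
  have hx : x = ∑ j, x j • Pi.single j (1 : K) := by
    ext k; simp [Pi.single_apply]
  rw [mulVec_eq_sum]
  conv_rhs => rw [hx]
  simp only [map_sum, map_smul, LinearMap.sum_apply, LinearMap.smul_apply, Finset.mul_sum,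
    Finset.sum_smul]
  rw [← Finset.sum_add_distrib]
  refine Finset.sum_congr rfl fun j _ => ?_
  have : (transvec c v)ᵀ j = Pi.single j 1 + (c * om (Pi.single j 1) v) • v := rfl
  rw [this, smul_add, smul_smul]
  congr 2
  simp only [smul_eq_mul]; ring

theorem transvec_mem (c : K) (v : ι ⊕ ι → K) : transvec c v ∈ symplecticGroup ι K := by
  rw [mem_iff_om]
  intro i j
  rw [← mulVec_single, ← mulVec_single, transvec_mulVec, transvec_mulVec]
  simp only [map_add, LinearMap.add_apply, map_smul, LinearMap.smul_apply, om_self, smul_eq_mul]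
  rw [om_swap v]
  ring

theorem exists_symplectic_of_om_ne_zero {x y : ι ⊕ ι → K} (h : om x y ≠ 0) :
    ∃ A ∈ symplecticGroup ι K, A *ᵥ x = y := by
  refine ⟨transvec (om x y)⁻¹ (y - x), transvec_mem _ _, ?_⟩
  rw [transvec_mulVec]
  simp [h]

theorem exists_om_ne_zero {x : ι ⊕ ι → K} (h : x ≠ 0) : ∃ z, om x z ≠ 0 := by
  by_contra! hc
  refine h (funext fun i => ?_)
  rcases i with i | i
  · exact (om_single_inr x i).symm.trans (hc _)
  · have := hc (Pi.single (inl i) 1)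
    rw [om_single_inl] at this
    simpa using this

/-- The symplectic group acts transitively on nonzero vectors. -/
theorem exists_symplectic_map {x y : ι ⊕ ι → K} (hx : x ≠ 0) (hy : y ≠ 0) :
    ∃ A ∈ symplecticGroup ι K, A *ᵥ x = y := by
  obtain ⟨z, hxz, hzy⟩ : ∃ z, om x z ≠ 0 ∧ om z y ≠ 0 := by
    obtain ⟨u, hu⟩ := exists_om_ne_zero hx
    obtain ⟨v, hv⟩ := exists_om_ne_zero hy
    rw [om_swap, neg_ne_zero] at hv
    by_cases h1 : om u y = 0
    · by_cases h2 : om x v = 0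
      · exact ⟨u + v, by simpa [h2] using hu, by simpa [h1] using hv⟩
      · exact ⟨v, h2, hv⟩
    · exact ⟨u, hu, h1⟩
  obtain ⟨A, hA, hAx⟩ := exists_symplectic_of_om_ne_zero hxz
  obtain ⟨B, hB, hBz⟩ := exists_symplectic_of_om_ne_zero hzy
  exact ⟨B * A, mul_mem hB hA, by rw [← mulVec_mulVec, hAx, hBz]⟩

end Field

end SympRed

namespace SympRed

open Sum

section Herm

variable {Z : Type} [Fintype Z]

/-- The sesquilinear form attached to a complex matrix. -/
def hf (G : Matrix Z Z ℂ) (x y : Z → ℂ) : ℂ := star x ⬝ᵥ (G *ᵥ y)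

variable (G : Matrix Z Z ℂ)

theorem hf_add_left (x x' y : Z → ℂ) : hf G (x + x') y = hf G x y + hf G x' y := by
  simp [hf, add_dotProduct]

theorem hf_add_right (x y y' : Z → ℂ) : hf G x (y + y') = hf G x y + hf G x y' := by
  simp [hf, mulVec_add, dotProduct_add]

theorem hf_smul_left (c : ℂ) (x y : Z → ℂ) : hf G (c • x) y = star c * hf G x y := by
  simp [hf, smul_dotProduct]

theorem hf_smul_right (c : ℂ) (x y : Z → ℂ) : hf G x (c • y) = c * hf G x y := by
  simp [hf, mulVec_smul, dotProduct_smul]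

theorem hf_mulVec (A : Matrix Z Z ℂ) (x y : Z → ℂ) :
    hf (Aᴴ * G * A) x y = hf G (A *ᵥ x) (A *ᵥ y) := by
  rw [hf, hf, star_mulVec, ← dotProduct_mulVec, mulVec_mulVec, mulVec_mulVec, mul_assoc]

theorem hf_single [DecidableEq Z] (i j : Z) : hf G (Pi.single i 1) (Pi.single j 1) = G i j := by
  simp [hf]

variable {G}

theorem hf_star (hG : G.IsHermitian) (x y : Z → ℂ) : star (hf G x y) = hf G y x := by
  rw [hf, hf, star_dotProduct, star_mulVec, hG.eq, dotProduct_mulVec, star_star]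

theorem hf_self_eq (hG : G.IsHermitian) (x : Z → ℂ) : hf G x x = ((hf G x x).re : ℂ) := by
  have := hf_star hG x x
  exact (Complex.conj_eq_iff_re.1 this).symm

variable (G) in
/-- Positive definite Hermitian matrices. -/
def HPos : Prop := G.IsHermitian ∧ ∀ x : Z → ℂ, x ≠ 0 → 0 < (hf G x x).re

theorem hf_self_pos (hG : HPos G) {x : Z → ℂ} (hx : x ≠ 0) : 0 < (hf G x x).re :=
  hG.2 x hx

theorem hf_self_nonneg (hG : HPos G) (x : Z → ℂ) : 0 ≤ (hf G x x).re := by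
  by_cases hx : x = 0
  · simp [hx, hf]
  · exact (hf_self_pos hG hx).le

/-- The Schur complement of `hf G` along the vector `e`. -/
def sf (G : Matrix Z Z ℂ) (e x y : Z → ℂ) : ℂ := hf G x y - hf G x e * hf G e y / hf G e e

theorem sf_add_smul {e : Z → ℂ} (he : hf G e e ≠ 0) (x y : Z → ℂ) (c d : ℂ) :
    sf G e (x + c • e) (y + d • e) = sf G e x y := by
  simp only [sf, hf_add_left, hf_add_right, hf_smul_left, hf_smul_right]
  field_simp
  ring

theorem hf_add_smul_self (hG : G.IsHermitian) {e : Z → ℂ} (he : hf G e e ≠ 0) (y : Z → ℂ) (c : ℂ) :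
    (hf G (y + c • e) (y + c • e)).re =
      (sf G e y y).re + (hf G e e).re * ‖c + hf G e y / hf G e e‖ ^ 2 := by
  have key : hf G (y + c • e) (y + c • e) =
      sf G e y y + hf G e e * ((c + hf G e y / hf G e e) * star (c + hf G e y / hf G e e)) := by
    have h1 : star (hf G e e) = hf G e e := hf_star hG e e
    have h2 : star (hf G e y) = hf G y e := hf_star hG e y
    simp only [sf, hf_add_left, hf_add_right, hf_smul_left, hf_smul_right, star_add, star_div₀,
      h1, h2]
    field_simp
    ring
  have h3 : (c + hf G e y / hf G e e) * star (c + hf G e y / hf G e e) =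
      ((‖c + hf G e y / hf G e e‖ ^ 2 : ℝ) : ℂ) := by
    have := Complex.mul_conj' (c + hf G e y / hf G e e)
    push_cast
    exact this
  rw [key, h3, Complex.add_re, Complex.re_mul_ofReal]

theorem sf_self_nonneg (hG : HPos G) {e : Z → ℂ} (he : hf G e e ≠ 0) (y : Z → ℂ) :
    0 ≤ (sf G e y y).re := by
  have := hf_add_smul_self hG.1 he y (-(hf G e y / hf G e e))
  simp only [neg_add_cancel, norm_zero] at this
  have h2 := hf_self_nonneg hG (y + (-(hf G e y / hf G e e)) • e)
  rw [this] at h2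
  simpa using h2

theorem norm_hf_sq_le (hG : HPos G) (x y : Z → ℂ) :
    ‖hf G x y‖ ^ 2 ≤ (hf G x x).re * (hf G y y).re := by
  by_cases hx : x = 0
  · simp [hx, hf]
  have h0 := hf_self_pos hG hx
  have hne : hf G x x ≠ 0 := fun h => by simp [h] at h0
  have h1 := hf_add_smul_self hG.1 hne y 0
  have h2 := sf_self_nonneg hG hne y
  simp only [zero_smul, add_zero, zero_add, norm_div] at h1
  have h3 : ‖hf G x x‖ = (hf G x x).re := by
    rw [hf_self_eq hG.1, Complex.norm_real, Complex.ofReal_re, Real.norm_of_nonneg h0.le]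
  rw [h3, div_pow] at h1
  have h4 : (hf G x x).re * (hf G y y).re =
      (hf G x x).re * (sf G x y y).re + ‖hf G x y‖ ^ 2 := by
    rw [h1]; field_simp
  nlinarith [mul_nonneg h0.le h2]

end Herm

section Symp

variable {ι : Type} [Fintype ι] [DecidableEq ι] {G : Matrix (ι ⊕ ι) (ι ⊕ ι) ℂ}

theorem norm_om_sq_le (hG : HPos G) (hs : G ∈ symplecticGroup ι ℂ) (x y : ι ⊕ ι → ℂ) :
    ‖om x y‖ ^ 2 ≤ (hf G x x).re * (hf G y y).re := by
  have hJ : ∀ u v : ι ⊕ ι → ℂ, (J ι ℂ *ᵥ u) ⬝ᵥ v = om u v := fun u v => by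
    rw [om_swap, om_eq_J, neg_neg, dotProduct_comm]
  set z : ι ⊕ ι → ℂ := star (J ι ℂ *ᵥ (G *ᵥ x)) with hz
  have h1 : ∀ y, om x y = hf G z y := fun y => by
    rw [hf, hz, star_star, hJ, om_mulVec hs]
  have h2 : hf G z z = hf G x x := by
    have h3 : ∀ w : ι ⊕ ι → ℂ, star (J ι ℂ *ᵥ w) = J ι ℂ *ᵥ star w := fun w => by
      ext i
      rcases i with i | i <;> simp [J, mulVec, fromBlocks, one_apply, dotProduct]
    rw [← h1, hz, h3, om_eq_J, mulVec_mulVec, J_squared, neg_mulVec, one_mulVec, dotProduct_neg,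
      neg_neg, ← hf_star hG.1 x x, hf, dotProduct_star, dotProduct_comm]
  rw [h1, ← h2]
  exact norm_hf_sq_le hG z y

end Symp

end SympRed

namespace SympRed

open Sum NumberField Module NFLattice
open NumberField.ComplexEmbedding (conjugate)
open scoped nonZeroDivisors

section Family

variable {K : Type} [Field K] [NumberField K] {Z : Type} [Fintype Z]

/-- Entrywise application of an embedding to a vector. -/
def vmap (σ : K →+* ℂ) (x : Z → K) : Z → ℂ := fun i => σ (x i)

omit [NumberField K] [Fintype Z] in
theorem vmap_add (σ : K →+* ℂ) (x y : Z → K) : vmap σ (x + y) = vmap σ x + vmap σ y := by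
  ext i; simp [vmap]

omit [NumberField K] [Fintype Z] in
theorem vmap_smul (σ : K →+* ℂ) (c : K) (x : Z → K) : vmap σ (c • x) = σ c • vmap σ x := by
  ext i; simp [vmap]

omit [NumberField K] [Fintype Z] in
theorem vmap_ne_zero (σ : K →+* ℂ) {x : Z → K} (hx : x ≠ 0) : vmap σ x ≠ 0 := fun h =>
  hx (funext fun i => by simpa [vmap] using congrFun h i)

omit [NumberField K] [Fintype Z] in
theorem osmul_eq (m : 𝓞 K) (v : Z → K) : m • v = (m : K) • v := (algebraMap_smul K m v).symm

/-- The value `h_σ(x, y)` of a family of sesquilinear forms. -/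
def hs (G : (K →+* ℂ) → Matrix Z Z ℂ) (σ : K →+* ℂ) (x y : Z → K) : ℂ :=
  hf (G σ) (vmap σ x) (vmap σ y)

/-- The value `h_σ(x, x)` of a family of Hermitian forms. -/
def nu (G : (K →+* ℂ) → Matrix Z Z ℂ) (σ : K →+* ℂ) (x : Z → K) : ℝ := (hs G σ x x).re

omit [NumberField K] in
theorem nu_smul (G : (K →+* ℂ) → Matrix Z Z ℂ) (σ : K →+* ℂ) (c : K) (x : Z → K) :
    nu G σ (c • x) = ‖σ c‖ ^ 2 * nu G σ x := by
  rw [nu, nu, hs, hs, vmap_smul, hf_smul_left, hf_smul_right, ← mul_assoc]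
  have : star (σ c) * σ c = ((‖σ c‖ ^ 2 : ℝ) : ℂ) := by
    rw [mul_comm]; push_cast; exact Complex.mul_conj' _
  rw [this, Complex.re_ofReal_mul]

end Family

section Compat

variable {K : Type} [Field K] [NumberField K] {ι : Type} [Fintype ι] [DecidableEq ι]

/-- Families of positive definite symplectic Hermitian matrices indexed by the embeddings of `K`
and compatible with complex conjugation. -/
structure Compat (G : (K →+* ℂ) → Matrix (ι ⊕ ι) (ι ⊕ ι) ℂ) : Prop where
  pos : ∀ σ, HPos (G σ)
  symp : ∀ σ, G σ ∈ symplecticGroup ι ℂ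
  conj : ∀ σ, G (conjugate σ) = (G σ).map (starRingEnd ℂ)

/-- Integral full lattices `L` whose dual is contained in `N⁻¹ L`. -/
structure Lat (N : ℕ) (L : Submodule (𝓞 K) (ι ⊕ ι → K)) : Prop where
  full : ∀ v, ∃ m : 𝓞 K, m ≠ 0 ∧ m • v ∈ L
  integral : ∀ x ∈ L, ∀ y ∈ L, IsIntegral ℤ (om x y)
  dual : ∀ v, (∀ y ∈ L, IsIntegral ℤ (om v y)) → N • v ∈ L

variable {G : (K →+* ℂ) → Matrix (ι ⊕ ι) (ι ⊕ ι) ℂ}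

omit [NumberField K] in
theorem Compat.hs_conj (hG : Compat G) (σ : K →+* ℂ) (x y : ι ⊕ ι → K) :
    hs G (conjugate σ) x y = starRingEnd ℂ (hs G σ x y) := by
  simp [hs, hf, vmap, hG.conj, dotProduct, mulVec]

omit [NumberField K] in
theorem Compat.nu_conj (hG : Compat G) (σ : K →+* ℂ) (x : ι ⊕ ι → K) :
    nu G (conjugate σ) x = nu G σ x := by
  rw [nu, hG.hs_conj, Complex.conj_re, nu]

omit [NumberField K] in
theorem Compat.nu_pos (hG : Compat G) (σ : K →+* ℂ) {x : ι ⊕ ι → K} (hx : x ≠ 0) :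
    0 < nu G σ x := hf_self_pos (hG.pos σ) (vmap_ne_zero σ hx)

/-- The product over all embeddings of the values of the Hermitian forms. -/
def nuProd (G : (K →+* ℂ) → Matrix (ι ⊕ ι) (ι ⊕ ι) ℂ) (x : ι ⊕ ι → K) : ℝ := ∏ σ, nu G σ x

theorem Compat.nuProd_pos (hG : Compat G) {x : ι ⊕ ι → K} (hx : x ≠ 0) : 0 < nuProd G x :=
  Finset.prod_pos fun σ _ => hG.nu_pos σ hx

omit [DecidableEq ι] in
theorem nuProd_smul (c : K) (x : ι ⊕ ι → K) :
    nuProd G (c • x) = (∏ σ : K →+* ℂ, ‖σ c‖) ^ 2 * nuProd G x := by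
  simp only [nuProd, nu_smul, Finset.prod_mul_distrib, Finset.prod_pow]

theorem Compat.one_le_mul (hG : Compat G) {x y : ι ⊕ ι → K} (h : IsIntegral ℤ (om x y))
    (h0 : om x y ≠ 0) : 1 ≤ nuProd G x * nuProd G y := by
  have h1 := one_le_prod_norm (K := K) (x := ⟨om x y, h⟩) (fun hc => h0 (congrArg Subtype.val hc))
  have h2 : (∏ σ : K →+* ℂ, ‖σ (om x y)‖) ^ 2 ≤ nuProd G x * nuProd G y := by
    rw [← Finset.prod_pow, nuProd, nuProd, ← Finset.prod_mul_distrib]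
    refine Finset.prod_le_prod (fun σ _ => by positivity) fun σ _ => ?_
    rw [← om_map]
    exact norm_om_sq_le (hG.pos σ) (hG.symp σ) _ _
  exact (one_le_pow₀ h1).trans h2

theorem Compat.exists_almost_min [Nonempty ι] (hG : Compat G) {N : ℕ}
    {L : Submodule (𝓞 K) (ι ⊕ ι → K)} (hL : Lat N L) :
    ∃ e ∈ L, e ≠ 0 ∧ ∀ x ∈ L, x ≠ 0 → nuProd G e ≤ 2 * nuProd G x := by
  choose m hm0 hm using fun j : ι ⊕ ι => hL.full (Pi.single j 1)
  have hms : ∀ j, m j • (Pi.single j 1 : ι ⊕ ι → K) ≠ 0 := fun j h => by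
    have := congrFun h j
    simp [Algebra.smul_def] at this
    exact hm0 j this
  set D : ℝ := ∑ j, nuProd G (m j • (Pi.single j 1 : ι ⊕ ι → K)) with hD
  have hD0 : 0 < D := Finset.sum_pos (fun j _ => hG.nuProd_pos (hms j)) Finset.univ_nonempty
  have low : ∀ x ∈ L, x ≠ 0 → D⁻¹ ≤ nuProd G x := by
    intro x hx hx0
    obtain ⟨j, hj⟩ : ∃ j, om x (Pi.single j 1) ≠ 0 := by
      by_contra! hc
      refine hx0 (funext fun i => ?_)
      rcases i with i | i
      · exact (om_single_inr x i).symm.trans (hc _)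
      · have := hc (inl i)
        rw [om_single_inl] at this
        simpa using this
    have h1 : om x (m j • (Pi.single j 1 : ι ⊕ ι → K)) ≠ 0 := by
      rw [osmul_eq, map_smul, smul_eq_mul]
      exact mul_ne_zero (RingOfIntegers.coe_ne_zero_iff.2 (hm0 j)) hj
    have h2 := hG.one_le_mul (hL.integral x hx _ (hm j)) h1
    have h3 : nuProd G (m j • (Pi.single j 1 : ι ⊕ ι → K)) ≤ D :=
      Finset.single_le_sum (f := fun j => nuProd G (m j • (Pi.single j 1 : ι ⊕ ι → K)))
        (fun j _ => (hG.nuProd_pos (hms j)).le) (Finset.mem_univ j)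
    rw [inv_le_iff_one_le_mul₀ hD0]
    exact h2.trans (mul_le_mul_of_nonneg_left h3 (hG.nuProd_pos hx0).le)
  set T : Set ℝ := {r | ∃ x ∈ L, x ≠ 0 ∧ nuProd G x = r} with hT
  have hTb : BddBelow T := ⟨D⁻¹, by rintro _ ⟨x, hx, hx0, rfl⟩; exact low x hx hx0⟩
  have hTn : T.Nonempty := ⟨_, _, hm (Classical.arbitrary _), hms _, rfl⟩
  have hI : 0 < sInf T := lt_of_lt_of_le (inv_pos.2 hD0)
    (le_csInf hTn (by rintro _ ⟨x, hx, hx0, rfl⟩; exact low x hx hx0))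
  obtain ⟨_, ⟨e, he, he0, rfl⟩, hlt⟩ := exists_lt_of_csInf_lt hTn (show sInf T < 2 * sInf T by linarith)
  refine ⟨e, he, he0, fun x hx hx0 => hlt.le.trans ?_⟩
  have := csInf_le hTb ⟨x, hx, hx0, rfl⟩
  linarith

end Compat

end SympRed

namespace SympRed

open Sum NumberField Module NFLattice
open NumberField.ComplexEmbedding (conjugate)
open scoped nonZeroDivisors

section

variable (K : Type) [Field K] [NumberField K] (ι : Type) [Fintype ι] [DecidableEq ι] [Nonempty ι]

theorem exists_short_vector : ∃ D : ℝ, 1 ≤ D ∧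
    ∀ (G : (K →+* ℂ) → Matrix (ι ⊕ ι) (ι ⊕ ι) ℂ) (N : ℕ) (L : Submodule (𝓞 K) (ι ⊕ ι → K)),
      Compat G → Lat N L → ∃ e ∈ L, e ≠ 0 ∧ ∃ t : ℝ, 0 < t ∧ (∀ σ, nu G σ e ≤ t) ∧
        ∀ x ∈ L, x ≠ 0 → t ^ finrank ℚ K ≤ D * nuProd G x := by
  obtain ⟨C, hC, h⟩ := exists_scaling K
  refine ⟨max 1 (C * 2), le_max_left _ _, fun G N L hG hL => ?_⟩
  obtain ⟨e, he, he0, hmin⟩ := hG.exists_almost_min hL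
  have hd : (finrank ℚ K) ≠ 0 := finrank_pos.ne'
  have hpos : 0 < C * nuProd G e := mul_pos hC (hG.nuProd_pos he0)
  set t : ℝ := (C * nuProd G e) ^ ((finrank ℚ K : ℝ)⁻¹) with ht
  have htd : t ^ finrank ℚ K = C * nuProd G e := Real.rpow_inv_natCast_pow hpos.le hd
  have ht0 : 0 < t := Real.rpow_pos_of_pos hpos _
  obtain ⟨u, hu0, hu⟩ := h (fun σ => nu G σ e) t (fun σ => hG.nu_pos σ he0)
    (fun σ => hG.nu_conj σ e) ht0 htd.ge
  refine ⟨u • e, L.smul_mem u he, ?_, t, ht0, fun σ => ?_, fun x hx hx0 => ?_⟩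
  · rw [osmul_eq]
    exact smul_ne_zero (RingOfIntegers.coe_ne_zero_iff.2 hu0) he0
  · rw [osmul_eq, nu_smul]
    exact hu σ
  · have h1 := hmin x hx hx0
    have h2 : 0 < nuProd G x := hG.nuProd_pos hx0
    rw [htd]
    calc C * nuProd G e ≤ C * (2 * nuProd G x) := by gcongr
      _ = (C * 2) * nuProd G x := by ring
      _ ≤ _ := by gcongr; exact le_max_right _ _

omit [Nonempty ι] in
theorem exists_dual_vector {D : ℝ} (hD : 1 ≤ D) (N : ℕ) (hN : 1 ≤ N) : ∃ N₁ : ℕ, 1 ≤ N₁ ∧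
    ∀ (G : (K →+* ℂ) → Matrix (ι ⊕ ι) (ι ⊕ ι) ℂ) (L : Submodule (𝓞 K) (ι ⊕ ι → K))
      (e : ι ⊕ ι → K) (t : ℝ), Compat G → Lat N L → e ∈ L → e ≠ 0 → 0 < t →
      (∀ σ, nu G σ e ≤ t) → (∀ x ∈ L, x ≠ 0 → t ^ finrank ℚ K ≤ D * nuProd G x) →
      ∃ f ∈ L, om e f = N₁ := by
  obtain ⟨C, hC, h⟩ := exists_mem_ideal_norm_le K
  set B : ℕ := ⌈C ^ 2 * (D * N ^ (2 * finrank ℚ K))⌉₊ with hB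
  refine ⟨B.factorial, Nat.factorial_pos _, fun G L e t hG hL he he0 ht hle hmin => ?_⟩
  let 𝔟 : Ideal (𝓞 K) :=
    { carrier := {a | ∃ y ∈ L, om e y = a}
      zero_mem' := ⟨0, L.zero_mem, by simp⟩
      add_mem' := by
        rintro a b ⟨y, hy, hya⟩ ⟨z, hz, hzb⟩
        exact ⟨y + z, L.add_mem hy hz, by simp [hya, hzb]⟩
      smul_mem' := by
        rintro c a ⟨y, hy, hya⟩
        exact ⟨c • y, L.smul_mem c hy, by rw [osmul_eq, map_smul, hya]; simp⟩ }
  have hb0 : 𝔟 ≠ ⊥ := by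
    obtain ⟨z, hz⟩ := exists_om_ne_zero he0
    obtain ⟨m, hm, hmz⟩ := hL.full z
    have hi := hL.integral e he _ hmz
    intro hbot
    have hmem : (⟨om e (m • z), hi⟩ : 𝓞 K) ∈ 𝔟 := ⟨_, hmz, rfl⟩
    rw [hbot] at hmem
    have h1 : om e (m • z) = 0 := congrArg Subtype.val (Ideal.mem_bot.1 hmem)
    rw [osmul_eq, map_smul, smul_eq_mul, mul_eq_zero] at h1
    rcases h1 with h1 | h1
    · exact hm (RingOfIntegers.coe_eq_zero_iff.1 h1)
    · exact hz h1
  have hI0 : (𝔟 : FractionalIdeal (𝓞 K)⁰ K) ≠ 0 := FractionalIdeal.coeIdeal_ne_zero.2 hb0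
  obtain ⟨x, hx, hx0, hxC⟩ := h (Units.mk0 _ hI0)⁻¹
  have hxi : ∀ y ∈ L, IsIntegral ℤ (om (x • e) y) := by
    intro y hy
    have hi := hL.integral e he y hy
    have hmem : (⟨om e y, hi⟩ : 𝓞 K) ∈ 𝔟 := ⟨_, hy, rfl⟩
    have h1 : x * om e y ∈ (1 : FractionalIdeal (𝓞 K)⁰ K) := by
      have h2 := FractionalIdeal.mul_mem_mul hx
        (FractionalIdeal.mem_coeIdeal_of_mem (𝓞 K)⁰ hmem (P := K))
      have h3 : ((Units.mk0 _ hI0)⁻¹ : (FractionalIdeal (𝓞 K)⁰ K)ˣ).1 * (𝔟 : FractionalIdeal (𝓞 K)⁰ K) = 1 :=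
        Units.inv_mul (Units.mk0 _ hI0)
      rw [h3] at h2
      exact h2
    rw [map_smul, LinearMap.smul_apply, smul_eq_mul]
    obtain ⟨w, hw⟩ := (FractionalIdeal.mem_one_iff _).1 h1
    rw [← hw]
    exact w.2
  have hxL := hL.dual _ hxi
  have hNx : (N : ℕ) • (x • e) = ((N : K) * x) • e := by
    rw [← Nat.cast_smul_eq_nsmul K, smul_smul]
  rw [hNx] at hxL
  have hN0 : (N : K) ≠ 0 := by exact_mod_cast (by omega : N ≠ 0)
  have h1 := hmin _ hxL (smul_ne_zero (mul_ne_zero hN0 hx0) he0)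
  rw [nuProd_smul] at h1
  have h2 : nuProd G e ≤ t ^ finrank ℚ K := by
    rw [← card_embeddings, ← Finset.card_univ, ← Finset.prod_const, nuProd]
    exact Finset.prod_le_prod (fun σ _ => (hG.nu_pos σ he0).le) fun σ _ => hle σ
  have h3 : ∏ σ : K →+* ℂ, ‖σ ((N : K) * x)‖ = N ^ finrank ℚ K * ∏ σ : K →+* ℂ, ‖σ x‖ := by
    simp [Finset.prod_mul_distrib, card_embeddings]
  set q : ℝ := ((FractionalIdeal.absNorm (𝔟 : FractionalIdeal (𝓞 K)⁰ K) : ℚ) : ℝ) with hq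
  have hqn : q = (Ideal.absNorm 𝔟 : ℝ) := by
    rw [hq, FractionalIdeal.coeIdeal_absNorm]; simp
  have hab0 : Ideal.absNorm 𝔟 ≠ 0 := by rwa [ne_eq, Ideal.absNorm_eq_zero_iff]
  have hq1 : 1 ≤ q := by rw [hqn]; exact_mod_cast Nat.one_le_iff_ne_zero.2 hab0
  have h4 : ∏ σ : K →+* ℂ, ‖σ x‖ ≤ C / q := by
    refine hxC.trans (le_of_eq ?_)
    rw [Units.val_inv_eq_inv_val, Units.val_mk0, map_inv₀, hq, div_eq_mul_inv]
    push_cast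
    rfl
  have h5 : q ^ 2 ≤ C ^ 2 * (D * N ^ (2 * finrank ℚ K)) := by
    have htd : 0 < t ^ finrank ℚ K := by positivity
    rw [h3] at h1
    have h6 : t ^ finrank ℚ K ≤ t ^ finrank ℚ K * (D * (N ^ finrank ℚ K * (C / q)) ^ 2) := by
      refine h1.trans ?_
      have : (N ^ finrank ℚ K * ∏ σ : K →+* ℂ, ‖σ x‖) ^ 2 ≤ (N ^ finrank ℚ K * (C / q)) ^ 2 := by
        gcongr
      calc _ ≤ D * ((N ^ finrank ℚ K * (C / q)) ^ 2 * t ^ finrank ℚ K) := by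
            gcongr
            exact (hG.nuProd_pos he0).le
        _ = _ := by ring
    have h7 : 1 ≤ D * (N ^ finrank ℚ K * (C / q)) ^ 2 := by
      by_contra! hc
      nlinarith
    have h8 : D * (N ^ finrank ℚ K * (C / q)) ^ 2 = C ^ 2 * (D * N ^ (2 * finrank ℚ K)) / q ^ 2 := by
      field_simp
      ring
    rw [h8, one_le_div (by positivity)] at h7
    exact h7
  have h6 : Ideal.absNorm 𝔟 ≤ B := by
    have : q ≤ q ^ 2 := by nlinarith
    have := (this.trans h5).trans (Nat.le_ceil _)
    rw [hqn, ← hB] at this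
    exact_mod_cast this
  have h7 : ((B.factorial : ℕ) : 𝓞 K) ∈ 𝔟 := by
    obtain ⟨k, hk⟩ := Nat.dvd_factorial (Nat.pos_of_ne_zero hab0) h6
    rw [hk]
    push_cast
    exact Ideal.mul_mem_right _ _ (Ideal.absNorm_mem 𝔟)
  obtain ⟨f, hf, hef⟩ := h7
  exact ⟨f, hf, by rw [hef]; simp⟩

theorem exists_first_vectors (N : ℕ) (hN : 1 ≤ N) : ∃ c : ℝ, 0 < c ∧ ∃ N₁ : ℕ, 1 ≤ N₁ ∧
    ∀ (G : (K →+* ℂ) → Matrix (ι ⊕ ι) (ι ⊕ ι) ℂ) (L : Submodule (𝓞 K) (ι ⊕ ι → K)),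
      Compat G → Lat N L → ∃ e ∈ L, e ≠ 0 ∧ ∃ f ∈ L, om e f = N₁ ∧ ∃ t : ℝ, 0 < t ∧
        (∀ σ, nu G σ e ≤ t) ∧ (∀ σ, c * t ≤ nu G σ e) ∧
        ∀ x ∈ L, x ≠ 0 → ∃ σ, c * t ≤ nu G σ x := by
  classical
  obtain ⟨D, hD, h⟩ := exists_short_vector K ι
  obtain ⟨N₁, hN₁, h'⟩ := exists_dual_vector K ι hD N hN
  refine ⟨(2 * D)⁻¹, by positivity, N₁, hN₁, fun G L hG hL => ?_⟩
  obtain ⟨e, he, he0, t, ht, hle, hmin⟩ := h G N L hG hL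
  obtain ⟨f, hf, hef⟩ := h' G L e t hG hL he he0 ht hle hmin
  have hcard : Finset.univ.card = finrank ℚ K := card_embeddings (K := K)
  have hc1 : (2 * D)⁻¹ ≤ 1 := inv_le_one_of_one_le₀ (by linarith)
  have hd : (finrank ℚ K) ≠ 0 := finrank_pos.ne'
  have hcD : (2 * D)⁻¹ * D = 1 / 2 := by field_simp
  have htd : 0 < t ^ finrank ℚ K := by positivity
  refine ⟨e, he, he0, f, hf, hef, t, ht, hle, fun σ => ?_, fun x hx hx0 => ?_⟩
  · have h1 := hmin e he he0
    have h2 : nuProd G e ≤ nu G σ e * t ^ (finrank ℚ K - 1) := by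
      rw [nuProd, ← Finset.mul_prod_erase _ _ (Finset.mem_univ σ), ← hcard,
        ← Finset.card_erase_of_mem (Finset.mem_univ σ), ← Finset.prod_const]
      exact mul_le_mul_of_nonneg_left (Finset.prod_le_prod (fun τ _ => (hG.nu_pos τ he0).le)
        fun τ _ => hle τ) (hG.nu_pos σ he0).le
    have h3 : t ^ finrank ℚ K = t * t ^ (finrank ℚ K - 1) := by
      rw [← pow_succ', Nat.sub_add_cancel (Nat.one_le_iff_ne_zero.2 hd)]
    have h4 : t * t ^ (finrank ℚ K - 1) ≤ (D * nu G σ e) * t ^ (finrank ℚ K - 1) := by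
      rw [← h3]
      refine h1.trans ?_
      rw [mul_assoc]
      gcongr
    have h5 : t ≤ D * nu G σ e := le_of_mul_le_mul_right h4 (by positivity)
    have h6 : (2 * D)⁻¹ * t ≤ 1 / 2 * nu G σ e := by
      rw [← hcD, mul_assoc]; gcongr
    have := hG.nu_pos σ he0
    linarith
  · by_contra! hc
    have h1 := hmin x hx hx0
    have h2 : nuProd G x ≤ ((2 * D)⁻¹ * t) ^ finrank ℚ K := by
      rw [← hcard, ← Finset.prod_const]
      exact Finset.prod_le_prod (fun σ _ => (hG.nu_pos σ hx0).le) fun σ _ => (hc σ).le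
    have h3 : ((2 * D)⁻¹) ^ finrank ℚ K ≤ (2 * D)⁻¹ := pow_le_of_le_one (by positivity) hc1 hd
    have h4 : D * nuProd G x ≤ 1 / 2 * t ^ finrank ℚ K := by
      calc _ ≤ D * ((2 * D)⁻¹ * t ^ finrank ℚ K) := by
            gcongr
            refine h2.trans ?_
            rw [mul_pow]
            gcongr
        _ = _ := by rw [← hcD]; ring
    linarith

end

end SympRed

namespace SympRed

open Sum NumberField Module NFLattice
open NumberField.ComplexEmbedding (conjugate)

section Approx

variable (K : Type) [Field K] [NumberField K] (ι : Type) [Fintype ι] [DecidableEq ι]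

omit [NumberField K] in
theorem Compat.ratio_conj {K : Type} [Field K] {ι : Type} [Fintype ι] [DecidableEq ι]
    {G : (K →+* ℂ) → Matrix (ι ⊕ ι) (ι ⊕ ι) ℂ} (hG : Compat G) (e v : ι ⊕ ι → K) (σ : K →+* ℂ) :
    hs G (conjugate σ) e v / hs G (conjugate σ) e e = starRingEnd ℂ (hs G σ e v / hs G σ e e) := by
  rw [hG.hs_conj, hG.hs_conj, map_div₀]

omit [NumberField K] in
theorem Compat.hs_self {K : Type} [Field K] {ι : Type} [Fintype ι] [DecidableEq ι]
    {G : (K →+* ℂ) → Matrix (ι ⊕ ι) (ι ⊕ ι) ℂ} (hG : Compat G) (e : ι ⊕ ι → K) (σ : K →+* ℂ) :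
    hs G σ e e = (nu G σ e : ℂ) := hf_self_eq (hG.pos σ).1 _

omit [NumberField K] in
theorem Compat.hs_self_ne_zero {K : Type} [Field K] {ι : Type} [Fintype ι] [DecidableEq ι]
    {G : (K →+* ℂ) → Matrix (ι ⊕ ι) (ι ⊕ ι) ℂ} (hG : Compat G) {e : ι ⊕ ι → K} (he : e ≠ 0)
    (σ : K →+* ℂ) : hs G σ e e ≠ 0 := by
  rw [hG.hs_self]
  exact_mod_cast (hG.nu_pos σ he).ne'

theorem exists_rounded : ∃ ρ : ℝ, 1 ≤ ρ ∧
    ∀ (G : (K →+* ℂ) → Matrix (ι ⊕ ι) (ι ⊕ ι) ℂ), Compat G → ∀ e v : ι ⊕ ι → K, e ≠ 0 →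
      ∃ y : 𝓞 K, ∀ σ, ‖hs G σ e (v + y • e)‖ ≤ ρ * nu G σ e := by
  obtain ⟨ρ, hρ, h⟩ := exists_rounding K
  refine ⟨ρ, hρ, fun G hG e v he => ?_⟩
  obtain ⟨y, hy⟩ := h (fun σ => hs G σ e v / hs G σ e e) (hG.ratio_conj e v)
  refine ⟨y, fun σ => ?_⟩
  have h0 := hG.hs_self_ne_zero he σ
  have e1 : hs G σ e (v + y • e) = (hs G σ e v / hs G σ e e + σ y) * hs G σ e e := by
    rw [osmul_eq, hs, vmap_add, vmap_smul, hf_add_right, hf_smul_right]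
    change hs G σ e v + σ y * hs G σ e e = _
    field_simp
  rw [e1, norm_mul]
  have e2 : ‖hs G σ e e‖ = nu G σ e := by
    rw [hG.hs_self, Complex.norm_real, Real.norm_of_nonneg (hG.nu_pos σ he).le]
  rw [e2]
  exact mul_le_mul_of_nonneg_right (hy σ) (hG.nu_pos σ he).le

theorem exists_dirichlet_bound {c : ℝ} (hc : 0 < c) {N : ℕ} (hN : 1 ≤ N) : ∃ D : ℝ, 0 < D ∧
    ∀ (G : (K →+* ℂ) → Matrix (ι ⊕ ι) (ι ⊕ ι) ℂ) (L : Submodule (𝓞 K) (ι ⊕ ι → K))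
      (e v : ι ⊕ ι → K) (t U : ℝ), Compat G → e ∈ L → e ≠ 0 → 0 < t → (∀ σ, nu G σ e ≤ t) →
      (∀ x ∈ L, x ≠ 0 → ∃ σ, c * t ≤ nu G σ x) → N • v ∈ L →
      (∀ (m : ℕ) (y : 𝓞 K), 1 ≤ m → (m : K) • v + (y : K) • e ≠ 0) →
      (∀ σ, (sf (G σ) (vmap σ e) (vmap σ v) (vmap σ v)).re ≤ U) → t ≤ D * U := by
  have hN0 : (0 : ℝ) < N := by exact_mod_cast hN
  set ε : ℝ := √(c / (2 * N ^ 2)) with hε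
  have hε0 : 0 < ε := Real.sqrt_pos.2 (by positivity)
  have hε2 : N ^ 2 * ε ^ 2 = c / 2 := by
    rw [hε, Real.sq_sqrt (by positivity)]; field_simp
  obtain ⟨M, hM, h⟩ := exists_dirichlet K hε0
  have hM0 : (0 : ℝ) < M := by exact_mod_cast hM
  refine ⟨2 * N ^ 2 * M ^ 2 / c, by positivity, fun G L e v t U hG he he0 ht hle hmin hv hind hU => ?_⟩
  obtain ⟨m, hm1, hmM, y, hy⟩ := h (fun σ => hs G σ e v / hs G σ e e) (hG.ratio_conj e v)
  have hw0 := hind m y hm1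
  set w : ι ⊕ ι → K := (m : K) • v + (y : K) • e with hw
  have hwL : (N : K) • w ∈ L := by
    have h1 : (N : K) • w = (m : ℕ) • (N • v) + ((N : 𝓞 K) * y) • e := by
      rw [hw, osmul_eq, ← Nat.cast_smul_eq_nsmul K, ← Nat.cast_smul_eq_nsmul K, smul_add, smul_smul,
        smul_smul, smul_smul, mul_comm]
      simp
    rw [h1]
    exact L.add_mem (nsmul_mem hv m) (L.smul_mem _ he)
  have hNK : (N : K) ≠ 0 := by exact_mod_cast (by omega : N ≠ 0)
  obtain ⟨σ, hσ⟩ := hmin _ hwL (smul_ne_zero hNK hw0)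
  have hne := hG.hs_self_ne_zero he0 σ
  have e1 : nu G σ w = (m : ℝ) ^ 2 * (sf (G σ) (vmap σ e) (vmap σ v) (vmap σ v)).re +
      nu G σ e * ‖(m : ℂ) * (hs G σ e v / hs G σ e e) + σ y‖ ^ 2 := by
    have h1 := hf_add_smul_self (hG.pos σ).1 hne ((m : ℂ) • vmap σ v) (σ y)
    have h2 : vmap σ w = (m : ℂ) • vmap σ v + σ y • vmap σ e := by
      rw [hw, vmap_add, vmap_smul, vmap_smul]; simp
    have h3 : sf (G σ) (vmap σ e) ((m : ℂ) • vmap σ v) ((m : ℂ) • vmap σ v) =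
        ((m ^ 2 : ℝ) : ℂ) * sf (G σ) (vmap σ e) (vmap σ v) (vmap σ v) := by
      simp only [sf, hf_smul_left, hf_smul_right]
      simp
      ring
    rw [nu, hs, h2, h1, h3, Complex.re_ofReal_mul, hf_smul_right]
    congr 3
    rw [add_comm, mul_div_assoc]
    rfl
  rw [nu_smul, e1] at hσ
  have hS0 := sf_self_nonneg (hG.pos σ) hne (vmap σ v)
  set s := (sf (G σ) (vmap σ e) (vmap σ v) (vmap σ v)).re with hs'
  have hmM' : (m : ℝ) ≤ M := by exact_mod_cast hmM
  have h2 : (m : ℝ) ^ 2 * s ≤ M ^ 2 * U := by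
    have := hU σ
    gcongr
  have h3 : nu G σ e * ‖(m : ℂ) * (hs G σ e v / hs G σ e e) + σ y‖ ^ 2 ≤ t * ε ^ 2 := by
    have := hy σ
    have := hle σ
    gcongr
  have h4 : ‖σ (N : K)‖ ^ 2 = (N : ℝ) ^ 2 := by simp
  rw [h4] at hσ
  have h5 : c * t ≤ N ^ 2 * (M ^ 2 * U) + c / 2 * t := by
    calc c * t ≤ _ := hσ
      _ ≤ (N : ℝ) ^ 2 * (M ^ 2 * U + t * ε ^ 2) := by gcongr
      _ = _ := by rw [← hε2]; ring
  have h6 : c * t ≤ 2 * N ^ 2 * M ^ 2 * U := by linarith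
  rw [div_mul_eq_mul_div, le_div_iff₀ hc]
  linarith

end Approx

section Blocks

variable {n : ℕ}

/-- The inclusion of the middle indices. -/
def mid : Fin n ⊕ Fin n → Fin (n + 1) ⊕ Fin (n + 1) := Sum.map Fin.succ Fin.succ

theorem index_cases {P : Fin (n + 1) ⊕ Fin (n + 1) → Prop} (h0 : P (inl 0)) (h1 : P (inr 0))
    (h2 : ∀ k, P (mid k)) (z) : P z := by
  rcases z with z | z
  · exact Fin.cases h0 (fun k => h2 (inl k)) z
  · exact Fin.cases h1 (fun k => h2 (inr k)) z

theorem sum_blocks {M : Type} [AddCommMonoid M] (f : Fin (n + 1) ⊕ Fin (n + 1) → M) :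
    ∑ z, f z = f (inl 0) + f (inr 0) + ∑ k, f (mid k) := by
  rw [Fintype.sum_sum_type, Fintype.sum_sum_type, Fin.sum_univ_succ, Fin.sum_univ_succ]
  simp only [mid, Sum.map_inl, Sum.map_inr]
  abel

theorem om_blocks {R : Type} [CommRing R] (x y : Fin (n + 1) ⊕ Fin (n + 1) → R) :
    om x y = x (inl 0) * y (inr 0) - x (inr 0) * y (inl 0) +
      om (fun k => x (mid k)) (fun k => y (mid k)) := by
  rw [om_apply, om_apply, Fin.sum_univ_succ]
  rfl

/-- Extension of the scaling parameters. -/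
def tt (t : ℝ) (t' : Fin n ⊕ Fin n → ℝ) : Fin (n + 1) ⊕ Fin (n + 1) → ℝ :=
  Sum.elim (Fin.cons t fun i => t' (inl i)) (Fin.cons t⁻¹ fun i => t' (inr i))

@[simp] theorem tt_inl (t : ℝ) (t' : Fin n ⊕ Fin n → ℝ) : tt t t' (inl 0) = t := rfl
@[simp] theorem tt_inr (t : ℝ) (t' : Fin n ⊕ Fin n → ℝ) : tt t t' (inr 0) = t⁻¹ := rfl
@[simp] theorem tt_mid (t : ℝ) (t' : Fin n ⊕ Fin n → ℝ) (k) : tt t t' (mid k) = t' k := by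
  rcases k with k | k <;> rfl

theorem tt_pos {t : ℝ} (ht : 0 < t) {t' : Fin n ⊕ Fin n → ℝ} (ht' : ∀ i, 0 < t' i) (i) :
    0 < tt t t' i :=
  index_cases (P := fun i => 0 < tt t t' i) ht (inv_pos.2 ht) (fun k => by simpa using ht' k) i

theorem tt_swap {t : ℝ} {t' : Fin n ⊕ Fin n → ℝ} (ht' : ∀ i, t' i.swap = (t' i)⁻¹) (i) :
    tt t t' i.swap = (tt t t' i)⁻¹ := by
  refine index_cases (P := fun i => tt t t' i.swap = (tt t t' i)⁻¹) ?_ ?_ (fun k => ?_) i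
  · rfl
  · simp
  · have : (mid k).swap = mid k.swap := by rcases k with k | k <;> rfl
    simp only [this, tt_mid, ht' k]

/-- Entries of the Schur complement. -/
def sc (G : Matrix (Fin (n + 1) ⊕ Fin (n + 1)) (Fin (n + 1) ⊕ Fin (n + 1)) ℂ)
    (i j : Fin (n + 1) ⊕ Fin (n + 1)) : ℂ :=
  G i j - G i (inl 0) * G (inl 0) j / G (inl 0) (inl 0)

variable {G : Matrix (Fin (n + 1) ⊕ Fin (n + 1)) (Fin (n + 1) ⊕ Fin (n + 1)) ℂ}

theorem sc_left (h0 : G (inl 0) (inl 0) ≠ 0) (j) : sc G (inl 0) j = 0 := by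
  rw [sc]; field_simp; ring

theorem sc_right (h0 : G (inl 0) (inl 0) ≠ 0) (i) : sc G i (inl 0) = 0 := by
  rw [sc]; field_simp; ring

theorem norm_sc_comm (hH : G.IsHermitian) (i j) : ‖sc G i j‖ = ‖sc G j i‖ := by
  have h : ∀ i j, star (G i j) = G j i := fun i j => hH.apply j i
  rw [← norm_star]
  congr 1
  simp only [sc, star_sub, star_div₀, star_mul', h]
  ring

theorem om_norm_le (x y : Fin n ⊕ Fin n → ℂ) {a : ℝ} (hx : ∀ k, ‖x k‖ ≤ a) :
    ‖om x y‖ ≤ a * ∑ k, ‖y k‖ := by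
  rw [om_apply, Fintype.sum_sum_type, mul_add, Finset.mul_sum, Finset.mul_sum,
    ← Finset.sum_add_distrib]
  refine (norm_sum_le _ _).trans (Finset.sum_le_sum fun i _ => ?_)
  refine (norm_sub_le _ _).trans ?_
  rw [norm_mul, norm_mul, add_comm]
  gcongr <;> apply hx

theorem norm_sc_last_le (hs : G ∈ symplecticGroup (Fin (n + 1)) ℂ) (hH : G.IsHermitian)
    {ρ : ℝ} (h0 : G (inl 0) (inl 0) ≠ 0) (hρ : ∀ j, ‖G (inl 0) j‖ ≤ ρ * ‖G (inl 0) (inl 0)‖) (j) :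
    ‖sc G (inr 0) j‖ ≤ (if j = inr 0 then ‖G (inl 0) (inl 0)‖⁻¹ else 0) +
      ρ * ∑ k, ‖sc G (mid k) j‖ := by
  have h1 : om (fun k => G k (inl 0)) (fun k => sc G k j) = if j = inr 0 then 1 else 0 := by
    have e1 : (fun k => sc G k j) = Gᵀ j - (G (inl 0) j / G (inl 0) (inl 0)) • Gᵀ (inl 0) := by
      ext k; simp [sc]; ring
    have e2 : (fun k => G k (inl 0)) = Gᵀ (inl 0) := rfl
    rw [e1, e2, map_sub, map_smul, om_self, mem_iff_om.1 hs, om_single_inl_left]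
    simp [Pi.single_apply, eq_comm]
  rw [om_blocks, sc_left h0] at h1
  set τ := G (inl 0) (inl 0) with hτ
  have h2 : sc G (inr 0) j = ((if j = inr 0 then 1 else 0) -
      om (fun k => G (mid k) (inl 0)) (fun k => sc G (mid k) j)) / τ := by
    rw [← h1]; field_simp; ring
  have hτ0 : 0 < ‖τ‖ := norm_pos_iff.2 h0
  have h3 : ‖om (fun k => G (mid k) (inl 0)) (fun k => sc G (mid k) j)‖ ≤
      (ρ * ‖τ‖) * ∑ k, ‖sc G (mid k) j‖ := by
    refine om_norm_le _ _ fun k => ?_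
    rw [← norm_star, hH.apply]
    exact hρ _
  rw [h2, norm_div, div_le_iff₀ hτ0]
  refine (norm_sub_le _ _).trans ?_
  rw [add_mul]
  refine add_le_add ?_ (h3.trans (le_of_eq (by ring)))
  split_ifs <;> simp [hτ0.ne']

theorem norm_sc_le (hs : G ∈ symplecticGroup (Fin (n + 1)) ℂ) (hH : G.IsHermitian)
    {ρ C D c t : ℝ} {t' : Fin n ⊕ Fin n → ℝ} (hC : 0 < C) (hD : 0 < D) (hc : 0 < c) (ht : 0 < t)
    (ht' : ∀ k, 0 < t' k) (hsw : ∀ k, t' k.swap = (t' k)⁻¹) (hρ1 : 1 ≤ ρ)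
    (h0 : c * t ≤ ‖G (inl 0) (inl 0)‖) (hρ : ∀ j, ‖G (inl 0) j‖ ≤ ρ * ‖G (inl 0) (inl 0)‖)
    (hS : ∀ j k, ‖sc G (mid j) (mid k)‖ ≤ C * min (t' j) (t' k)) (htt : ∀ k, t ≤ D * t' k) (i j) :
    ‖sc G i j‖ ≤ (C + ρ * (2 * n * C) * (1 + D) + (c⁻¹ + ρ * (2 * n * (ρ * (2 * n * C) * (1 + D))))) * min (tt t t' i) (tt t t' j) := by
  have hne : G (inl 0) (inl 0) ≠ 0 := fun h => by
    rw [h, norm_zero] at h0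
    have := mul_pos hc ht
    linarith
  have hcard : (Finset.univ : Finset (Fin n ⊕ Fin n)).card = 2 * n := by simp; ring
  have hinv : ∀ k, t' k ≤ D * t⁻¹ := fun k => by
    have h1 := htt k.swap
    rw [hsw] at h1
    have h2 := ht' k
    have : t * t' k ≤ D := by
      calc t * t' k ≤ D * (t' k)⁻¹ * t' k := by gcongr
        _ = D := by field_simp
    rw [← div_eq_mul_inv, le_div_iff₀ ht]
    linarith
  have htinv : 0 < t⁻¹ := inv_pos.2 ht
  have hn : (0 : ℝ) ≤ n := Nat.cast_nonneg n
  set A := ρ * (2 * n * C) * (1 + D) with hA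
  have hA0 : 0 ≤ A := by positivity
  have hB0 : 0 ≤ c⁻¹ + ρ * (2 * n * A) := by positivity
  have hmidf : ∀ k, ‖sc G (inr 0) (mid k)‖ ≤ A * min (t' k) t⁻¹ := by
    intro k
    have h1 := norm_sc_last_le hs hH hne hρ (mid k)
    have hk : mid k ≠ inr 0 := by
      rcases k with k | k <;> simp [mid]
    rw [if_neg hk, zero_add] at h1
    have h2 : ∑ l, ‖sc G (mid l) (mid k)‖ ≤ 2 * n * C * t' k := by
      calc _ ≤ ∑ l : Fin n ⊕ Fin n, C * t' k := Finset.sum_le_sum fun l _ =>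
            (hS l k).trans (by gcongr; exact min_le_right _ _)
        _ = _ := by rw [Finset.sum_const, hcard]; simp; ring
    have h3 : ∑ l, ‖sc G (mid l) (mid k)‖ ≤ 2 * n * C * (D * t⁻¹) := by
      calc _ ≤ ∑ l : Fin n ⊕ Fin n, C * (D * t⁻¹) := Finset.sum_le_sum fun l _ =>
            (hS l k).trans (by gcongr; exact (min_le_left _ _).trans (hinv l))
        _ = _ := by rw [Finset.sum_const, hcard]; simp; ring
    rw [mul_min_of_nonneg _ _ hA0]
    refine h1.trans (le_min ?_ ?_)
    · calc _ ≤ ρ * (2 * n * C * t' k) := by gcongr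
        _ = ρ * (2 * n * C) * 1 * t' k := by ring
        _ ≤ _ := by have := (ht' k).le; rw [hA]; gcongr; linarith
    · calc _ ≤ ρ * (2 * n * C * (D * t⁻¹)) := by gcongr
        _ = ρ * (2 * n * C) * D * t⁻¹ := by ring
        _ ≤ _ := by rw [hA]; gcongr; linarith
  have hff : ‖sc G (inr 0) (inr 0)‖ ≤ (c⁻¹ + ρ * (2 * n * A)) * t⁻¹ := by
    have h1 := norm_sc_last_le hs hH hne hρ (inr 0)
    rw [if_pos rfl] at h1
    have h2 : ∑ l, ‖sc G (mid l) (inr 0)‖ ≤ 2 * n * A * t⁻¹ := by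
      calc _ ≤ ∑ l : Fin n ⊕ Fin n, A * t⁻¹ := Finset.sum_le_sum fun l _ => by
            rw [norm_sc_comm hH]
            exact (hmidf l).trans (by gcongr; exact min_le_right _ _)
        _ = _ := by rw [Finset.sum_const, hcard]; simp; ring
    have h3 : ‖G (inl 0) (inl 0)‖⁻¹ ≤ c⁻¹ * t⁻¹ := by
      rw [← mul_inv]
      exact inv_anti₀ (mul_pos hc ht) h0
    calc _ ≤ c⁻¹ * t⁻¹ + ρ * (2 * n * A * t⁻¹) := h1.trans (by gcongr)
      _ = _ := by ring
  have hpos : ∀ i, 0 < tt t t' i := tt_pos ht ht'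
  have hCA : 0 ≤ C + A + (c⁻¹ + ρ * (2 * n * A)) := by positivity
  revert i j
  refine index_cases (fun j => ?_) (index_cases ?_ ?_ fun k => ?_) fun k => (index_cases ?_ ?_ fun l => ?_)
  · rw [sc_left hne, norm_zero]
    exact mul_nonneg hCA (le_min (hpos _).le (hpos _).le)
  · rw [sc_right hne, norm_zero]
    exact mul_nonneg hCA (le_min (hpos _).le (hpos _).le)
  · simp only [tt_inr, min_self]
    exact hff.trans (mul_le_mul_of_nonneg_right (by linarith) htinv.le)
  · simp only [tt_inr, tt_mid]
    rw [min_comm]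
    exact (hmidf k).trans (mul_le_mul_of_nonneg_right (by linarith) (le_min (ht' k).le htinv.le))
  · rw [sc_right hne, norm_zero]
    exact mul_nonneg hCA (le_min (hpos _).le (hpos _).le)
  · simp only [tt_inr, tt_mid]
    rw [norm_sc_comm hH]
    exact (hmidf k).trans (mul_le_mul_of_nonneg_right (by linarith) (le_min (ht' k).le htinv.le))
  · simp only [tt_mid]
    exact (hS k l).trans (mul_le_mul_of_nonneg_right (by linarith) (le_min (ht' k).le (ht' l).le))

theorem norm_entry_le {ρ C D t : ℝ} {s : Fin (n + 1) ⊕ Fin (n + 1) → ℝ}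
    (hρ0 : 0 ≤ ρ) (hH : G.IsHermitian) (h0 : G (inl 0) (inl 0) ≠ 0)
    (hle : ‖G (inl 0) (inl 0)‖ ≤ t) (hρ : ∀ j, ‖G (inl 0) j‖ ≤ ρ * ‖G (inl 0) (inl 0)‖)
    (hS : ∀ i j, ‖sc G i j‖ ≤ C * min (s i) (s j)) (hs : ∀ i, t ≤ D * s i) (hD : 0 < D) (i j) :
    ‖G i j‖ ≤ (C + ρ ^ 2 * D) * min (s i) (s j) := by
  have h1 : G i j = sc G i j + G i (inl 0) * G (inl 0) j / G (inl 0) (inl 0) := by rw [sc]; ring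
  have hτ : 0 < ‖G (inl 0) (inl 0)‖ := norm_pos_iff.2 h0
  have h2 : ‖G i (inl 0) * G (inl 0) j / G (inl 0) (inl 0)‖ ≤ ρ ^ 2 * t := by
    rw [norm_div, norm_mul, div_le_iff₀ hτ]
    have h3 : ‖G i (inl 0)‖ ≤ ρ * ‖G (inl 0) (inl 0)‖ := by
      rw [← norm_star, hH.apply]; exact hρ i
    calc _ ≤ (ρ * ‖G (inl 0) (inl 0)‖) * (ρ * ‖G (inl 0) (inl 0)‖) :=
          mul_le_mul h3 (hρ j) (norm_nonneg _) (by positivity)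
      _ = ρ ^ 2 * ‖G (inl 0) (inl 0)‖ * ‖G (inl 0) (inl 0)‖ := by ring
      _ ≤ _ := by gcongr
  have h4 : t ≤ D * min (s i) (s j) := by
    rw [mul_min_of_nonneg _ _ hD.le]; exact le_min (hs i) (hs j)
  rw [h1, add_mul]
  refine (norm_add_le _ _).trans (add_le_add (hS i j) (h2.trans ?_))
  rw [mul_assoc]
  gcongr

end Blocks

end SympRed

namespace SympRed

open Sum NumberField Module NFLattice
open NumberField.ComplexEmbedding (conjugate)

section Congr

variable {ι : Type} [Fintype ι] [DecidableEq ι]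

theorem map_mem_symplecticGroup {R S : Type} [CommRing R] [CommRing S] (f : R →+* S)
    {A : Matrix (ι ⊕ ι) (ι ⊕ ι) R} (hA : A ∈ symplecticGroup ι R) :
    A.map f ∈ symplecticGroup ι S := by
  rw [mem_iff_om] at hA ⊢
  intro i j
  have h1 : ∀ k, (A.map f)ᵀ k = fun l => f (Aᵀ k l) := fun k => rfl
  have h2 : ∀ k, (Pi.single k (1 : S) : ι ⊕ ι → S) = fun l => f ((Pi.single k (1 : R) : ι ⊕ ι → R) l) :=
    fun k => by ext l; simp [Pi.single_apply, apply_ite f]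
  rw [h1, h1, om_map, hA, h2, h2, om_map]

theorem conjTranspose_mem {A : Matrix (ι ⊕ ι) (ι ⊕ ι) ℂ} (hA : A ∈ symplecticGroup ι ℂ) :
    Aᴴ ∈ symplecticGroup ι ℂ :=
  map_mem_symplecticGroup (starRingEnd ℂ) (SymplecticGroup.transpose_mem hA)

theorem HPos.congr {G A : Matrix (ι ⊕ ι) (ι ⊕ ι) ℂ} (hG : HPos G) (hA : IsUnit A.det) :
    HPos (Aᴴ * G * A) := by
  refine ⟨isHermitian_conjTranspose_mul_mul A hG.1, fun x hx => ?_⟩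
  rw [hf_mulVec]
  refine hG.2 _ fun h => hx ?_
  have : A⁻¹ *ᵥ (A *ᵥ x) = 0 := by rw [h, mulVec_zero]
  rwa [mulVec_mulVec, nonsing_inv_mul _ hA, one_mulVec] at this

variable {K : Type} [Field K]

/-- The change of basis for families of Hermitian matrices. -/
def cong (G : (K →+* ℂ) → Matrix (ι ⊕ ι) (ι ⊕ ι) ℂ) (b : Matrix (ι ⊕ ι) (ι ⊕ ι) K)
    (σ : K →+* ℂ) : Matrix (ι ⊕ ι) (ι ⊕ ι) ℂ :=
  (b.map σ)ᴴ * G σ * b.map σ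

theorem Compat.cong {G : (K →+* ℂ) → Matrix (ι ⊕ ι) (ι ⊕ ι) ℂ} (hG : Compat G)
    {b : Matrix (ι ⊕ ι) (ι ⊕ ι) K} (hb : b ∈ symplecticGroup ι K) : Compat (cong G b) where
  pos σ := (hG.pos σ).congr (SymplecticGroup.symplectic_det (map_mem_symplecticGroup σ hb))
  symp σ := mul_mem (mul_mem (conjTranspose_mem (map_mem_symplecticGroup σ hb)) (hG.symp σ))
    (map_mem_symplecticGroup σ hb)
  conj σ := by
    have h1 : b.map (conjugate σ) = (b.map σ).map (starRingEnd ℂ) := by ext; simp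
    rw [SympRed.cong, SympRed.cong, hG.conj, h1, Matrix.map_mul, Matrix.map_mul]
    rfl

omit [DecidableEq ι] in
theorem hs_cong (G : (K →+* ℂ) → Matrix (ι ⊕ ι) (ι ⊕ ι) ℂ) (b : Matrix (ι ⊕ ι) (ι ⊕ ι) K)
    (σ : K →+* ℂ) (x y : ι ⊕ ι → K) : hs (cong G b) σ x y = hs G σ (b *ᵥ x) (b *ᵥ y) := by
  have : ∀ x, vmap σ (b *ᵥ x) = b.map σ *ᵥ vmap σ x := fun x => by
    ext i; simp [vmap, mulVec, dotProduct]
  rw [hs, hs, cong, hf_mulVec, this, this]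

theorem cong_apply (G : (K →+* ℂ) → Matrix (ι ⊕ ι) (ι ⊕ ι) ℂ) (b : Matrix (ι ⊕ ι) (ι ⊕ ι) K)
    (σ : K →+* ℂ) (i j) : cong G b σ i j = hs G σ (bᵀ i) (bᵀ j) := by
  have h : ∀ i, vmap σ (Pi.single i (1 : K) : ι ⊕ ι → K) = Pi.single i 1 := fun i => by
    ext l; simp [vmap, Pi.single_apply, apply_ite σ]
  rw [← mulVec_single, ← mulVec_single, ← hs_cong, hs, h, h, hf_single]

end Congr

section Middle

variable {n : ℕ} {R : Type} [CommRing R]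

/-- Extension of a family indexed by the middle indices by two further values. -/
def ext2 {M : Type} (a b : M) (y : Fin n ⊕ Fin n → M) : Fin (n + 1) ⊕ Fin (n + 1) → M :=
  Sum.elim (Fin.cons a fun i => y (inl i)) (Fin.cons b fun i => y (inr i))

section
variable {M : Type} (a b : M) (y : Fin n ⊕ Fin n → M)
@[simp] theorem ext2_inl : ext2 a b y (inl 0) = a := rfl
@[simp] theorem ext2_inr : ext2 a b y (inr 0) = b := rfl
@[simp] theorem ext2_mid (k) : ext2 a b y (mid k) = y k := by rcases k with k | k <;> rfl
end

/-- The first basis vector. -/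
def ve (n : ℕ) (R : Type) [CommRing R] : Fin (n + 1) ⊕ Fin (n + 1) → R := Pi.single (inl 0) 1

/-- The inclusion of the middle coordinates. -/
def embv : (Fin n ⊕ Fin n → R) →ₗ[R] (Fin (n + 1) ⊕ Fin (n + 1) → R) where
  toFun y := ext2 0 0 y
  map_add' x y := by
    ext z; revert z
    exact index_cases (by simp) (by simp) (by simp)
  map_smul' c x := by
    ext z; revert z
    exact index_cases (by simp) (by simp) (by simp)

@[simp] theorem embv_inl (y : Fin n ⊕ Fin n → R) : embv y (inl 0) = 0 := rfl
@[simp] theorem embv_inr (y : Fin n ⊕ Fin n → R) : embv y (inr 0) = 0 := rfl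
@[simp] theorem embv_mid (y : Fin n ⊕ Fin n → R) (k) : embv y (mid k) = y k := ext2_mid _ _ _ k

theorem mid_ne_inl (k : Fin n ⊕ Fin n) : mid k ≠ inl 0 := by rcases k with k | k <;> simp [mid]
theorem mid_ne_inr (k : Fin n ⊕ Fin n) : mid k ≠ inr 0 := by rcases k with k | k <;> simp [mid]

@[simp] theorem ve_inl : ve n R (inl 0) = 1 := by simp [ve]
@[simp] theorem ve_inr : ve n R (inr 0) = 0 := by simp [ve]
@[simp] theorem ve_mid (k) : ve n R (mid k) = 0 := by simp [ve, mid_ne_inl]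

theorem om_ve (x : Fin (n + 1) ⊕ Fin (n + 1) → R) : om (ve n R) x = x (inr 0) :=
  om_single_inl_left x 0

theorem om_embv (x y : Fin n ⊕ Fin n → R) : om (embv x) (embv y) = om x y := by
  rw [om_blocks]; simp

theorem om_ve_embv (y : Fin n ⊕ Fin n → R) : om (ve n R) (embv y) = 0 := by
  rw [om_ve]; simp

theorem om_embv_ve (y : Fin n ⊕ Fin n → R) : om (embv y) (ve n R) = 0 := by
  rw [om_swap, om_ve_embv, neg_zero]

theorem embv_single (k : Fin n ⊕ Fin n) :
    embv (Pi.single k (1 : R)) = Pi.single (mid k) (1 : R) := by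
  have hinj : Function.Injective (mid (n := n)) :=
    Sum.map_injective.2 ⟨Fin.succ_injective n, Fin.succ_injective n⟩
  ext z; revert z
  refine index_cases ?_ ?_ fun l => ?_
  · simp [(mid_ne_inl k).symm]
  · simp [(mid_ne_inr k).symm]
  · simp [Pi.single_apply, hinj.eq_iff]

theorem eq_embv {x : Fin (n + 1) ⊕ Fin (n + 1) → R} (hx : x (inr 0) = 0) :
    x = x (inl 0) • ve n R + embv fun k => x (mid k) := by
  ext z; revert z
  exact index_cases (by simp) (by simp [hx]) (by simp)

variable {G : Matrix (Fin (n + 1) ⊕ Fin (n + 1)) (Fin (n + 1) ⊕ Fin (n + 1)) ℂ}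

/-- The Schur complement as a matrix on the middle indices. -/
def schur (G : Matrix (Fin (n + 1) ⊕ Fin (n + 1)) (Fin (n + 1) ⊕ Fin (n + 1)) ℂ) :
    Matrix (Fin n ⊕ Fin n) (Fin n ⊕ Fin n) ℂ := Matrix.of fun j k => sc G (mid j) (mid k)

theorem hf_eq_sum {Z : Type} [Fintype Z] (G : Matrix Z Z ℂ) (x y : Z → ℂ) :
    hf G x y = ∑ i, ∑ j, star (x i) * (G i j * y j) := by
  simp [hf, dotProduct, mulVec, Finset.mul_sum]

theorem hf_ve_left (y) : hf G (ve n ℂ) y = ∑ j, G (inl 0) j * y j := by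
  rw [hf_eq_sum, Finset.sum_eq_single (inl 0)]
  · simp
  · intro b _ hb; simp [ve, hb]
  · simp

theorem hf_ve_right (x) : hf G x (ve n ℂ) = ∑ i, star (x i) * G i (inl 0) := by
  rw [hf_eq_sum]
  refine Finset.sum_congr rfl fun i _ => ?_
  rw [Finset.sum_eq_single (inl 0)]
  · simp
  · intro b _ hb; simp [ve, hb]
  · simp

theorem hf_ve : hf G (ve n ℂ) (ve n ℂ) = G (inl 0) (inl 0) := hf_single _ _ _

theorem hf_schur (x y : Fin n ⊕ Fin n → ℂ) :
    hf (schur G) x y = sf G (ve n ℂ) (embv x) (embv y) := by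
  rw [sf, hf_ve, hf_ve_left, hf_ve_right, hf_eq_sum, hf_eq_sum]
  simp only [sum_blocks, embv_inl, embv_inr, embv_mid, star_zero, zero_mul, mul_zero,
    Finset.sum_const_zero, zero_add, add_zero]
  rw [Finset.sum_mul_sum, Finset.sum_div, ← Finset.sum_sub_distrib]
  refine Finset.sum_congr rfl fun i _ => ?_
  rw [Finset.sum_div, ← Finset.sum_sub_distrib]
  refine Finset.sum_congr rfl fun j _ => ?_
  simp only [schur, of_apply, sc]
  ring

theorem HPos.schur (hG : HPos G) : HPos (schur G) := by
  have hve : ve n ℂ ≠ 0 := fun h => by simpa using congrFun h (inl 0)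
  have hτ := hf_self_pos hG hve
  have hne : hf G (ve n ℂ) (ve n ℂ) ≠ 0 := fun h => by simp [h] at hτ
  refine ⟨?_, fun y hy => ?_⟩
  · ext j k
    have h : ∀ i j, star (G i j) = G j i := fun i j => hG.1.apply j i
    simp only [SympRed.schur, conjTranspose_apply, of_apply, sc, star_sub, star_div₀, star_mul', h]
    ring
  · rw [hf_schur]
    have h1 := hf_add_smul_self hG.1 hne (embv y) (-(hf G (ve n ℂ) (embv y) / hf G (ve n ℂ) (ve n ℂ)))
    rw [neg_add_cancel, norm_zero, zero_pow two_ne_zero, mul_zero, add_zero] at h1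
    rw [← h1]
    refine hf_self_pos hG fun h => hy (funext fun k => ?_)
    simpa using congrFun h (mid k)

theorem schur_symp (hs : G ∈ symplecticGroup (Fin (n + 1)) ℂ) (h0 : G (inl 0) (inl 0) ≠ 0) :
    schur G ∈ symplecticGroup (Fin n) ℂ := by
  rw [mem_iff_om] at hs ⊢
  intro j k
  have e1 : ∀ j, (fun l => sc G l j) = Gᵀ j - (G (inl 0) j / G (inl 0) (inl 0)) • Gᵀ (inl 0) := by
    intro j; ext l; simp [sc]; ring
  have e2 : om (fun l => sc G l (mid j)) (fun l => sc G l (mid k)) =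
      om ((schur G)ᵀ j) ((schur G)ᵀ k) := by
    rw [om_blocks, sc_left h0, sc_left h0]
    simp; rfl
  have e3 : ∀ j : Fin n ⊕ Fin n, om (Pi.single (mid j) (1 : ℂ)) (Pi.single (inl 0) 1) = 0 := fun j => by
    rw [← embv_single]; exact om_embv_ve _
  have e4 : ∀ j : Fin n ⊕ Fin n, om (Pi.single (inl 0) 1) (Pi.single (mid j) (1 : ℂ)) = 0 := fun j => by
    rw [om_swap, e3, neg_zero]
  rw [← e2, e1, e1]
  simp only [map_sub, LinearMap.sub_apply, map_smul, LinearMap.smul_apply, hs, e3, e4, om_self]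
  rw [← embv_single, ← embv_single, om_embv]
  simp

end Middle

section FamilySchur

variable {n : ℕ} {K : Type} [Field K]

theorem vmap_ve (σ : K →+* ℂ) : vmap σ (ve n K) = ve n ℂ := by
  ext z; simp [vmap, ve, Pi.single_apply, apply_ite σ]

theorem vmap_embv (σ : K →+* ℂ) (y : Fin n ⊕ Fin n → K) :
    vmap σ (embv y) = embv (vmap σ y) := by
  ext z; revert z
  exact index_cases (by simp [vmap]) (by simp [vmap]) (by simp [vmap])

theorem ve_ne_zero : ve n K ≠ 0 := fun h => by simpa using congrFun h (inl 0)

variable {G : (K →+* ℂ) → Matrix (Fin (n + 1) ⊕ Fin (n + 1)) (Fin (n + 1) ⊕ Fin (n + 1)) ℂ}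

theorem hs_ve (σ : K →+* ℂ) : hs G σ (ve n K) (ve n K) = G σ (inl 0) (inl 0) := by
  rw [hs, vmap_ve, hf_ve]

theorem hs_schur (σ : K →+* ℂ) (x y : Fin n ⊕ Fin n → K) : hs (fun σ => schur (G σ)) σ x y =
    sf (G σ) (vmap σ (ve n K)) (vmap σ (embv x)) (vmap σ (embv y)) := by
  rw [hs, hf_schur, vmap_ve, vmap_embv, vmap_embv]

theorem Compat.schur [NumberField K] (hG : Compat G) : Compat fun σ => schur (G σ) where
  pos σ := (hG.pos σ).schur
  symp σ := schur_symp (hG.symp σ) (by rw [← hs_ve (G := G)]; exact hG.hs_self_ne_zero ve_ne_zero σ)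
  conj σ := by
    ext j k
    simp [SympRed.schur, sc, hG.conj]

end FamilySchur

section MiddleLattice

variable {n : ℕ} {K : Type} [Field K] [NumberField K]

/-- The lattice on the middle coordinates. -/
def midLat (L : Submodule (𝓞 K) (Fin (n + 1) ⊕ Fin (n + 1) → K)) :
    Submodule (𝓞 K) (Fin n ⊕ Fin n → K) where
  carrier := {y | ∃ x : K, x • ve n K + embv y ∈ L}
  zero_mem' := ⟨0, by simp⟩
  add_mem' := by
    rintro y z ⟨a, ha⟩ ⟨b, hb⟩
    refine ⟨a + b, ?_⟩
    have := L.add_mem ha hb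
    rwa [add_add_add_comm, ← add_smul, ← map_add] at this
  smul_mem' := by
    rintro c y ⟨a, ha⟩
    refine ⟨c * a, ?_⟩
    have := L.smul_mem c ha
    rwa [smul_add, osmul_eq, osmul_eq c (embv y), smul_smul, ← map_smul, ← osmul_eq] at this

omit [NumberField K] in
theorem Lat.midLat {L : Submodule (𝓞 K) (Fin (n + 1) ⊕ Fin (n + 1) → K)} {N N₁ : ℕ}
    (hL : Lat N L) (he : ve n K ∈ L) {f : Fin (n + 1) ⊕ Fin (n + 1) → K} (hf : f ∈ L)
    (hef : om (ve n K) f = N₁) : Lat (N * N₁) (midLat L) where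
  full v := by
    obtain ⟨m, hm, h⟩ := hL.full (embv v)
    refine ⟨m, hm, 0, ?_⟩
    rwa [zero_smul, zero_add, osmul_eq, map_smul, ← osmul_eq]
  integral := by
    rintro y ⟨a, ha⟩ z ⟨b, hb⟩
    have := hL.integral _ ha _ hb
    simpa [om_embv, om_ve_embv, om_embv_ve] using this
  dual v hv := by
    set w := (N₁ : K) • embv v - om (embv v) f • ve n K with hw
    have h1 : ∀ z ∈ L, IsIntegral ℤ (om w z) := by
      intro z hz
      have hai := hL.integral _ he z hz
      rw [om_ve] at hai
      set a : 𝓞 K := ⟨z (inr 0), hai⟩ with ha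
      have hmem : (N₁ : ℕ) • z - a • f ∈ L := L.sub_mem (nsmul_mem hz N₁) (L.smul_mem a hf)
      have hza : (N₁ : ℕ) • z - a • f = (N₁ : K) • z - z (inr 0) • f := by
        rw [osmul_eq, ← Nat.cast_smul_eq_nsmul K]; rfl
      rw [hza] at hmem
      have h0 : ((N₁ : K) • z - z (inr 0) • f) (inr 0) = 0 := by
        rw [om_ve] at hef
        simp [hef, mul_comm]
      rw [eq_embv h0] at hmem
      have h2 := hv _ ⟨_, hmem⟩
      have h3 : om w z = om (embv v) ((N₁ : K) • z - z (inr 0) • f) := by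
        rw [hw]
        simp only [map_sub, map_smul, LinearMap.sub_apply, LinearMap.smul_apply, om_ve, smul_eq_mul]
        ring
      rw [h3, eq_embv h0, map_add, map_smul, om_embv_ve, om_embv, smul_zero, zero_add]
      exact h2
    refine ⟨-(N : K) * om (embv v) f, ?_⟩
    have h2 := hL.dual w h1
    convert h2 using 1
    rw [hw, ← Nat.cast_smul_eq_nsmul K, ← Nat.cast_smul_eq_nsmul K, map_smul, smul_sub, smul_smul,
      smul_smul]
    push_cast
    module

end MiddleLattice

end SympRed

namespace SympRed

open Sum NumberField Module NFLattice
open NumberField.ComplexEmbedding (conjugate)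

section Induction

variable {n : ℕ} {K : Type} [Field K] [NumberField K]

/-- `b` is a reduced basis for `G` with denominators `N` with respect to `L`. -/
def IsReducedBasis (N : ℕ) (C : ℝ) (G : (K →+* ℂ) → Matrix (Fin n ⊕ Fin n) (Fin n ⊕ Fin n) ℂ)
    (L : Submodule (𝓞 K) (Fin n ⊕ Fin n → K)) (b : Matrix (Fin n ⊕ Fin n) (Fin n ⊕ Fin n) K) :
    Prop :=
  b ∈ symplecticGroup (Fin n) K ∧ (∀ j, N • bᵀ j ∈ L) ∧ ∃ t : Fin n ⊕ Fin n → ℝ, (∀ i, 0 < t i) ∧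
    (∀ i, t i.swap = (t i)⁻¹) ∧ ∀ σ i j, ‖hs G σ (bᵀ i) (bᵀ j)‖ ≤ C * min (t i) (t j)

omit [NumberField K] in
theorem om_single (i j : Fin n) : om (Pi.single (inl i) 1) (Pi.single (inr j) (1 : K)) =
    if i = j then 1 else 0 := by
  rw [om_single_inr]; simp [Pi.single_apply, eq_comm]

omit [NumberField K] in
theorem om_single_ll (i j : Fin n) : om (Pi.single (inl i) 1) (Pi.single (inl j) (1 : K)) = 0 := by
  rw [om_single_inl]; simp

omit [NumberField K] in
theorem om_single_rr (i j : Fin n) : om (Pi.single (inr i) 1) (Pi.single (inr j) (1 : K)) = 0 := by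
  rw [om_single_inr]; simp

theorem om_single_rl (i j : Fin n) : om (Pi.single (inr i) 1) (Pi.single (inl j) (1 : K)) =
    if i = j then -1 else 0 := by
  rw [om_single_inl]; simp [Pi.single_apply, eq_comm, apply_ite]

theorem om_single_swap_ne_zero (j : Fin n ⊕ Fin n) :
    om (Pi.single j 1) (Pi.single j.swap (1 : K)) ≠ 0 := by
  rcases j with j | j
  · rw [swap_inl, om_single]; simp
  · rw [swap_inr, om_single_rl]; simp

/-- Projection onto the span of a symplectic family. -/
theorem om_proj {ι : Type} [Fintype ι] {β : Fin n ⊕ Fin n → (ι ⊕ ι → K)}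
    (hβ : ∀ i j, om (β i) (β j) = om (Pi.single i 1) (Pi.single j (1 : K))) (x : ι ⊕ ι → K) (j) :
    om (∑ i, (om x (β (inr i)) • β (inl i) - om x (β (inl i)) • β (inr i))) (β j) = om x (β j) := by
  simp only [map_sum, map_sub, map_smul, LinearMap.sum_apply, LinearMap.sub_apply,
    LinearMap.smul_apply, hβ]
  rcases j with j | j <;> simp [om_single, om_single_ll, om_single_rr, om_single_rl]

theorem ext2_mem_symplectic {E F : Fin (n + 1) ⊕ Fin (n + 1) → K}
    {β : Fin n ⊕ Fin n → (Fin (n + 1) ⊕ Fin (n + 1) → K)}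
    (hβ : ∀ i j, om (β i) (β j) = om (Pi.single i 1) (Pi.single j (1 : K))) (hEF : om E F = 1)
    (hE : ∀ j, om E (β j) = 0) (hF : ∀ j, om F (β j) = 0) :
    (Matrix.of (ext2 E F β))ᵀ ∈ symplecticGroup (Fin (n + 1)) K := by
  rw [mem_iff_om]
  have hcol : ∀ i, (Matrix.of (ext2 E F β))ᵀᵀ i = ext2 E F β i := fun i => rfl
  simp only [hcol]
  have hE' : ∀ j, om (β j) E = 0 := fun j => by rw [om_swap, hE, neg_zero]
  have hF' : ∀ j, om (β j) F = 0 := fun j => by rw [om_swap, hF, neg_zero]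
  have hFE : om F E = -1 := by rw [om_swap, hEF]
  have s1 : (Pi.single (inl 0) 1 : Fin (n + 1) ⊕ Fin (n + 1) → K) = ve n K := rfl
  have s2 : ∀ k : Fin n ⊕ Fin n, om (Pi.single (inr 0) 1) (embv (Pi.single k (1 : K))) = 0 := fun k => by
    rw [om_single_inr_left]; simp
  have s3 : ∀ k : Fin n ⊕ Fin n, om (embv (Pi.single k (1 : K))) (Pi.single (inr 0) 1) = 0 := fun k => by
    rw [om_swap, s2, neg_zero]
  refine index_cases (index_cases ?_ ?_ fun k => ?_) (index_cases ?_ ?_ fun k => ?_)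
    fun j => (index_cases ?_ ?_ fun k => ?_)
  · simp
  · rw [om_single]; simp [hEF]
  · rw [s1, ← embv_single, om_ve_embv]; simp [hE]
  · rw [om_single_rl]; simp [hFE]
  · simp
  · rw [← embv_single, s2]; simp [hF]
  · rw [s1, ← embv_single, om_embv_ve]; simp [hE']
  · rw [← embv_single, s3]; simp [hF']
  · rw [← embv_single, ← embv_single, om_embv]; simp [hβ]

omit [NumberField K] in
theorem natCast_smul (N : ℕ) (v : Fin n ⊕ Fin n → K) : N • v = (N : K) • v :=
  (Nat.cast_smul_eq_nsmul K N v).symm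

omit [NumberField K] in
theorem isIntegral_smul_mem {L : Submodule (𝓞 K) (Fin n ⊕ Fin n → K)} {c : K} (hc : IsIntegral ℤ c)
    {v : Fin n ⊕ Fin n → K} (hv : v ∈ L) : c • v ∈ L := by
  exact (osmul_eq (⟨c, hc⟩ : 𝓞 K) v) ▸ L.smul_mem (⟨c, hc⟩ : 𝓞 K) hv

variable (K) in
/-- Extending a reduced basis of the middle lattice to a symplectic basis whose entries against
the first basis vector are small. -/
theorem exists_extension (n : ℕ) : ∃ ρ : ℝ, 1 ≤ ρ ∧
    ∀ (G : (K →+* ℂ) → Matrix (Fin (n + 1) ⊕ Fin (n + 1)) (Fin (n + 1) ⊕ Fin (n + 1)) ℂ)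
      (N N₀ N₁ : ℕ) (L : Submodule (𝓞 K) (Fin (n + 1) ⊕ Fin (n + 1) → K))
      (f : Fin (n + 1) ⊕ Fin (n + 1) → K) (b : Matrix (Fin n ⊕ Fin n) (Fin n ⊕ Fin n) K),
      Compat G → Lat N₀ L → ve n K ∈ L → f ∈ L → om (ve n K) f = N₁ → 1 ≤ N₁ → 1 ≤ N →
      b ∈ symplecticGroup (Fin n) K → (∀ j, N • bᵀ j ∈ midLat L) →
      ∃ (β : Fin n ⊕ Fin n → (Fin (n + 1) ⊕ Fin (n + 1) → K)) (F : Fin (n + 1) ⊕ Fin (n + 1) → K),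
        (∀ i j, om (β i) (β j) = om (Pi.single i 1) (Pi.single j (1 : K))) ∧
        om (ve n K) F = 1 ∧ (∀ j, om (ve n K) (β j) = 0) ∧ (∀ j, om F (β j) = 0) ∧
        (∀ j, ∃ c : K, β j = embv (bᵀ j) + c • ve n K) ∧ (∀ j, N • β j ∈ L) ∧
        (N₁ * N ^ 2) • F ∈ L ∧ (∀ σ j, ‖hs G σ (ve n K) (β j)‖ ≤ ρ * nu G σ (ve n K)) ∧
        ∀ σ, ‖hs G σ (ve n K) F‖ ≤ ρ * nu G σ (ve n K) := by
  obtain ⟨ρ, hρ, hround⟩ := exists_rounded K (Fin (n + 1))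
  refine ⟨ρ, hρ, fun G N N₀ N₁ L f b hG hL he hf hef hN₁ hN hb hbL => ?_⟩
  have hNK : (N : K) ≠ 0 := by exact_mod_cast (by omega : N ≠ 0)
  have hN₁K : (N₁ : K) ≠ 0 := by exact_mod_cast (by omega : N₁ ≠ 0)
  have h1 : ∀ j, ∃ v : Fin (n + 1) ⊕ Fin (n + 1) → K, (∃ c : K, v = embv (bᵀ j) + c • ve n K) ∧
      N • v ∈ L ∧ ∀ σ, ‖hs G σ (ve n K) v‖ ≤ ρ * nu G σ (ve n K) := by
    intro j
    obtain ⟨x, hx⟩ := hbL j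
    obtain ⟨y, hy⟩ := hround G hG (ve n K) (embv (bᵀ j) + (x / N) • ve n K) ve_ne_zero
    refine ⟨_, ⟨x / N + y, ?_⟩, ?_, hy⟩
    · rw [osmul_eq, add_smul, add_assoc]
    · rw [smul_add]
      refine L.add_mem ?_ (nsmul_mem (L.smul_mem _ he) _)
      convert hx using 1
      rw [natCast_smul, natCast_smul, smul_add, smul_smul, mul_div_cancel₀ _ hNK, map_smul]
      exact add_comm _ _
  choose β hβc hβL hβρ using h1
  have hββ : ∀ i j, om (β i) (β j) = om (Pi.single i 1) (Pi.single j (1 : K)) := by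
    intro i j
    obtain ⟨c, hc⟩ := hβc i
    obtain ⟨d, hd⟩ := hβc j
    rw [hc, hd, ← mem_iff_om.1 hb]
    simp [om_embv, om_ve_embv, om_embv_ve]
  have hEβ : ∀ j, om (ve n K) (β j) = 0 := by
    intro j
    obtain ⟨c, hc⟩ := hβc j
    rw [hc]
    simp [om_ve_embv]
  set φ := (N₁ : K)⁻¹ • f with hφ
  set ψ := ∑ i, (om φ (β (inr i)) • β (inl i) - om φ (β (inl i)) • β (inr i)) with hψ
  obtain ⟨y, hy⟩ := hround G hG (ve n K) (φ - ψ) ve_ne_zero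
  have hEψ : om (ve n K) ψ = 0 := by
    simp [hψ, hEβ]
  have hα : ∀ j, IsIntegral ℤ ((N₁ * N : K) * om φ (β j)) := by
    intro j
    have h2 := hL.integral f hf _ (hβL j)
    rw [natCast_smul, map_smul, smul_eq_mul] at h2
    convert h2 using 1
    rw [hφ, map_smul, LinearMap.smul_apply, smul_eq_mul]
    field_simp
  refine ⟨β, φ - ψ + y • ve n K, hββ, ?_, hEβ, fun j => ?_, hβc, hβL, ?_, fun σ j => hβρ j σ, hy⟩
  · rw [osmul_eq, map_add, map_smul, om_self, map_sub, hEψ, hφ, map_smul, hef]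
    simp [hN₁K]
  · rw [osmul_eq, map_add, map_smul, LinearMap.add_apply, LinearMap.smul_apply, hEβ, map_sub,
      LinearMap.sub_apply, om_proj hββ]
    simp
  · rw [smul_add]
    refine L.add_mem ?_ (nsmul_mem (L.smul_mem _ he) _)
    rw [smul_sub]
    refine L.sub_mem ?_ ?_
    · have : (N₁ * N ^ 2) • φ = (N ^ 2) • f := by
        rw [natCast_smul, natCast_smul, hφ, smul_smul]
        congr 1
        push_cast
        field_simp
      rw [this]
      exact nsmul_mem hf _
    · rw [hψ, Finset.smul_sum]
      refine L.sum_mem fun i _ => ?_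
      rw [smul_sub]
      have key : ∀ j k, (N₁ * N ^ 2) • (om φ (β j) • β k) =
          ((N₁ * N : K) * om φ (β j)) • (N • β k) := fun j k => by
        rw [natCast_smul, natCast_smul, smul_smul, smul_smul]
        congr 1
        push_cast
        ring
      rw [key, key]
      exact L.sub_mem (isIntegral_smul_mem (hα _) (hβL _)) (isIntegral_smul_mem (hα _) (hβL _))

end Induction

end SympRed

namespace SympRed

open Sum NumberField Module NFLattice
open NumberField.ComplexEmbedding (conjugate)

section Induction

variable {n : ℕ} {K : Type} [Field K] [NumberField K]

/-- The existence of reduced bases, uniformly over all forms and lattices. -/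
def HasReducedBases (n : ℕ) (K : Type) [Field K] [NumberField K] (N₀ N : ℕ) (C : ℝ) : Prop :=
  ∀ (G : (K →+* ℂ) → Matrix (Fin n ⊕ Fin n) (Fin n ⊕ Fin n) ℂ)
    (L : Submodule (𝓞 K) (Fin n ⊕ Fin n → K)), Compat G → Lat N₀ L →
    ∃ b, IsReducedBasis N C G L b

omit [NumberField K] in
theorem sc_cong (G : (K →+* ℂ) → Matrix (Fin (n + 1) ⊕ Fin (n + 1)) (Fin (n + 1) ⊕ Fin (n + 1)) ℂ)
    (b : Matrix (Fin (n + 1) ⊕ Fin (n + 1)) (Fin (n + 1) ⊕ Fin (n + 1)) K) (σ : K →+* ℂ) (i j) :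
    sc (cong G b σ) i j =
      sf (G σ) (vmap σ (bᵀ (inl 0))) (vmap σ (bᵀ i)) (vmap σ (bᵀ j)) := by
  rw [sc, sf, cong_apply, cong_apply, cong_apply, cong_apply]
  rfl

theorem exists_reduced_of_first {c : ℝ} (hc : 0 < c) {N₀ N₁ N' : ℕ} (hN₁ : 1 ≤ N₁)
    (hN' : 1 ≤ N') {C' : ℝ} (hC' : 0 < C') (IH : HasReducedBases n K (N₀ * N₁) N' C') :
    ∃ C : ℝ, 0 < C ∧
      ∀ (G : (K →+* ℂ) → Matrix (Fin (n + 1) ⊕ Fin (n + 1)) (Fin (n + 1) ⊕ Fin (n + 1)) ℂ)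
        (L : Submodule (𝓞 K) (Fin (n + 1) ⊕ Fin (n + 1) → K)) (f) (t : ℝ),
        Compat G → Lat N₀ L → ve n K ∈ L → f ∈ L → om (ve n K) f = N₁ → 0 < t →
        (∀ σ, nu G σ (ve n K) ≤ t) → (∀ σ, c * t ≤ nu G σ (ve n K)) →
        (∀ x ∈ L, x ≠ 0 → ∃ σ, c * t ≤ nu G σ x) →
        ∃ b, IsReducedBasis (N₁ * N' ^ 2) C G L b := by
  obtain ⟨ρ, hρ1, hext⟩ := exists_extension K n
  have hN1 : 1 ≤ N₁ * N' ^ 2 := Nat.one_le_iff_ne_zero.2 (by positivity)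
  obtain ⟨D₁, hD₁, hdir₁⟩ := exists_dirichlet_bound K (Fin (n + 1)) hc hN1
  set D := D₁ * C' with hD
  have hD0 : 0 < D := by positivity
  set C₄ := (C' + ρ * (2 * n * C') * (1 + D) + (c⁻¹ + ρ * (2 * n * (ρ * (2 * n * C') * (1 + D)))))
    with hC₄
  have hρ0 : 0 < ρ := by linarith
  have hC₄0 : 0 < C₄ := by positivity
  set D₂ := max 1 (max D (D₁ * C₄)) with hD₂
  have hD₂0 : 0 < D₂ := lt_of_lt_of_le one_pos (le_max_left _ _)
  refine ⟨C₄ + ρ ^ 2 * D₂, by positivity, fun G L f t hG hL he hf hef ht hle hge hmin => ?_⟩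
  obtain ⟨b', hb', hbL, t', ht', hsw, hbt⟩ := IH _ _ hG.schur (hL.midLat he hf hef)
  obtain ⟨β, F, hββ, hEF, hEβ, hFβ, hβc, hβL, hFL, hβρ, hFρ⟩ :=
    hext G N' N₀ N₁ L f b' hG hL he hf hef hN₁ hN' hb' hbL
  set b := (Matrix.of (ext2 (ve n K) F β))ᵀ with hbdef
  have hb : b ∈ symplecticGroup (Fin (n + 1)) K := ext2_mem_symplectic hββ hEF hEβ hFβ
  have hb0 : bᵀ (inl 0) = ve n K := rfl
  have hb1 : bᵀ (inr 0) = F := rfl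
  have hbm : ∀ k, bᵀ (mid k) = β k := fun k => ext2_mid _ _ _ k
  have hG' := hG.cong hb
  have hve0 : ve n K ≠ 0 := ve_ne_zero
  have hee : ∀ σ, ‖cong G b σ (inl 0) (inl 0)‖ = nu G σ (ve n K) := fun σ => by
    rw [cong_apply, hb0, hG.hs_self, Complex.norm_real, Real.norm_of_nonneg (hG.nu_pos σ hve0).le]
  have hne : ∀ σ, cong G b σ (inl 0) (inl 0) ≠ 0 := fun σ => by
    rw [← norm_pos_iff, hee]; exact hG.nu_pos σ hve0
  have hrow : ∀ σ j, ‖cong G b σ (inl 0) j‖ ≤ ρ * ‖cong G b σ (inl 0) (inl 0)‖ := by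
    intro σ
    rw [hee]
    refine index_cases ?_ ?_ fun k => ?_
    · rw [hee]
      exact le_mul_of_one_le_left (hG.nu_pos σ hve0).le hρ1
    · rw [cong_apply, hb0, hb1]; exact hFρ σ
    · rw [cong_apply, hb0, hbm]; exact hβρ σ k
  have hmidS : ∀ σ j k, ‖sc (cong G b σ) (mid j) (mid k)‖ ≤ C' * min (t' j) (t' k) := by
    intro σ j k
    obtain ⟨x, hx⟩ := hβc j
    obtain ⟨y, hy⟩ := hβc k
    rw [sc_cong, hb0, hbm, hbm, hx, hy, vmap_add, vmap_add, vmap_smul, vmap_smul,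
      sf_add_smul (by exact hG.hs_self_ne_zero hve0 σ), ← hs_schur]
    exact hbt σ j k
  have hNL : ∀ i, (N₁ * N' ^ 2) • bᵀ i ∈ L := by
    refine index_cases ?_ ?_ fun k => ?_
    · exact nsmul_mem he _
    · exact hFL
    · rw [hbm]
      have : (N₁ * N' ^ 2) • β k = (N₁ * N') • (N' • β k) := by
        rw [smul_smul]; congr 1; ring
      rw [this]
      exact nsmul_mem (hβL k) _
  have htt : ∀ k, t ≤ D * t' k := by
    intro k
    have h := hdir₁ G L (ve n K) (β k) t (C' * t' k) hG he hve0 ht hle hmin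
      (by rw [← hbm]; exact hNL _) ?_ fun σ => ?_
    · rwa [← mul_assoc] at h
    · intro m y hm h0
      have h1 := congrArg (fun v => om v (β k.swap)) h0
      simp only [map_add, map_smul, LinearMap.add_apply, LinearMap.smul_apply, hEβ, hββ,
        smul_eq_mul, mul_zero, add_zero, map_zero, LinearMap.zero_apply, mul_eq_zero,
        Nat.cast_eq_zero, om_single_swap_ne_zero k, or_false] at h1
      omega
    · have h1 := hmidS σ k k
      rw [sc_cong, hb0, hbm, min_self] at h1
      exact (Complex.re_le_norm _).trans h1
  have hS : ∀ σ i j, ‖sc (cong G b σ) i j‖ ≤ C₄ * min (tt t t' i) (tt t t' j) := fun σ =>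
    norm_sc_le (hG'.symp σ) (hG'.pos σ).1 hC' hD0 hc ht ht' hsw hρ1 (by rw [hee]; exact hge σ)
      (hrow σ) (hmidS σ) htt
  have htF : t ≤ (D₁ * C₄) * t⁻¹ := by
    have h := hdir₁ G L (ve n K) F t (C₄ * t⁻¹) hG he hve0 ht hle hmin hFL ?_ fun σ => ?_
    · rwa [← mul_assoc] at h
    · intro m y hm h0
      have h1 := congrArg (fun v => om (ve n K) v) h0
      simp only [map_add, map_smul, hEF, om_self,
        smul_eq_mul, mul_zero, add_zero, map_zero, mul_one, Nat.cast_eq_zero] at h1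
      omega
    · have h1 := hS σ (inr 0) (inr 0)
      rw [sc_cong, hb0, hb1, min_self, tt_inr] at h1
      exact (Complex.re_le_norm _).trans h1
  refine ⟨b, hb, hNL, tt t t', tt_pos ht ht', tt_swap hsw, fun σ i j => ?_⟩
  rw [← cong_apply]
  refine norm_entry_le (t := t) hρ0.le (hG'.pos σ).1 (hne σ) (by rw [hee]; exact hle σ) (hrow σ) (hS σ) ?_
    hD₂0 i j
  refine index_cases ?_ ?_ fun k => ?_
  · exact le_mul_of_one_le_left ht.le (le_max_left _ _)
  · refine htF.trans (mul_le_mul_of_nonneg_right ?_ (inv_pos.2 ht).le)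
    exact (le_max_right _ _).trans (le_max_right _ _)
  · rw [tt_mid]
    refine (htt k).trans (mul_le_mul_of_nonneg_right ?_ (ht' k).le)
    exact (le_max_left _ _).trans (le_max_right _ _)

omit [NumberField K] in
theorem Lat.comap {ι : Type} [Fintype ι] [DecidableEq ι] {N : ℕ}
    {L : Submodule (𝓞 K) (ι ⊕ ι → K)} (hL : Lat N L)
    {A : Matrix (ι ⊕ ι) (ι ⊕ ι) K} (hA : A ∈ symplecticGroup ι K) :
    Lat N (L.comap ((A.mulVecLin).restrictScalars (𝓞 K))) where
  full v := by
    obtain ⟨m, hm, h⟩ := hL.full (A *ᵥ v)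
    refine ⟨m, hm, ?_⟩
    rw [Submodule.mem_comap, map_smul]
    exact h
  integral x hx y hy := by
    rw [← om_mulVec hA]
    exact hL.integral _ hx _ hy
  dual v hv := by
    rw [Submodule.mem_comap, map_nsmul]
    refine hL.dual _ fun y hy => ?_
    have hdet := SymplecticGroup.symplectic_det hA
    have h1 : A *ᵥ (A⁻¹ *ᵥ y) = y := by rw [mulVec_mulVec, mul_nonsing_inv _ hdet, one_mulVec]
    have h2 := hv (A⁻¹ *ᵥ y) (by
      rw [Submodule.mem_comap]
      change A *ᵥ (A⁻¹ *ᵥ y) ∈ L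
      rwa [h1])
    rw [← om_mulVec hA, h1] at h2
    exact h2

omit [NumberField K] in
theorem IsReducedBasis.of_comap {N : ℕ} {C : ℝ}
    {G : (K →+* ℂ) → Matrix (Fin n ⊕ Fin n) (Fin n ⊕ Fin n) ℂ}
    {L : Submodule (𝓞 K) (Fin n ⊕ Fin n → K)} {A b : Matrix (Fin n ⊕ Fin n) (Fin n ⊕ Fin n) K}
    (hA : A ∈ symplecticGroup (Fin n) K)
    (h : IsReducedBasis N C (cong G A) (L.comap ((A.mulVecLin).restrictScalars (𝓞 K))) b) :
    IsReducedBasis N C G L (A * b) := by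
  have hcol : ∀ j, (A * b)ᵀ j = A *ᵥ bᵀ j := fun j => by
    rw [← mulVec_single, ← mulVec_single, mulVec_mulVec]
  obtain ⟨hb, hL, t, ht, hsw, hbt⟩ := h
  refine ⟨mul_mem hA hb, fun j => ?_, t, ht, hsw, fun σ i j => ?_⟩
  · have h1 := hL j
    rw [Submodule.mem_comap, map_nsmul] at h1
    rw [hcol]
    exact h1
  · rw [hcol, hcol, ← hs_cong]
    exact hbt σ i j

variable (K) in
/-- Reduction theory for symplectic Hermitian forms over number fields. -/
theorem exists_hasReducedBases (n N₀ : ℕ) (hN₀ : 1 ≤ N₀) :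
    ∃ N : ℕ, 1 ≤ N ∧ ∃ C : ℝ, 0 < C ∧ HasReducedBases n K N₀ N C := by
  induction n generalizing N₀ with
  | zero =>
    refine ⟨1, le_rfl, 1, one_pos, fun G L _ _ => ⟨1, one_mem _, fun j => ?_, 1, fun j => ?_,
      fun j => ?_, fun σ j => ?_⟩⟩ <;> exact (isEmptyElim j)
  | succ n ih =>
    obtain ⟨c, hc, N₁, hN₁, hfirst⟩ := exists_first_vectors K (Fin (n + 1)) N₀ hN₀
    obtain ⟨N', hN', C', hC', IH⟩ := ih (N₀ * N₁) (Nat.one_le_iff_ne_zero.2 (by positivity))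
    obtain ⟨C, hC, hstep⟩ := exists_reduced_of_first hc hN₁ hN' hC' IH
    refine ⟨N₁ * N' ^ 2, Nat.one_le_iff_ne_zero.2 (by positivity), C, hC, fun G L hG hL => ?_⟩
    obtain ⟨e, heL, he0, f, hfL, hef, t, ht, hle, hge, hmin⟩ := hfirst G L hG hL
    obtain ⟨A, hA, hAe⟩ := exists_symplectic_map (ve_ne_zero : ve n K ≠ 0) he0
    have hdet := SymplecticGroup.symplectic_det hA
    have hAf : A *ᵥ (A⁻¹ *ᵥ f) = f := by rw [mulVec_mulVec, mul_nonsing_inv _ hdet, one_mulVec]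
    have hnu : ∀ σ x, nu (cong G A) σ x = nu G σ (A *ᵥ x) := fun σ x => by
      rw [nu, nu, hs_cong]
    have hb := hstep (cong G A) (L.comap ((A.mulVecLin).restrictScalars (𝓞 K)))
      (A⁻¹ *ᵥ f) t (hG.cong hA) (hL.comap hA) (show A *ᵥ ve n K ∈ L from hAe.symm ▸ heL)
      (show A *ᵥ (A⁻¹ *ᵥ f) ∈ L from hAf.symm ▸ hfL) (by rw [← om_mulVec hA, hAe, hAf, hef]) ht
      (fun σ => by rw [hnu, hAe]; exact hle σ) (fun σ => by rw [hnu, hAe]; exact hge σ)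
      fun x hx hx0 => ?_
    · obtain ⟨b, hb⟩ := hb
      exact ⟨A * b, hb.of_comap hA⟩
    · simp only [hnu]
      refine hmin _ hx fun h => hx0 ?_
      have : A⁻¹ *ᵥ (A *ᵥ x) = 0 := by rw [show A *ᵥ x = 0 from h, mulVec_zero]
      rwa [mulVec_mulVec, nonsing_inv_mul _ hdet, one_mulVec] at this

end Induction

end SympRed

namespace SympRed

open Sum NumberField Module
open NumberField.ComplexEmbedding (conjugate)

section Siegel

variable {ι : Type} [Fintype ι] [DecidableEq ι]

open scoped ComplexOrder in
omit [DecidableEq ι] in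
theorem hPos_iff_posDef {G : Matrix ι ι ℂ} : HPos G ↔ G.PosDef := by
  rw [posDef_iff_dotProduct_mulVec]
  refine and_congr_right fun hG => forall_congr' fun x => ?_
  have h : star x ⬝ᵥ (G *ᵥ x) = ((hf G x x).re : ℂ) := hf_self_eq hG x
  rw [h, Complex.zero_lt_real]

open scoped ComplexOrder in
omit [DecidableEq ι] in
theorem HPos.transpose {P : Matrix ι ι ℂ} (hP : HPos P) : HPos Pᵀ :=
  hPos_iff_posDef.2 (hPos_iff_posDef.1 hP).transpose

open scoped ComplexOrder in
theorem HPos.inv {P : Matrix ι ι ℂ} (hP : HPos P) : HPos P⁻¹ :=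
  hPos_iff_posDef.2 (hPos_iff_posDef.1 hP).inv

open scoped ComplexOrder in
theorem HPos.isUnit_det {P : Matrix ι ι ℂ} (hP : HPos P) : IsUnit P.det :=
  (isUnit_iff_isUnit_det _).1 (hPos_iff_posDef.1 hP).isUnit

open scoped ComplexOrder in
theorem HPos.one : HPos (1 : Matrix ι ι ℂ) := hPos_iff_posDef.2 PosDef.one

open scoped ComplexOrder in
omit [DecidableEq ι] in
theorem HPos.convex {P Q : Matrix ι ι ℂ} (hP : HPos P) (hQ : HPos Q) {s : ℝ} (h0 : 0 ≤ s)
    (h1 : s ≤ 1) : HPos ((s : ℂ) • P + ((1 - s : ℝ) : ℂ) • Q) := by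
  rw [hPos_iff_posDef] at *
  rcases h0.eq_or_lt with rfl | h0
  · simpa using hQ
  · refine (hP.smul (a := (s : ℂ)) (by exact_mod_cast h0)).add_posSemidef
      (hQ.posSemidef.smul (a := ((1 - s : ℝ) : ℂ)) ?_)
    exact_mod_cast sub_nonneg.2 h1

/-- The Hermitian form with given Siegel coordinates. -/
def siegel (P X : Matrix ι ι ℂ) : Matrix (ι ⊕ ι) (ι ⊕ ι) ℂ :=
  (fromBlocks 1 X 0 1)ᴴ * fromBlocks P 0 0 (Pᵀ)⁻¹ * fromBlocks 1 X 0 1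

theorem siegel_eq (P X : Matrix ι ι ℂ) :
    siegel P X = fromBlocks P (P * X) (Xᴴ * P) (Xᴴ * P * X + (Pᵀ)⁻¹) := by
  simp [siegel, fromBlocks_conjTranspose, fromBlocks_multiply]

theorem unipotent_mem {X : Matrix ι ι ℂ} (hX : Xᵀ = X) :
    fromBlocks 1 X 0 1 ∈ symplecticGroup ι ℂ := by
  rw [SymplecticGroup.mem_iff']
  simp [fromBlocks_transpose, fromBlocks_multiply, J, hX]

theorem levi_mem {P : Matrix ι ι ℂ} (hP : IsUnit P.det) :
    fromBlocks P 0 0 (Pᵀ)⁻¹ ∈ symplecticGroup ι ℂ := by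
  have h1 : Pᵀ * (Pᵀ)⁻¹ = 1 := mul_nonsing_inv _ (by rwa [det_transpose])
  have h2 : P⁻¹ * P = 1 := nonsing_inv_mul _ hP
  rw [SymplecticGroup.mem_iff']
  simp [fromBlocks_transpose, fromBlocks_multiply, J, h1, h2, transpose_nonsing_inv]

omit [DecidableEq ι] in
theorem HPos.fromBlocks {P Q : Matrix ι ι ℂ} (hP : HPos P) (hQ : HPos Q) :
    HPos (fromBlocks P 0 0 Q) := by
  refine ⟨?_, fun x hx => ?_⟩
  · rw [IsHermitian, fromBlocks_conjTranspose, hP.1.eq, hQ.1.eq]; simp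
  · have h : hf (Matrix.fromBlocks P 0 0 Q) x x =
        hf P (fun i => x (inl i)) (fun i => x (inl i)) +
          hf Q (fun i => x (inr i)) (fun i => x (inr i)) := by
      simp [hf, fromBlocks_mulVec, dotProduct, Fintype.sum_sum_type, Function.comp_def]
    rw [h, Complex.add_re]
    by_cases h1 : (fun i => x (inl i)) = 0
    · have h2 : (fun i => x (inr i)) ≠ 0 := fun h2 => hx (by
        ext (i | i)
        exacts [congrFun h1 i, congrFun h2 i])
      exact add_pos_of_nonneg_of_pos (hf_self_nonneg hP _) (hf_self_pos hQ h2)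
    · exact add_pos_of_pos_of_nonneg (hf_self_pos hP h1) (hf_self_nonneg hQ _)

theorem HPos.siegel {P X : Matrix ι ι ℂ} (hP : HPos P) (hX : Xᵀ = X) : HPos (siegel P X) :=
  (hP.fromBlocks hP.transpose.inv).congr (SymplecticGroup.symplectic_det (unipotent_mem hX))

theorem siegel_mem {P X : Matrix ι ι ℂ} (hP : HPos P) (hX : Xᵀ = X) :
    siegel P X ∈ symplecticGroup ι ℂ :=
  mul_mem (mul_mem (conjTranspose_mem (unipotent_mem hX)) (levi_mem hP.isUnit_det))
    (unipotent_mem hX)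

omit [Fintype ι] [DecidableEq ι] in
theorem HPos.toBlocks₁₁ [Fintype ι] {G : Matrix (ι ⊕ ι) (ι ⊕ ι) ℂ} (hG : HPos G) :
    HPos G.toBlocks₁₁ := by
  refine ⟨?_, fun x hx => ?_⟩
  · ext i j
    exact hG.1.apply _ _
  · have h : hf G.toBlocks₁₁ x x = hf G (Sum.elim x 0) (Sum.elim x 0) := by
      simp [hf, dotProduct, mulVec, Fintype.sum_sum_type]
      rfl
    rw [h]
    refine hf_self_pos hG fun h0 => hx ?_
    ext i
    exact congrFun h0 (inl i)

/-- The second Siegel coordinate of a Hermitian form. -/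
def siegelX (G : Matrix (ι ⊕ ι) (ι ⊕ ι) ℂ) : Matrix ι ι ℂ := G.toBlocks₁₁⁻¹ * G.toBlocks₁₂

theorem siegel_relations {G : Matrix (ι ⊕ ι) (ι ⊕ ι) ℂ} (hG : HPos G)
    (hs : G ∈ symplecticGroup ι ℂ) :
    (siegelX G)ᵀ = siegelX G ∧ siegel G.toBlocks₁₁ (siegelX G) = G := by
  obtain ⟨P, Q, Q', R, rfl⟩ : ∃ P Q Q' R, G = fromBlocks P Q Q' R :=
    ⟨_, _, _, _, (fromBlocks_toBlocks G).symm⟩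
  have hP := hG.toBlocks₁₁
  have hH := hG.1
  rw [toBlocks_fromBlocks₁₁] at hP
  rw [siegelX, toBlocks_fromBlocks₁₁, toBlocks_fromBlocks₁₂]
  have hQ' : Q' = Qᴴ := by
    have h := hH.eq
    rw [fromBlocks_conjTranspose, fromBlocks_inj] at h
    exact h.2.2.1.symm
  subst hQ'
  have hu := hP.isUnit_det
  have hPP : P⁻¹ * P = 1 := nonsing_inv_mul _ hu
  have hPP' : P * P⁻¹ = 1 := mul_nonsing_inv _ hu
  rw [SymplecticGroup.mem_iff] at hs
  simp only [J, fromBlocks_transpose, fromBlocks_multiply, fromBlocks_inj] at hs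
  obtain ⟨h1, h2, h3, -⟩ := hs
  simp only [Matrix.mul_zero, Matrix.mul_one, Matrix.mul_neg, zero_add, add_zero] at h1 h2 h3
  have hsym : P⁻¹ * Q = Qᵀ * (Pᵀ)⁻¹ := by
    have h4 : Q * Pᵀ = P * Qᵀ := by
      rw [Matrix.neg_mul] at h1
      exact add_neg_eq_zero.1 h1
    have h5 : Pᵀ * (Pᵀ)⁻¹ = 1 := mul_nonsing_inv _ (by rwa [det_transpose])
    calc P⁻¹ * Q = P⁻¹ * (Q * Pᵀ) * (Pᵀ)⁻¹ := by
          rw [Matrix.mul_assoc, Matrix.mul_assoc, h5, Matrix.mul_one]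
      _ = Qᵀ * (Pᵀ)⁻¹ := by rw [h4, ← Matrix.mul_assoc, hPP, Matrix.one_mul]
  have hX : (P⁻¹ * Q)ᵀ = P⁻¹ * Q := by rw [transpose_mul, transpose_nonsing_inv, ← hsym]
  refine ⟨hX, ?_⟩
  rw [siegel_eq]
  have e1 : P * (P⁻¹ * Q) = Q := by rw [← Matrix.mul_assoc, hPP', Matrix.one_mul]
  have e2 : (P⁻¹ * Q)ᴴ * P = Qᴴ := by
    rw [conjTranspose_mul, conjTranspose_nonsing_inv, hP.1.eq, Matrix.mul_assoc, hPP,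
      Matrix.mul_one]
  rw [e1, e2]
  congr 1
  have h6 : R * Pᵀ = Qᴴ * Qᵀ + 1 := by
    rw [Matrix.neg_mul] at h3
    rw [← h3]; abel
  have h5 : Pᵀ * (Pᵀ)⁻¹ = 1 := mul_nonsing_inv _ (by rwa [det_transpose])
  calc Qᴴ * (P⁻¹ * Q) + (Pᵀ)⁻¹ = (Qᴴ * Qᵀ + 1) * (Pᵀ)⁻¹ := by
        rw [hsym, Matrix.add_mul, Matrix.mul_assoc, Matrix.one_mul]
    _ = R := by rw [← h6, Matrix.mul_assoc, h5, Matrix.mul_one]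

theorem map_star_inv (P : Matrix ι ι ℂ) :
    (P.map (starRingEnd ℂ))⁻¹ = P⁻¹.map (starRingEnd ℂ) := by
  change (Pᴴᵀ)⁻¹ = (P⁻¹)ᴴᵀ
  rw [conjTranspose_nonsing_inv, transpose_nonsing_inv]

theorem siegel_map (P X : Matrix ι ι ℂ) : (siegel P X).map (starRingEnd ℂ) =
    siegel (P.map (starRingEnd ℂ)) (X.map (starRingEnd ℂ)) := by
  rw [siegel_eq, siegel_eq, fromBlocks_map, Matrix.map_mul, Matrix.map_mul,
    Matrix.map_add _ (map_add _), Matrix.map_mul, Matrix.map_mul, ← map_star_inv]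
  rfl

theorem siegelX_map (G : Matrix (ι ⊕ ι) (ι ⊕ ι) ℂ) :
    siegelX (G.map (starRingEnd ℂ)) = (siegelX G).map (starRingEnd ℂ) := by
  rw [siegelX, siegelX, Matrix.map_mul, ← map_star_inv]
  rfl

end Siegel

section Space

variable (K : Type) [Field K] (ι : Type) [Fintype ι] [DecidableEq ι]

/-- The symmetric space of compatible families of positive symplectic Hermitian forms. -/
def FormSpace : Type := {G : (K →+* ℂ) → Matrix (ι ⊕ ι) (ι ⊕ ι) ℂ // Compat G}

instance : TopologicalSpace (FormSpace K ι) := instTopologicalSpaceSubtype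

variable {K ι}

omit [DecidableEq ι] in
theorem cong_mul (G : (K →+* ℂ) → Matrix (ι ⊕ ι) (ι ⊕ ι) ℂ) (a b : Matrix (ι ⊕ ι) (ι ⊕ ι) K) :
    cong (cong G a) b = cong G (a * b) := by
  funext σ
  simp only [cong, Matrix.map_mul, conjTranspose_mul, Matrix.mul_assoc]

theorem cong_one (G : (K →+* ℂ) → Matrix (ι ⊕ ι) (ι ⊕ ι) ℂ) : cong G 1 = G := by
  funext σ
  simp [cong]

/-- The straight path in Siegel coordinates from the standard form. -/
def contract (s : ℝ) (G : (K →+* ℂ) → Matrix (ι ⊕ ι) (ι ⊕ ι) ℂ) (σ : K →+* ℂ) :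
    Matrix (ι ⊕ ι) (ι ⊕ ι) ℂ :=
  siegel ((s : ℂ) • (G σ).toBlocks₁₁ + ((1 - s : ℝ) : ℂ) • 1) ((s : ℂ) • siegelX (G σ))

theorem Compat.contract {G : (K →+* ℂ) → Matrix (ι ⊕ ι) (ι ⊕ ι) ℂ} (hG : Compat G) {s : ℝ}
    (h0 : 0 ≤ s) (h1 : s ≤ 1) : Compat (contract s G) := by
  have hP : ∀ σ, HPos ((s : ℂ) • (G σ).toBlocks₁₁ + ((1 - s : ℝ) : ℂ) • 1) := fun σ =>
    (hG.pos σ).toBlocks₁₁.convex HPos.one h0 h1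
  have hX : ∀ σ, ((s : ℂ) • siegelX (G σ))ᵀ = (s : ℂ) • siegelX (G σ) := fun σ => by
    rw [transpose_smul, (siegel_relations (hG.pos σ) (hG.symp σ)).1]
  refine ⟨fun σ => (hP σ).siegel (hX σ), fun σ => siegel_mem (hP σ) (hX σ), fun σ => ?_⟩
  rw [SympRed.contract, SympRed.contract, siegel_map, hG.conj, siegelX_map]
  congr 1
  · ext i j
    by_cases h : i = j <;> simp [h, toBlocks₁₁]
  · ext i j
    simp

theorem Compat.contract_one {G : (K →+* ℂ) → Matrix (ι ⊕ ι) (ι ⊕ ι) ℂ} (hG : Compat G) :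
    SympRed.contract 1 G = G := by
  funext σ
  simp [SympRed.contract, (siegel_relations (hG.pos σ) (hG.symp σ)).2]

theorem contract_zero (G : (K →+* ℂ) → Matrix (ι ⊕ ι) (ι ⊕ ι) ℂ) :
    contract 0 G = fun _ => 1 := by
  funext σ
  simp [contract, siegel_eq]

theorem compat_one : Compat fun _ : K →+* ℂ => (1 : Matrix (ι ⊕ ι) (ι ⊕ ι) ℂ) :=
  ⟨fun _ => HPos.one, fun _ => one_mem _, fun _ => by
    rw [Matrix.map_one _ (map_zero _) (map_one _)]⟩

theorem continuous_inv {Y : Type} [TopologicalSpace Y] {f : Y → Matrix ι ι ℂ}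
    (hf : Continuous f) (h : ∀ y, IsUnit (f y).det) : Continuous fun y => (f y)⁻¹ := by
  simp only [inv_def, Ring.inverse_eq_inv']
  exact (hf.matrix_det.inv₀ fun y => (h y).ne_zero).smul hf.matrix_adjugate

/-- The contraction of the symmetric space. -/
def contraction : C(unitInterval × FormSpace K ι, FormSpace K ι) where
  toFun p := ⟨contract p.1 p.2.1, p.2.2.contract p.1.2.1 p.1.2.2⟩
  continuous_toFun := by
    refine Continuous.subtype_mk (continuous_pi fun σ => ?_) _
    have hG : Continuous fun p : unitInterval × FormSpace K ι => p.2.1 σ :=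
      (continuous_apply σ).comp (continuous_subtype_val.comp continuous_snd)
    have hs : Continuous fun p : unitInterval × FormSpace K ι => ((p.1 : ℝ) : ℂ) :=
      Complex.continuous_ofReal.comp (continuous_subtype_val.comp continuous_fst)
    have hs' : Continuous fun p : unitInterval × FormSpace K ι => ((1 - (p.1 : ℝ) : ℝ) : ℂ) :=
      Complex.continuous_ofReal.comp
        (continuous_const.sub (continuous_subtype_val.comp continuous_fst))
    have h11 : Continuous fun p : unitInterval × FormSpace K ι => (p.2.1 σ).toBlocks₁₁ :=
      hG.matrix_submatrix inl inl
    have h12 : Continuous fun p : unitInterval × FormSpace K ι => (p.2.1 σ).toBlocks₁₂ :=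
      hG.matrix_submatrix inl inr
    have hP := (hs.smul h11).add (hs'.smul (continuous_const (y := (1 : Matrix ι ι ℂ))))
    have hX : Continuous fun p : unitInterval × FormSpace K ι => siegelX (p.2.1 σ) :=
      (continuous_inv h11 fun p => (p.2.2.pos σ).toBlocks₁₁.isUnit_det).matrix_mul h12
    have hX' := hs.smul hX
    simp only [contract, siegel_eq]
    refine Continuous.matrix_fromBlocks hP (hP.matrix_mul hX')
      (hX'.matrix_conjTranspose.matrix_mul hP)
      (((hX'.matrix_conjTranspose.matrix_mul hP).matrix_mul hX').add
        (continuous_inv hP.matrix_transpose fun p => ?_))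
    rw [det_transpose]
    exact ((p.2.2.pos σ).toBlocks₁₁.convex HPos.one p.1.2.1 p.1.2.2).isUnit_det

end Space

end SympRed

namespace SympRed

open Sum NumberField Module

section Lattices

variable (K : Type) [Field K] [NumberField K] (ι : Type) [Fintype ι]

/-- The standard lattice. -/
def stdLat : Submodule (𝓞 K) (ι ⊕ ι → K) :=
  LinearMap.range ((Algebra.linearMap (𝓞 K) K).compLeft (ι ⊕ ι))

variable {K ι}

omit [NumberField K] [Fintype ι] in
theorem mem_stdLat {x : ι ⊕ ι → K} : x ∈ stdLat K ι ↔ ∀ i, IsIntegral ℤ (x i) := by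
  constructor
  · rintro ⟨u, rfl⟩ i
    exact (u i).2
  · intro h
    exact ⟨fun i => ⟨x i, h i⟩, rfl⟩

omit [NumberField K] in
theorem isIntegral_om {x y : ι ⊕ ι → K} (hx : ∀ i, IsIntegral ℤ (x i))
    (hy : ∀ i, IsIntegral ℤ (y i)) : IsIntegral ℤ (om x y) := by
  rw [om_apply]
  exact IsIntegral.sum _ fun i _ => ((hx _).mul (hy _)).sub ((hx _).mul (hy _))

variable [DecidableEq ι]

omit [NumberField K] in
theorem mem_stdLat_of_om {x : ι ⊕ ι → K} (h : ∀ y ∈ stdLat K ι, IsIntegral ℤ (om x y)) :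
    x ∈ stdLat K ι := by
  have h1 : ∀ z : ι ⊕ ι, (Pi.single z 1 : ι ⊕ ι → K) ∈ stdLat K ι := fun z => by
    rw [mem_stdLat]
    intro i
    rw [Pi.single_apply]
    split_ifs
    exacts [isIntegral_one, isIntegral_zero]
  rw [mem_stdLat]
  rintro (i | i)
  · rw [← om_single_inr x i]; exact h _ (h1 _)
  · have := (h _ (h1 (inl i))).neg
    rwa [om_single_inl, neg_neg] at this

theorem stdLat_lat : Lat 1 (stdLat K ι) where
  full v := by
    obtain ⟨m, hm⟩ := IsLocalization.exist_integer_multiples_of_finite (nonZeroDivisors (𝓞 K)) v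
    refine ⟨m, nonZeroDivisors.ne_zero m.2, ?_⟩
    rw [mem_stdLat]
    intro i
    obtain ⟨a, ha⟩ := hm i
    rw [Pi.smul_apply, ← ha]
    exact a.2
  integral x hx y hy := isIntegral_om (mem_stdLat.1 hx) (mem_stdLat.1 hy)
  dual v hv := by
    rw [one_smul]
    exact mem_stdLat_of_om hv

omit [NumberField K] in
theorem exists_om_single_eq (c : ι ⊕ ι → K) : ∃ w : ι ⊕ ι → K, ∀ z, om w (Pi.single z 1) = c z := by
  refine ⟨Sum.elim (fun i => c (inr i)) (fun i => -c (inl i)), ?_⟩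
  rintro (i | i)
  · rw [om_single_inl]; simp
  · rw [om_single_inr]; simp

omit [NumberField K] in
/-- Functionals on lattices are given by pairing with a vector. -/
theorem exists_om_eq {P : Submodule (𝓞 K) (ι ⊕ ι → K)} {a b : 𝓞 K} (ha : a ≠ 0) (hb : b ≠ 0)
    (haP : ∀ x ∈ stdLat K ι, a • x ∈ P) (hbP : ∀ x ∈ P, b • x ∈ stdLat K ι)
    (f : P →ₗ[𝓞 K] 𝓞 K) : ∃ w : ι ⊕ ι → K, ∀ x : P, om w (x : ι ⊕ ι → K) = (f x : K) := by
  have haK : (a : K) ≠ 0 := by simpa using ha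
  have hbK : (b : K) ≠ 0 := by simpa using hb
  let g : (ι ⊕ ι → 𝓞 K) →ₗ[𝓞 K] P := LinearMap.codRestrict P
    (a • (Algebra.linearMap (𝓞 K) K).compLeft (ι ⊕ ι)) fun u => haP _ ⟨u, rfl⟩
  obtain ⟨w, hw⟩ := exists_om_single_eq fun z : ι ⊕ ι => ((f (g (Pi.single z 1)) : 𝓞 K) : K) / a
  have h1 : ∀ u : ι ⊕ ι → 𝓞 K, (a : K) * om w (fun z => (u z : K)) = (f (g u) : K) := by
    intro u
    have h2 : (fun z => (u z : K)) = ∑ z, (u z : K) • (Pi.single z 1 : ι ⊕ ι → K) := by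
      exact pi_eq_sum_univ' _
    have h3 : f (g u) = ∑ z, u z * f (g (Pi.single z 1)) := by
      conv_lhs => rw [pi_eq_sum_univ' u, map_sum, map_sum]
      exact Finset.sum_congr rfl fun z _ => by rw [map_smul, map_smul, smul_eq_mul]
    rw [h2, h3, map_sum, Finset.mul_sum, RingOfIntegers.coe_eq_algebraMap (∑ z, _), map_sum]
    refine Finset.sum_congr rfl fun z _ => ?_
    rw [map_smul, hw, map_mul, smul_eq_mul, ← RingOfIntegers.coe_eq_algebraMap,
      ← RingOfIntegers.coe_eq_algebraMap]
    field_simp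
  refine ⟨w, fun x => ?_⟩
  obtain ⟨u, hu⟩ := hbP x x.2
  have h2 := h1 u
  have h3 : g u = (a * b) • x := by
    ext1
    change a • ((Algebra.linearMap (𝓞 K) K).compLeft (ι ⊕ ι)) u = (a * b) • (x : ι ⊕ ι → K)
    rw [hu, smul_smul]
  have h4 : (fun z => (u z : K)) = (b : K) • (x : ι ⊕ ι → K) := by
    rw [← osmul_eq, ← hu]; rfl
  rw [h3, h4, map_smul, map_smul, smul_eq_mul, smul_eq_mul, RingOfIntegers.coe_eq_algebraMap (_ * _),
    map_mul, map_mul, ← mul_assoc] at h2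
  exact mul_left_cancel₀ (mul_ne_zero haK hbK) h2

/-- Lattices are reflexive. -/
theorem mem_of_forall_dual {P : Submodule (𝓞 K) (ι ⊕ ι → K)} {a b : 𝓞 K} (ha : a ≠ 0) (hb : b ≠ 0)
    (haP : ∀ x ∈ stdLat K ι, a • x ∈ P) (hbP : ∀ x ∈ P, b • x ∈ stdLat K ι) {v : ι ⊕ ι → K}
    (hv : ∀ w, (∀ y ∈ P, IsIntegral ℤ (om w y)) → IsIntegral ℤ (om v w)) : v ∈ P := by
  have haK : (a : K) ≠ 0 := by simpa using ha
  have hbK : (b : K) ≠ 0 := by simpa using hb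
  have hstd : Module.Finite (𝓞 K) (stdLat K ι) := by unfold stdLat; infer_instance
  let j : P →ₗ[𝓞 K] stdLat K ι := (b • P.subtype).codRestrict _ fun x => hbP _ x.2
  have hj : Function.Injective j := by
    intro x y hxy
    have h1 : b • (x : ι ⊕ ι → K) = b • (y : ι ⊕ ι → K) := congrArg Subtype.val hxy
    rw [osmul_eq, osmul_eq] at h1
    exact Subtype.ext (smul_right_injective _ hbK h1)
  have hfin : Module.Finite (𝓞 K) P := Module.Finite.of_injective j hj
  have hfp : Module.FinitePresentation (𝓞 K) P := Module.finitePresentation_of_finite _ _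
  obtain ⟨k, f, g, hfg⟩ := Module.Flat.exists_factorization_of_finitePresentation
    (LinearMap.id (R := 𝓞 K) (M := P))
  choose w hw using fun i => exists_om_eq ha hb haP hbP (Finsupp.lapply i ∘ₗ f)
  have hx : ∀ x : P, (x : ι ⊕ ι → K) =
      ∑ i, om (w i) (x : ι ⊕ ι → K) • ((g (Finsupp.single i 1) : P) : ι ⊕ ι → K) := by
    intro x
    have h1 : x = ∑ i, f x i • g (Finsupp.single i 1) := by
      conv_lhs => rw [← LinearMap.id_apply (R := 𝓞 K) x, hfg, LinearMap.comp_apply,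
        ← Finsupp.univ_sum_single (f x), map_sum]
      refine Finset.sum_congr rfl fun i _ => ?_
      rw [← map_smul, Finsupp.smul_single, smul_eq_mul, mul_one]
    conv_lhs => rw [h1]
    rw [AddSubmonoidClass.coe_finsetSum]
    refine Finset.sum_congr rfl fun i _ => ?_
    rw [hw, Submodule.coe_smul, osmul_eq]
    rfl
  obtain ⟨m, hm, hmv⟩ := (stdLat_lat (K := K) (ι := ι)).full v
  have hmK : (m : K) ≠ 0 := by simpa using hm
  have h1 := hx ⟨a • m • v, haP _ hmv⟩
  have h2 : v = ∑ i, om (w i) v • ((g (Finsupp.single i 1) : P) : ι ⊕ ι → K) := by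
    apply smul_right_injective _ (mul_ne_zero haK hmK)
    simp only [osmul_eq, smul_smul, map_smul, smul_eq_mul] at h1
    simp only [Finset.smul_sum, smul_smul]
    exact h1
  rw [h2]
  refine P.sum_mem fun i _ => ?_
  have h3 : IsIntegral ℤ (om (w i) v) := by
    rw [← neg_neg (om (w i) v), ← om_swap]
    refine (hv _ fun y hy => ?_).neg
    rw [hw i ⟨y, hy⟩]
    exact (((Finsupp.lapply i ∘ₗ f) ⟨y, hy⟩ : 𝓞 K)).2
  exact P.smul_mem (⟨_, h3⟩ : 𝓞 K) (g (Finsupp.single i 1)).2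

end Lattices
end SympRed

namespace SympRed

open Sum NumberField Module

section Clip

variable {K : Type} [Field K] {ι : Type} [Fintype ι]

theorem om_osmul_left (m : 𝓞 K) (x y : ι ⊕ ι → K) : om (m • x) y = m * om x y := by
  rw [osmul_eq, map_smul, LinearMap.smul_apply, smul_eq_mul]

theorem om_osmul_right (m : 𝓞 K) (x y : ι ⊕ ι → K) : om x (m • y) = m * om x y := by
  rw [osmul_eq, map_smul, smul_eq_mul]

theorem om_osmul_comm (m : 𝓞 K) (x y : ι ⊕ ι → K) : om (m • x) y = om x (m • y) := by
  rw [om_osmul_left, om_osmul_right]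

/-- The multiple `s ^ k` of the standard lattice. -/
def smulStd (s : 𝓞 K) (k : ℕ) : Submodule (𝓞 K) (ι ⊕ ι → K) :=
  (stdLat K ι).map (LinearMap.lsmul (𝓞 K) _ (s ^ k))

omit [Fintype ι] in
theorem mem_smulStd {s : 𝓞 K} {k : ℕ} {x : ι ⊕ ι → K} :
    x ∈ smulStd s k ↔ ∃ u ∈ stdLat K ι, s ^ k • u = x := Iff.rfl

/-- The interpolation between a lattice and the standard lattice. -/
def clipLat (s : 𝓞 K) (L : Submodule (𝓞 K) (ι ⊕ ι → K)) (k : ℕ) :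
    Submodule (𝓞 K) (ι ⊕ ι → K) :=
  (L ⊓ (stdLat K ι).comap (LinearMap.lsmul (𝓞 K) _ (s ^ k))) ⊔ smulStd s k

omit [Fintype ι] in
theorem mem_clipLat {s : 𝓞 K} {L : Submodule (𝓞 K) (ι ⊕ ι → K)} {k : ℕ} {x : ι ⊕ ι → K} :
    x ∈ clipLat s L k ↔
      ∃ l ∈ L, s ^ k • l ∈ stdLat K ι ∧ ∃ u ∈ stdLat K ι, l + s ^ k • u = x := by
  simp only [clipLat, Submodule.mem_sup, mem_smulStd]
  constructor
  · rintro ⟨l, ⟨hl, hl'⟩, _, ⟨u, hu, rfl⟩, rfl⟩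
    exact ⟨l, hl, hl', u, hu, rfl⟩
  · rintro ⟨l, hl, hl', u, hu, rfl⟩
    exact ⟨l, ⟨hl, hl'⟩, _, ⟨u, hu, rfl⟩, rfl⟩

omit [Fintype ι] in
theorem pow_smul_mem_clipLat (s : 𝓞 K) (L : Submodule (𝓞 K) (ι ⊕ ι → K)) (k : ℕ)
    {u : ι ⊕ ι → K} (hu : u ∈ stdLat K ι) : s ^ k • u ∈ clipLat s L k :=
  Submodule.mem_sup_right ⟨u, hu, rfl⟩

variable [NumberField K] [DecidableEq ι]

omit [NumberField K] [DecidableEq ι] in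
theorem Lat.mem_of_integral {L : Submodule (𝓞 K) (ι ⊕ ι → K)} (hL : Lat 1 L) {v : ι ⊕ ι → K}
    (h : ∀ y ∈ L, IsIntegral ℤ (om v y)) : v ∈ L := by
  simpa using hL.dual v h

omit [NumberField K] in
theorem Lat.pow_smul_mem_stdLat {s : 𝓞 K} {L : Submodule (𝓞 K) (ι ⊕ ι → K)} (hL : Lat 1 L) {k : ℕ}
    (hk : ∀ x ∈ stdLat K ι, s ^ k • x ∈ L) {x : ι ⊕ ι → K} (hx : x ∈ L) :
    s ^ k • x ∈ stdLat K ι :=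
  mem_stdLat_of_om fun y hy => by
    rw [om_osmul_comm]
    exact hL.integral _ hx _ (hk y hy)

omit [NumberField K] in
theorem clipLat_eq {s : 𝓞 K} {L : Submodule (𝓞 K) (ι ⊕ ι → K)} (hL : Lat 1 L) {k : ℕ}
    (hk : ∀ x ∈ stdLat K ι, s ^ k • x ∈ L) : clipLat s L k = L := by
  ext x
  rw [mem_clipLat]
  constructor
  · rintro ⟨l, hl, -, u, hu, rfl⟩
    exact L.add_mem hl (hk u hu)
  · intro hx
    exact ⟨x, hx, hL.pow_smul_mem_stdLat hk hx, 0, Submodule.zero_mem _, by simp⟩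

omit [Fintype ι] [NumberField K] [DecidableEq ι] in
theorem clipLat_zero (s : 𝓞 K) (L : Submodule (𝓞 K) (ι ⊕ ι → K)) : clipLat s L 0 = stdLat K ι := by
  ext x
  simp only [mem_clipLat, pow_zero, one_smul]
  constructor
  · rintro ⟨l, -, hl, u, hu, rfl⟩
    exact Submodule.add_mem _ hl hu
  · intro hx
    exact ⟨0, L.zero_mem, Submodule.zero_mem _, x, hx, zero_add _⟩

theorem Lat.clipLat {s : 𝓞 K} (hs : s ≠ 0) {L : Submodule (𝓞 K) (ι ⊕ ι → K)} (hL : Lat 1 L)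
    {j : ℕ} (hj : ∀ x ∈ stdLat K ι, s ^ j • x ∈ L) (k : ℕ) : Lat 1 (clipLat s L k) where
  full v := by
    obtain ⟨m, hm, hmv⟩ := (stdLat_lat (K := K) (ι := ι)).full v
    refine ⟨s ^ k * m, mul_ne_zero (pow_ne_zero _ hs) hm, ?_⟩
    rw [mul_smul]
    exact pow_smul_mem_clipLat _ _ _ hmv
  integral x hx y hy := by
    obtain ⟨l, hl, hl', u, hu, rfl⟩ := mem_clipLat.1 hx
    obtain ⟨m, hm, hm', v, hv, rfl⟩ := mem_clipLat.1 hy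
    have hi := (stdLat_lat (K := K) (ι := ι)).integral
    simp only [map_add, LinearMap.add_apply]
    refine ((hL.integral _ hl _ hm).add ?_).add (IsIntegral.add ?_ ?_)
    · rw [om_osmul_comm]; exact hi _ hu _ hm'
    · rw [← om_osmul_comm]; exact hi _ hl' _ hv
    · exact hi _ (Submodule.smul_mem _ _ hu) _ (Submodule.smul_mem _ _ hv)
  dual v hv := by
    have h1 : v ∈ L ⊔ smulStd s k := by
      refine mem_of_forall_dual (a := s ^ k) (b := s ^ j) (pow_ne_zero _ hs) (pow_ne_zero _ hs)
        (fun x hx => Submodule.mem_sup_right (mem_smulStd.2 ⟨x, hx, rfl⟩)) ?_ ?_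
      · intro x hx
        obtain ⟨l, hl, _, ⟨u, hu, rfl⟩, rfl⟩ := Submodule.mem_sup.1 hx
        rw [smul_add]
        exact Submodule.add_mem _ (hL.pow_smul_mem_stdLat hj hl)
          (Submodule.smul_mem _ _ (Submodule.smul_mem _ _ hu))
      · intro w hw
        refine hv w (Submodule.mem_sup_left ⟨?_, ?_⟩)
        · exact hL.mem_of_integral fun y hy => hw y (Submodule.mem_sup_left hy)
        · refine mem_stdLat_of_om fun y hy => ?_
          change IsIntegral ℤ (om (s ^ k • w) y)
          rw [om_osmul_comm]
          exact hw _ (Submodule.mem_sup_right ⟨y, hy, rfl⟩)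
    obtain ⟨l, hl, _, ⟨u, hu, rfl⟩, rfl⟩ := Submodule.mem_sup.1 h1
    rw [one_smul, mem_clipLat]
    refine ⟨l, hl, mem_stdLat_of_om fun y hy => ?_, u, hu, rfl⟩
    have h2 := hv _ (pow_smul_mem_clipLat s L k hy)
    rw [map_add, LinearMap.add_apply, ← om_osmul_comm] at h2
    have h3 := (stdLat_lat (K := K) (ι := ι)).integral (s ^ k • (s ^ k • u))
      (Submodule.smul_mem _ _ (Submodule.smul_mem _ _ hu)) y hy
    have h4 : om ((LinearMap.lsmul (𝓞 K) (ι ⊕ ι → K) (s ^ k)) u) (s ^ k • y) =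
      om (s ^ k • (s ^ k • u)) y := by rw [om_osmul_comm]; rfl
    rw [h4] at h2
    simpa using h2.sub h3

end Clip

section Vertices

variable {K : Type} [Field K] [NumberField K] {ι : Type} [Fintype ι] [DecidableEq ι]

variable (K ι) in
/-- Self-dual lattices commensurable with the standard one. -/
structure LatV (A : Subalgebra (𝓞 K) K) (s : 𝓞 K) where
  /-- the underlying lattice -/
  L : Submodule (𝓞 K) (ι ⊕ ι → K)
  lat : Lat 1 L
  ent : ∀ x ∈ L, ∀ i, x i ∈ A
  near : ∃ k : ℕ, ∀ x ∈ stdLat K ι, s ^ k • x ∈ L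

variable {A : Subalgebra (𝓞 K) K} {s : 𝓞 K}

omit [NumberField K] [DecidableEq ι] in
theorem LatV.ext {L L' : LatV K ι A s} (h : L.L = L'.L) : L = L' := by
  cases L; cases L'; cases h; rfl

omit [NumberField K] [Fintype ι] [DecidableEq ι] in
theorem ent_stdLat {x : ι ⊕ ι → K} (hx : x ∈ stdLat K ι) (i : ι ⊕ ι) : x i ∈ A :=
  A.algebraMap_mem (⟨x i, mem_stdLat.1 hx i⟩ : 𝓞 K)

variable (A s) in
/-- The standard vertex. -/
def LatV.std : LatV K ι A s where
  L := stdLat K ι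
  lat := stdLat_lat
  ent _ hx := ent_stdLat hx
  near := ⟨0, fun x hx => by simpa using hx⟩

/-- The clipping operation on vertices. -/
def LatV.clip (hs : s ≠ 0) (L : LatV K ι A s) (k : ℕ) : LatV K ι A s where
  L := clipLat s L.L k
  lat := L.lat.clipLat hs L.near.choose_spec k
  ent x hx i := by
    obtain ⟨l, hl, -, u, hu, rfl⟩ := mem_clipLat.1 hx
    exact A.add_mem (L.ent l hl i) (ent_stdLat (Submodule.smul_mem _ _ hu) i)
  near := ⟨k, fun _ hx => pow_smul_mem_clipLat _ _ _ hx⟩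

/-- Adjacency of vertices. -/
def LatV.Adj (r : ℕ) (L L' : LatV K ι A s) : Prop :=
  (∀ x ∈ L.L, s ^ r • x ∈ L'.L) ∧ ∀ x ∈ L'.L, s ^ r • x ∈ L.L

omit [NumberField K] [DecidableEq ι] in
theorem LatV.Adj.refl (r : ℕ) (L : LatV K ι A s) : LatV.Adj r L L :=
  ⟨fun _ hx => Submodule.smul_mem _ _ hx, fun _ hx => Submodule.smul_mem _ _ hx⟩

omit [NumberField K] [DecidableEq ι] in
theorem LatV.Adj.trans {q r : ℕ} {L L' L'' : LatV K ι A s} (h : LatV.Adj q L L')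
    (h' : LatV.Adj r L' L'') : LatV.Adj (q + r) L L'' :=
  ⟨fun x hx => by rw [add_comm, pow_add, mul_smul]; exact h'.1 _ (h.1 x hx),
    fun x hx => by rw [pow_add, mul_smul]; exact h.2 _ (h'.2 x hx)⟩

theorem LatV.clip_zero (hs : s ≠ 0) (L : LatV K ι A s) : L.clip hs 0 = LatV.std A s :=
  LatV.ext (clipLat_zero _ _)

theorem LatV.clip_eventually (hs : s ≠ 0) (L : LatV K ι A s) :
    ∃ n, ∀ k, n ≤ k → L.clip hs k = L := by
  obtain ⟨n, hn⟩ := L.near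
  refine ⟨n, fun k hk => LatV.ext (clipLat_eq L.lat fun x hx => ?_)⟩
  obtain ⟨j, rfl⟩ := Nat.exists_eq_add_of_le' hk
  rw [pow_add, mul_smul]
  exact L.L.smul_mem _ (hn x hx)

theorem LatV.clip_succ (hs : s ≠ 0) (L : LatV K ι A s) (k : ℕ) :
    LatV.Adj 1 (L.clip hs k) (L.clip hs (k + 1)) := by
  constructor
  · intro x hx
    obtain ⟨l, hl, hl', u, hu, rfl⟩ := mem_clipLat.1 hx
    refine mem_clipLat.2 ⟨s • l, L.L.smul_mem _ hl, ?_, u, hu, ?_⟩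
    · have : s ^ (k + 1) • s • l = (s * s) • s ^ k • l := by
        rw [smul_smul, smul_smul]; congr 1; ring
      rw [this]
      exact Submodule.smul_mem _ _ hl'
    · rw [smul_add, smul_smul, pow_one, pow_succ']
  · intro x hx
    obtain ⟨l, hl, hl', u, hu, rfl⟩ := mem_clipLat.1 hx
    refine mem_clipLat.2 ⟨s • l, L.L.smul_mem _ hl, ?_, (s * s) • u,
      Submodule.smul_mem _ _ hu, ?_⟩
    · rwa [smul_smul, ← pow_succ]
    · rw [smul_add, smul_smul, smul_smul, pow_one]
      congr 2; ring

theorem LatV.clip_adj (hs : s ≠ 0) {L L' : LatV K ι A s} (h : LatV.Adj 1 L L') (k : ℕ) :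
    LatV.Adj 1 (L.clip hs k) (L'.clip hs k) := by
  have key : ∀ {L L' : LatV K ι A s}, (∀ x ∈ L.L, s ^ 1 • x ∈ L'.L) →
      ∀ x ∈ (L.clip hs k).L, s ^ 1 • x ∈ (L'.clip hs k).L := by
    intro L L' h x hx
    obtain ⟨l, hl, hl', u, hu, rfl⟩ := mem_clipLat.1 hx
    refine mem_clipLat.2 ⟨s ^ 1 • l, h l hl, ?_, s ^ 1 • u, Submodule.smul_mem _ _ hu, ?_⟩
    · rw [smul_comm]
      exact Submodule.smul_mem _ _ hl'
    · rw [smul_add, smul_comm]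
  exact ⟨key h.1, key h.2⟩

end Vertices

end SympRed

namespace SympRed

open Sum NumberField Module

section Action

variable {K : Type} [Field K] [NumberField K] {n : ℕ}

/-- The subring `A` has the form `𝓞[1/s]`. -/
class HasDenominator (A : Subalgebra (𝓞 K) K) (s : 𝓞 K) : Prop where
  ne_zero : s ≠ 0
  inv_mem : (s : K)⁻¹ ∈ A
  exists_pow : ∀ x ∈ A, ∃ k : ℕ, IsIntegral ℤ ((s : K) ^ k * x)

variable {A : Subalgebra (𝓞 K) K} {s : 𝓞 K}

/-- Extension of scalars to `K`. -/
def toK : Sp n A →* Sp n K := SpAux.SpMap (algebraMap A K) n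

omit [NumberField K] in
theorem toK_apply_mem (γ : Sp n A) (i j) : (toK γ).1 i j ∈ A := (γ.1 i j).2

omit [NumberField K] in
theorem toK_mul (γ δ : Sp n A) : (toK (γ * δ)).1 = (toK γ).1 * (toK δ).1 := by
  rw [map_mul]; rfl

omit [NumberField K] in
theorem toK_one : (toK (1 : Sp n A)).1 = 1 := by
  rw [map_one]; rfl

omit [NumberField K] in
theorem toK_inv_mul (γ : Sp n A) : (toK γ⁻¹).1 * (toK γ).1 = 1 := by
  rw [← toK_mul, inv_mul_cancel, toK_one]

omit [NumberField K] in
theorem toK_mul_inv (γ : Sp n A) : (toK γ).1 * (toK γ⁻¹).1 = 1 := by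
  rw [← toK_mul, mul_inv_cancel, toK_one]

omit [NumberField K] in
theorem toK_injective : Function.Injective (toK : Sp n A →* Sp n K) := fun _ _ h =>
  Subtype.ext (Matrix.ext fun i j => Subtype.ext (congrFun (congrFun (congrArg Subtype.val h) i) j))

instance : MulAction (Sp n A) (FormSpace K (Fin n)) where
  smul γ G := ⟨cong G.1 (toK γ⁻¹).1, G.2.cong (toK γ⁻¹).2⟩
  one_smul G := Subtype.ext (by
    change cong G.1 (toK (1 : Sp n A)⁻¹).1 = G.1
    rw [inv_one, toK_one, cong_one])
  mul_smul γ δ G := Subtype.ext (by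
    change cong G.1 (toK (γ * δ)⁻¹).1 = cong (cong G.1 (toK δ⁻¹).1) (toK γ⁻¹).1
    rw [cong_mul, _root_.mul_inv_rev, toK_mul])

omit [NumberField K] in
theorem FormSpace.smul_val (γ : Sp n A) (G : FormSpace K (Fin n)) :
    (γ • G).1 = cong G.1 (toK γ⁻¹).1 := rfl

instance : ContinuousConstSMul (Sp n A) (FormSpace K (Fin n)) where
  continuous_const_smul γ := by
    refine Continuous.subtype_mk ?_ _
    refine continuous_pi fun σ => ?_
    have h1 : Continuous fun G : FormSpace K (Fin n) => G.1 σ :=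
      (continuous_apply σ).comp continuous_subtype_val
    exact (continuous_const.matrix_mul h1).matrix_mul continuous_const

omit [NumberField K] in
theorem exists_pow_smul_mem_stdLat [HasDenominator A s] (γ : Sp n A) :
    ∃ k : ℕ, ∀ x ∈ stdLat K (Fin n), s ^ k • ((toK γ).1 *ᵥ x) ∈ stdLat K (Fin n) := by
  choose k hk using fun i j => HasDenominator.exists_pow (s := s) _ (toK_apply_mem γ i j)
  refine ⟨∑ i, ∑ j, k i j, fun x hx => ?_⟩
  rw [mem_stdLat] at hx ⊢
  intro i
  rw [Pi.smul_apply, mulVec, dotProduct, Finset.smul_sum]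
  refine IsIntegral.sum _ fun j _ => ?_
  have h1 : k i j ≤ ∑ i, ∑ j, k i j :=
    (Finset.single_le_sum (f := fun j => k i j) (fun _ _ => Nat.zero_le _)
      (Finset.mem_univ j)).trans (Finset.single_le_sum (f := fun i => ∑ j, k i j)
      (fun _ _ => Nat.zero_le _) (Finset.mem_univ i))
  obtain ⟨d, hd⟩ := Nat.exists_eq_add_of_le' h1
  have h2 : s ^ (∑ i, ∑ j, k i j) • ((toK γ).1 i j * x j) =
      (s : K) ^ d * ((s : K) ^ k i j * (toK γ).1 i j) * x j := by
    rw [hd, Algebra.smul_def, map_pow, pow_add]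
    change (s : K) ^ d * (s : K) ^ k i j * _ = _
    ring
  rw [h2]
  exact (((show IsIntegral ℤ (s : K) from s.2).pow d).mul (hk i j)).mul (hx j)

instance [HasDenominator A s] : MulAction (Sp n A) (LatV K (Fin n) A s) where
  smul γ L :=
    { L := L.L.comap (((toK γ⁻¹).1.mulVecLin).restrictScalars (𝓞 K))
      lat := L.lat.comap (toK γ⁻¹).2
      ent := fun x hx i => by
        have h1 : x = (toK γ).1 *ᵥ ((toK γ⁻¹).1 *ᵥ x) := by
          rw [mulVec_mulVec, toK_mul_inv, one_mulVec]
        rw [h1]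
        rw [mulVec, dotProduct]
        exact A.sum_mem fun j _ => A.mul_mem (toK_apply_mem γ i j) (L.ent _ hx j)
      near := by
        obtain ⟨k, hk⟩ := exists_pow_smul_mem_stdLat (s := s) γ⁻¹
        obtain ⟨l, hl⟩ := L.near
        refine ⟨l + k, fun x hx => ?_⟩
        rw [Submodule.mem_comap, map_smul, pow_add, mul_smul]
        exact hl _ (hk x hx) }
  one_smul L := LatV.ext (by
    ext x
    change (toK (1 : Sp n A)⁻¹).1 *ᵥ x ∈ L.L ↔ _
    rw [inv_one, toK_one, one_mulVec])
  mul_smul γ δ L := LatV.ext (by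
    ext x
    change (toK (γ * δ)⁻¹).1 *ᵥ x ∈ L.L ↔ (toK δ⁻¹).1 *ᵥ ((toK γ⁻¹).1 *ᵥ x) ∈ L.L
    rw [mulVec_mulVec, _root_.mul_inv_rev, toK_mul])

omit [NumberField K] in
theorem LatV.mem_smul [HasDenominator A s] {γ : Sp n A} {L : LatV K (Fin n) A s}
    {x : Fin n ⊕ Fin n → K} : x ∈ (γ • L).L ↔ (toK γ⁻¹).1 *ᵥ x ∈ L.L := Iff.rfl

omit [NumberField K] in
theorem LatV.Adj.smul [HasDenominator A s] {r : ℕ} (γ : Sp n A) {L L' : LatV K (Fin n) A s}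
    (h : LatV.Adj r L L') : LatV.Adj r (γ • L) (γ • L') := by
  have key : ∀ {L L' : LatV K (Fin n) A s}, (∀ x ∈ L.L, s ^ r • x ∈ L'.L) →
      ∀ x ∈ (γ • L).L, s ^ r • x ∈ (γ • L').L := by
    intro L L' h x hx
    rw [LatV.mem_smul] at hx ⊢
    have : (toK γ⁻¹).1 *ᵥ (s ^ r • x) = s ^ r • ((toK γ⁻¹).1 *ᵥ x) := by
      rw [osmul_eq, osmul_eq, mulVec_smul]
    rw [this]
    exact h _ hx
  exact ⟨key h.1, key h.2⟩

end Action

section Reduced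

variable {K : Type} [Field K] [NumberField K] {n : ℕ}

/-- Bases which are reduced with strict inequalities for a family of Hermitian forms. -/
def StrictReduced (C : ℝ) (G : (K →+* ℂ) → Matrix (Fin n ⊕ Fin n) (Fin n ⊕ Fin n) ℂ)
    (b : Matrix (Fin n ⊕ Fin n) (Fin n ⊕ Fin n) K) : Prop :=
  ∃ t : Fin n ⊕ Fin n → ℝ, (∀ i, 0 < t i) ∧ (∀ i, t i.swap = (t i)⁻¹) ∧
    ∀ σ i j, ‖hs G σ (bᵀ i) (bᵀ j)‖ < C * min (t i) (t j)

omit [NumberField K] in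
theorem continuous_hs (σ : K →+* ℂ) (x y : Fin n ⊕ Fin n → K) :
    Continuous fun G : FormSpace K (Fin n) => hs G.1 σ x y := by
  have h1 : Continuous fun G : FormSpace K (Fin n) => G.1 σ :=
    (continuous_apply σ).comp continuous_subtype_val
  exact continuous_const.dotProduct (h1.matrix_mulVec continuous_const)

theorem isOpen_strictReduced (C : ℝ) (b : Matrix (Fin n ⊕ Fin n) (Fin n ⊕ Fin n) K) :
    IsOpen {G : FormSpace K (Fin n) | StrictReduced C G.1 b} := by
  have : {G : FormSpace K (Fin n) | StrictReduced C G.1 b} =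
      ⋃ t : {t : Fin n ⊕ Fin n → ℝ // (∀ i, 0 < t i) ∧ ∀ i, t i.swap = (t i)⁻¹},
        ⋂ σ, ⋂ i, ⋂ j, {G : FormSpace K (Fin n) |
          ‖hs G.1 σ (bᵀ i) (bᵀ j)‖ < C * min (t.1 i) (t.1 j)} := by
    ext G
    simp only [StrictReduced, Set.mem_ofPred_eq, Set.mem_iUnion, Set.mem_iInter]
    constructor
    · rintro ⟨t, ht, hsw, h⟩
      exact ⟨⟨t, ht, hsw⟩, h⟩
    · rintro ⟨⟨t, ht, hsw⟩, h⟩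
      exact ⟨t, ht, hsw, h⟩
  rw [this]
  refine isOpen_iUnion fun t => isOpen_iInter_of_finite fun σ => isOpen_iInter_of_finite fun i =>
    isOpen_iInter_of_finite fun j => ?_
  exact isOpen_lt (continuous_hs σ _ _).norm continuous_const

omit [NumberField K] in
theorem mul_transpose_apply (a b : Matrix (Fin n ⊕ Fin n) (Fin n ⊕ Fin n) K) (j) :
    (a * b)ᵀ j = a *ᵥ bᵀ j := by
  rw [← mulVec_single, ← mulVec_single, mulVec_mulVec]

omit [NumberField K] in
theorem strictReduced_cong {C : ℝ} {G : (K →+* ℂ) → Matrix (Fin n ⊕ Fin n) (Fin n ⊕ Fin n) ℂ}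
    {a b : Matrix (Fin n ⊕ Fin n) (Fin n ⊕ Fin n) K} :
    StrictReduced C (cong G a) b ↔ StrictReduced C G (a * b) := by
  simp only [StrictReduced, mul_transpose_apply, hs_cong]

end Reduced

end SympRed

namespace SympRed

open Sum NumberField Module NFLattice

section Inverse

variable {R : Type} [CommRing R] {ι : Type} [Fintype ι] [DecidableEq ι]

/-- The signs occurring in the inverse of a symplectic matrix. -/
def sgn (R : Type) [CommRing R] : ι ⊕ ι → R := Sum.elim (fun _ => 1) (fun _ => -1)

theorem symplectic_inv_apply {b : Matrix (ι ⊕ ι) (ι ⊕ ι) R} (hb : b ∈ symplecticGroup ι R) (i j) :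
    b⁻¹ i j = sgn R i * sgn R j * b j.swap i.swap := by
  rw [SymplecticGroup.inv_eq_symplectic_inv b hb]
  rcases i with i | i <;> rcases j with j | j <;>
    simp [mul_apply, Fintype.sum_sum_type, J, one_apply, sgn]

omit [Fintype ι] [DecidableEq ι] in
theorem norm_sgn_mul (i j : ι ⊕ ι) (x : ℂ) : ‖sgn ℂ i * sgn ℂ j * x‖ = ‖x‖ := by
  rcases i with i | i <;> rcases j with j | j <;> simp [sgn]

theorem norm_symplectic_inv {b : Matrix (ι ⊕ ι) (ι ⊕ ι) ℂ} (hb : b ∈ symplecticGroup ι ℂ) (i j) :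
    ‖b⁻¹ i j‖ = ‖b j.swap i.swap‖ := by
  rw [symplectic_inv_apply hb, norm_sgn_mul]

end Inverse

section Siegel

variable {n : ℕ} {G γ : Matrix (Fin n ⊕ Fin n) (Fin n ⊕ Fin n) ℂ} {C c : ℝ}
  {t t' : Fin n ⊕ Fin n → ℝ}

theorem norm_sq_entry_le (hG : HPos G) (hGs : G ∈ symplecticGroup (Fin n) ℂ) (hC : 0 ≤ C)
    (ht : ∀ i, 0 < t i) (hsw : ∀ i, t i.swap = (t i)⁻¹) (ht' : ∀ i, 0 < t' i)
    (h1 : ∀ i j, ‖G i j‖ ≤ C * min (t i) (t j))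
    (h2 : ∀ i j, ‖(γᴴ * G * γ) i j‖ ≤ C * min (t' i) (t' j)) (i j) :
    ‖γ i j‖ ^ 2 * t i ≤ C ^ 2 * t' j := by
  have key : ‖γ i j‖ = ‖om (γ *ᵥ Pi.single j 1) (Pi.single i.swap 1)‖ := by
    rcases i with i | i
    · rw [swap_inl, om_single_inr, mulVec_single, transpose_apply]
    · rw [swap_inr, om_single_inl, mulVec_single, transpose_apply, norm_neg]
  have h3 := norm_om_sq_le hG hGs (γ *ᵥ Pi.single j 1) (Pi.single i.swap 1)
  rw [← key, ← hf_mulVec, hf_single, hf_single] at h3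
  have h4 : ((γᴴ * G * γ) j j).re ≤ C * t' j := by
    simpa using (Complex.re_le_norm _).trans (h2 j j)
  have h5 : (G i.swap i.swap).re ≤ C * (t i)⁻¹ := by
    simpa [hsw] using (Complex.re_le_norm _).trans (h1 i.swap i.swap)
  have h6 : 0 ≤ (G i.swap i.swap).re := by
    have := hf_self_nonneg hG (Pi.single i.swap 1)
    rwa [hf_single] at this
  have h7 : ‖γ i j‖ ^ 2 ≤ (C * t' j) * (C * (t i)⁻¹) :=
    h3.trans (mul_le_mul h4 h5 h6 (mul_nonneg hC (ht' j).le))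
  calc ‖γ i j‖ ^ 2 * t i ≤ (C * t' j) * (C * (t i)⁻¹) * t i :=
        mul_le_mul_of_nonneg_right h7 (ht i).le
    _ = C ^ 2 * t' j := by field_simp [(ht i).ne']

theorem norm_siegel_entry_le (hG : HPos G) (hGs : G ∈ symplecticGroup (Fin n) ℂ)
    (hγ : γ ∈ symplecticGroup (Fin n) ℂ) (hC : 0 ≤ C) (hc : 1 ≤ c)
    (ht : ∀ i, 0 < t i) (hsw : ∀ i, t i.swap = (t i)⁻¹) (ht' : ∀ i, 0 < t' i)
    (hsw' : ∀ i, t' i.swap = (t' i)⁻¹)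
    (h1 : ∀ i j, ‖G i j‖ ≤ C * min (t i) (t j))
    (h2 : ∀ i j, ‖(γᴴ * G * γ) i j‖ ≤ C * min (t' i) (t' j))
    (h3 : ∀ i j, γ i j ≠ 0 → t i ≤ c * t' j) (i j) :
    ‖γ i j‖ ≤ (Fintype.card (Fin n ⊕ Fin n)) ^ 2 * (C ^ 3 * c) := by
  have hu := SymplecticGroup.symplectic_det hγ
  have huG := SymplecticGroup.symplectic_det hGs
  have hH : G * γ = (γ⁻¹)ᴴ * (γᴴ * G * γ) := by
    rw [← mul_assoc, ← mul_assoc, ← conjTranspose_mul, mul_nonsing_inv _ hu, conjTranspose_one,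
      one_mul]
  have h4 : ∀ k l, ‖γ⁻¹ l k‖ * (C * t' l) ≤ C ^ 2 * c * t k := by
    intro k l
    rw [norm_symplectic_inv hγ]
    by_cases h0 : γ k.swap l.swap = 0
    · rw [h0, norm_zero, zero_mul]
      have := ht k
      positivity
    · have h5 := h3 _ _ h0
      rw [hsw, hsw'] at h5
      have h6 : t' l ≤ c * t k := by
        have hk := ht k
        have hl := ht' l
        field_simp at h5
        linarith
      have h7 := norm_sq_entry_le hG hGs hC ht hsw ht' h1 h2 k.swap l.swap
      rw [hsw, hsw'] at h7
      have hk := ht k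
      have hl := ht' l
      have h8 : (‖γ k.swap l.swap‖ * t' l) ^ 2 ≤ (C * c * t k) ^ 2 := by
        have h9 : ‖γ k.swap l.swap‖ ^ 2 * t' l ≤ C ^ 2 * t k := by
          field_simp at h7
          linarith
        calc (‖γ k.swap l.swap‖ * t' l) ^ 2 = ‖γ k.swap l.swap‖ ^ 2 * t' l * t' l := by ring
          _ ≤ C ^ 2 * t k * (c * t k) := by
            refine mul_le_mul h9 h6 hl.le (by positivity)
          _ ≤ C ^ 2 * t k * (c * t k) * c := le_mul_of_one_le_right (by positivity) hc
          _ = (C * c * t k) ^ 2 := by ring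
      have h9 : ‖γ k.swap l.swap‖ * t' l ≤ C * c * t k :=
        le_of_sq_le_sq h8 (by positivity)
      calc ‖γ k.swap l.swap‖ * (C * t' l) = C * (‖γ k.swap l.swap‖ * t' l) := by ring
        _ ≤ C * (C * c * t k) := mul_le_mul_of_nonneg_left h9 hC
        _ = C ^ 2 * c * t k := by ring
  have h5 : ∀ k, ‖(G * γ) k j‖ ≤ Fintype.card (Fin n ⊕ Fin n) * (C ^ 2 * c * t k) := by
    intro k
    rw [hH, mul_apply, ← Finset.card_univ, ← nsmul_eq_mul]
    refine (norm_sum_le _ _).trans (Finset.sum_le_card_nsmul _ _ _ fun l _ => ?_)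
    rw [norm_mul, conjTranspose_apply, norm_star]
    refine le_trans ?_ (h4 k l)
    refine mul_le_mul_of_nonneg_left ((h2 l j).trans ?_) (norm_nonneg _)
    exact mul_le_mul_of_nonneg_left (min_le_left _ _) hC
  have h6 : γ = G⁻¹ * (G * γ) := by rw [← mul_assoc, nonsing_inv_mul _ huG, one_mul]
  rw [h6, mul_apply]
  calc ‖∑ k, G⁻¹ i k * (G * γ) k j‖ ≤
        (Finset.univ : Finset (Fin n ⊕ Fin n)).card •
          (Fintype.card (Fin n ⊕ Fin n) * (C ^ 3 * c)) := by
        refine (norm_sum_le _ _).trans (Finset.sum_le_card_nsmul _ _ _ fun k _ => ?_)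
        rw [norm_mul, norm_symplectic_inv hGs]
        have hk := ht k
        have h7 : ‖G k.swap i.swap‖ ≤ C * (t k)⁻¹ := by
          rw [← hsw]
          exact (h1 _ _).trans (mul_le_mul_of_nonneg_left (min_le_left _ _) hC)
        refine (mul_le_mul h7 (h5 k) (norm_nonneg _) (by positivity)).trans (le_of_eq ?_)
        field_simp
    _ = _ := by rw [nsmul_eq_mul, Finset.card_univ]; ring

end Siegel

section Finiteness

variable {K : Type} [Field K] [NumberField K] {n : ℕ}

variable (n) in
/-- The Siegel finiteness property. -/
theorem finite_strictReduced {C : ℝ} (hC : 0 ≤ C) {m : 𝓞 K} (hm : m ≠ 0) :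
    {γ : Matrix (Fin n ⊕ Fin n) (Fin n ⊕ Fin n) K | γ ∈ symplecticGroup (Fin n) K ∧
      (∀ i j, IsIntegral ℤ ((m : K) * γ i j)) ∧ ∃ G, Compat G ∧ StrictReduced C G 1 ∧
        StrictReduced C G γ}.Finite := by
  set d := Fintype.card (K →+* ℂ) with hd
  have hd0 : d ≠ 0 := by
    rw [hd, card_embeddings]
    exact finrank_pos.ne'
  set μ : ℝ := ∏ σ : K →+* ℂ, ‖σ m‖ with hμ
  have hμ1 : 1 ≤ μ := one_le_prod_norm hm
  set c : ℝ := max 1 (μ ^ 2 * C ^ 2) with hc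
  set B : ℝ := (Fintype.card (Fin n ⊕ Fin n)) ^ 2 * (C ^ 3 * c) with hB
  set F : Set K := {x : K | IsIntegral ℤ x ∧ ∀ φ : K →+* ℂ, ‖φ x‖ ≤ (∑ σ : K →+* ℂ, ‖σ m‖) * B}
  have hF : F.Finite := Embeddings.finite_of_norm_le K ℂ _
  have hmK : (m : K) ≠ 0 := by simpa using hm
  have hfin : {γ : Matrix (Fin n ⊕ Fin n) (Fin n ⊕ Fin n) K | ∀ i j, γ i j ∈
      (fun x => (m : K) * x) ⁻¹' F}.Finite := by
    have h1 := hF.preimage (mul_right_injective₀ hmK).injOn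
    exact Set.Finite.pi' fun i => Set.Finite.pi' fun j => h1
  refine hfin.subset ?_
  rintro γ ⟨hγ, h_int, G, hG, ⟨t, ht, hsw, h1⟩, t', ht', hsw', h2⟩ i j
  refine ⟨h_int i j, fun φ => ?_⟩
  have hB0 : 0 ≤ B := by positivity
  rw [map_mul, norm_mul]
  refine mul_le_mul (Finset.single_le_sum (f := fun σ : K →+* ℂ => ‖σ m‖)
    (fun _ _ => norm_nonneg _) (Finset.mem_univ φ)) ?_ (norm_nonneg _)
    (Finset.sum_nonneg fun _ _ => norm_nonneg _)
  have hg1 : ∀ (σ : K →+* ℂ) i j, ‖G σ i j‖ ≤ C * min (t i) (t j) := fun σ i j => by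
    have := (h1 σ i j).le
    rwa [← cong_apply, cong_one] at this
  have hg2 : ∀ (σ : K →+* ℂ) i j, ‖((γ.map σ)ᴴ * G σ * γ.map σ) i j‖ ≤ C * min (t' i) (t' j) :=
    fun σ i j => by
      have := (h2 σ i j).le
      rwa [← cong_apply] at this
  refine norm_siegel_entry_le (γ := γ.map φ) (hG.pos φ) (hG.symp φ) (map_mem_symplecticGroup φ hγ) hC
    (le_max_left _ _) ht hsw ht' hsw' (hg1 φ) (hg2 φ) (fun k l hkl => ?_) i j
  have hkl' : γ k l ≠ 0 := fun h => hkl (by simp [h])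
  have h3 : ∀ σ : K →+* ℂ, ‖σ (γ k l)‖ ^ 2 * t k ≤ C ^ 2 * t' l := fun σ =>
    norm_sq_entry_le (γ := γ.map σ) (hG.pos σ) (hG.symp σ) hC ht hsw ht' (hg1 σ) (hg2 σ) k l
  have h4 : 1 ≤ ∏ σ : K →+* ℂ, ‖σ ((m : K) * γ k l)‖ :=
    one_le_prod_norm (x := ⟨_, h_int k l⟩) fun h => mul_ne_zero hmK hkl' (congrArg Subtype.val h)
  have hk := ht k
  have hl := ht' l
  have h5 : t k ^ d ≤ (μ ^ 2 * C ^ 2 * t' l) ^ d := by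
    calc t k ^ d ≤ (∏ σ : K →+* ℂ, ‖σ ((m : K) * γ k l)‖) ^ 2 * t k ^ d :=
          le_mul_of_one_le_left (by positivity) (one_le_pow₀ h4)
      _ = μ ^ 2 * ∏ σ : K →+* ℂ, (‖σ (γ k l)‖ ^ 2 * t k) := by
          simp only [map_mul, norm_mul, Finset.prod_mul_distrib, Finset.prod_pow,
            Finset.prod_const, Finset.card_univ, mul_pow, ← hd, hμ]
          ring
      _ ≤ μ ^ 2 * ∏ σ : K →+* ℂ, (C ^ 2 * t' l) := by
          refine mul_le_mul_of_nonneg_left ?_ (by positivity)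
          exact Finset.prod_le_prod (fun σ _ => by positivity) fun σ _ => h3 σ
      _ = μ ^ 2 * (C ^ 2 * t' l) ^ d := by rw [Finset.prod_const, Finset.card_univ]
      _ ≤ (μ ^ 2) ^ d * (C ^ 2 * t' l) ^ d := by
          refine mul_le_mul_of_nonneg_right ?_ (by positivity)
          exact le_self_pow₀ (one_le_pow₀ hμ1) hd0
      _ = (μ ^ 2 * C ^ 2 * t' l) ^ d := by rw [← mul_pow, mul_assoc]
  have h6 : t k ≤ μ ^ 2 * C ^ 2 * t' l := le_of_pow_le_pow_left₀ hd0 (by positivity) h5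
  exact h6.trans (mul_le_mul_of_nonneg_right (le_max_right _ _) hl.le)

end Finiteness

end SympRed

namespace SympRed

open Sum NumberField Module

section Cosets

variable {K : Type} [Field K] [NumberField K] {n : ℕ} (A : Subalgebra (𝓞 K) K) (s : 𝓞 K)

theorem finite_quotient [HasDenominator A s] {m : ℕ} (hm : m ≠ 0) :
    Finite (A ⧸ Ideal.span {(m : A)}) := by
  have hs := HasDenominator.ne_zero A (s := s)
  have hsK : (s : K) ≠ 0 := by simpa using hs
  have hfin : Finite (𝓞 K ⧸ Ideal.span {(m : 𝓞 K)}) :=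
    Ring.HasFiniteQuotients.finiteQuotient (by
      rw [Ne, Ideal.span_singleton_eq_bot]
      exact_mod_cast hm)
  let f : 𝓞 K →+* A ⧸ Ideal.span {(m : A)} := (Ideal.Quotient.mk _).comp (algebraMap (𝓞 K) A)
  have hf : ∀ a ∈ Ideal.span {(m : 𝓞 K)}, f a = 0 := by
    intro a ha
    obtain ⟨c, rfl⟩ := Ideal.mem_span_singleton'.1 ha
    have : f (m : 𝓞 K) = 0 := by
      rw [map_natCast, ← map_natCast (Ideal.Quotient.mk (Ideal.span {(m : A)}))]
      exact Ideal.Quotient.eq_zero_iff_mem.2 (Ideal.mem_span_singleton_self _)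
    rw [map_mul, this, mul_zero]
  let F := Ideal.Quotient.lift (Ideal.span {(m : 𝓞 K)}) f hf
  have hu : IsUnit (f s) := by
    refine IsUnit.map (Ideal.Quotient.mk _) (IsUnit.of_mul_eq_one
      (⟨_, HasDenominator.inv_mem (A := A) (s := s)⟩ : A) (Subtype.ext ?_))
    exact mul_inv_cancel₀ hsK
  obtain ⟨j, hj, hj1⟩ : ∃ j : ℕ, 1 ≤ j ∧ f s ^ j = 1 := by
    obtain ⟨a, b, hab, h⟩ := Finite.exists_ne_map_eq_of_infinite
      fun k : ℕ => (Ideal.Quotient.mk (Ideal.span {(m : 𝓞 K)}) s) ^ k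
    wlog hlt : a < b generalizing a b
    · exact this b a hab.symm h.symm (lt_of_le_of_ne (not_lt.1 hlt) hab.symm)
    refine ⟨b - a, by omega, ?_⟩
    have h1 := congrArg F h
    simp only [map_pow] at h1
    change f s ^ a = f s ^ b at h1
    apply (hu.pow a).mul_left_cancel
    rw [← pow_add, Nat.add_sub_cancel' hlt.le, mul_one, h1]
  refine Finite.of_surjective F fun q => ?_
  obtain ⟨x, rfl⟩ := Ideal.Quotient.mk_surjective q
  obtain ⟨k, hk⟩ := HasDenominator.exists_pow (A := A) (s := s) x x.2
  obtain ⟨y, hy⟩ : ∃ y : 𝓞 K, (y : K) = (s : K) ^ k * x := ⟨⟨_, hk⟩, rfl⟩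
  refine ⟨Ideal.Quotient.mk _ (s ^ (j * k - k) * y), ?_⟩
  change f _ = _
  have h2 : algebraMap (𝓞 K) A (s ^ (j * k - k) * y) =
      algebraMap (𝓞 K) A s ^ (j * k) * x := by
    rw [map_mul, map_pow]
    have h3 : j * k = (j * k - k) + k := (Nat.sub_add_cancel (Nat.le_mul_of_pos_left k hj)).symm
    conv_rhs => rw [h3]
    rw [pow_add, mul_assoc]
    congr 1
    exact Subtype.ext hy
  have h3 : f (s ^ (j * k - k) * y) =
      f s ^ (j * k) * Ideal.Quotient.mk _ x := by
    change Ideal.Quotient.mk _ (algebraMap (𝓞 K) A _) = _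
    rw [h2, map_mul, map_pow]
    rfl
  rw [h3, pow_mul, hj1, one_pow, one_mul]

variable (n) in
/-- Symplectic matrices with bounded denominators fall in finitely many cosets. -/
theorem exists_finite_cosets [HasDenominator A s] {N : ℕ} (hN : 1 ≤ N) :
    ∃ R : Set (Matrix (Fin n ⊕ Fin n) (Fin n ⊕ Fin n) K), R.Finite ∧
      (∀ r ∈ R, r ∈ symplecticGroup (Fin n) K) ∧
      ∀ b ∈ symplecticGroup (Fin n) K, (∀ i j, (N : K) * b i j ∈ A) →
        ∃ γ : Sp n A, ∃ r ∈ R, b = (toK γ).1 * r := by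
  have hfin := finite_quotient A s (m := N ^ 2) (by positivity)
  let B := {b : Matrix (Fin n ⊕ Fin n) (Fin n ⊕ Fin n) K //
    b ∈ symplecticGroup (Fin n) K ∧ ∀ i j, (N : K) * b i j ∈ A}
  let f : B → (Fin n ⊕ Fin n → Fin n ⊕ Fin n → A ⧸ Ideal.span {((N ^ 2 : ℕ) : A)}) :=
    fun b i j => Ideal.Quotient.mk _ ⟨_, b.2.2 i j⟩
  let φ : Set.range f → B := fun q => q.2.choose
  have hφ : ∀ q, f (φ q) = q.1 := fun q => q.2.choose_spec
  refine ⟨Set.range fun q => (φ q).1, Set.finite_range _, ?_, fun b hb hbA => ?_⟩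
  · rintro _ ⟨q, rfl⟩
    exact (φ q).2.1
  set r : B := φ ⟨f ⟨b, hb, hbA⟩, _, rfl⟩ with hr
  have h1 : f r = f ⟨b, hb, hbA⟩ := hφ _
  have hN0 : (N : K) ≠ 0 := by exact_mod_cast (by omega : N ≠ 0)
  have h2 : ∀ i j, ∃ z : A, b i j = r.1 i j + N * z := by
    intro i j
    have h3 := congrFun (congrFun h1.symm i) j
    obtain ⟨z, hz⟩ := Ideal.mem_span_singleton'.1 (Ideal.Quotient.eq.1 h3)
    refine ⟨z, ?_⟩
    have h4 : (z : K) * ((N : K) ^ 2) = N * b i j - N * r.1 i j := by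
      have := congrArg Subtype.val hz
      simpa using this
    apply mul_left_cancel₀ hN0
    linear_combination -h4
  choose X hX using h2
  have hu := SymplecticGroup.symplectic_det r.2.1
  have hinvA : ∀ i j, (N : K) * r.1⁻¹ i j ∈ A := by
    intro i j
    have h3 := r.2.2 j.swap i.swap
    rw [symplectic_inv_apply r.2.1]
    rcases i with i | i <;> rcases j with j | j <;> simp [sgn] at h3 ⊢ <;> exact h3
  have h3 : ∀ i j, (b * r.1⁻¹) i j ∈ A := by
    intro i j
    have h4 : b = r.1 + (N : K) • (Matrix.of fun i j => (X i j : K)) := by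
      ext i j
      rw [hX]
      rfl
    rw [h4, add_mul, mul_nonsing_inv _ hu, Matrix.add_apply, Matrix.smul_mul, ← Matrix.mul_smul,
      mul_apply]
    refine A.add_mem ?_ (A.sum_mem fun k _ => A.mul_mem (X i k).2 (hinvA k j))
    rw [one_apply]
    split_ifs
    exacts [A.one_mem, A.zero_mem]
  have hrinv : r.1⁻¹ ∈ symplecticGroup (Fin n) K := by
    rw [SymplecticGroup.inv_eq_symplectic_inv _ r.2.1]
    exact (⟨r.1, r.2.1⟩⁻¹ : symplecticGroup (Fin n) K).2
  let g : Matrix (Fin n ⊕ Fin n) (Fin n ⊕ Fin n) A := fun i j => ⟨_, h3 i j⟩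
  have hgmap : g.map (algebraMap A K) = b * r.1⁻¹ := rfl
  have hg : g ∈ Sp n A := by
    rw [SymplecticGroup.mem_iff]
    have h5 := SymplecticGroup.mem_iff.1 (mul_mem hb hrinv)
    have hinj : Function.Injective (algebraMap A K) := Subtype.val_injective
    apply Matrix.map_injective hinj
    change (g * J (Fin n) A * gᵀ).map (algebraMap A K) = (J (Fin n) A).map (algebraMap A K)
    rw [Matrix.map_mul, Matrix.map_mul, SpAux.J_map, transpose_map, hgmap, h5]
  refine ⟨⟨g, hg⟩, r.1, ⟨_, rfl⟩, ?_⟩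
  change b = b * r.1⁻¹ * r.1
  rw [mul_assoc, nonsing_inv_mul _ hu, mul_one]

end Cosets

end SympRed

namespace SympRed

open NumberField IsDedekindDomain

section SInteger

variable {K : Type} [Field K] [NumberField K]

theorem exists_element_with_support {S : Set (HeightOneSpectrum (𝓞 K))} (hS : S.Finite) :
    ∃ s : 𝓞 K, s ≠ 0 ∧ ∀ v : HeightOneSpectrum (𝓞 K), s ∈ v.asIdeal ↔ v ∈ S := by
  classical
  let I : Ideal (𝓞 K) := ∏ v ∈ hS.toFinset, v.asIdeal
  have hI : I ≠ 0 := Finset.prod_ne_zero_iff.2 fun v _ => v.ne_bot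
  have hc := pow_card_eq_one (x := ClassGroup.mk0 ⟨I, mem_nonZeroDivisors_of_ne_zero hI⟩)
  rw [← map_pow, ClassGroup.mk0_eq_one_iff] at hc
  obtain ⟨s, hs⟩ := hc.principal
  have hs' : I ^ Fintype.card (ClassGroup (𝓞 K)) = Ideal.span {s} := hs
  refine ⟨s, ?_, fun v => ?_⟩
  · rintro rfl
    rw [Ideal.span_singleton_eq_bot.2 rfl] at hs'
    exact pow_ne_zero _ hI hs'
  · rw [← Ideal.span_singleton_le_iff_mem, ← hs', v.isPrime.pow_le_iff Fintype.card_ne_zero,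
      v.isPrime.prod_le]
    constructor
    · rintro ⟨w, hw, hle⟩
      have : w = v := HeightOneSpectrum.ext (w.isMaximal.eq_of_le v.isPrime.ne_top hle)
      exact this ▸ hS.mem_toFinset.1 hw
    · intro hv
      exact ⟨v, hS.mem_toFinset.2 hv, le_rfl⟩

theorem exists_hasDenominator_integer {S : Set (HeightOneSpectrum (𝓞 K))} (hS : S.Finite) :
    ∃ s : 𝓞 K, HasDenominator (S.integer K) s := by
  obtain ⟨s, hs0, hs⟩ := exists_element_with_support hS
  refine ⟨s, hs0, fun v hv => ?_, fun x hx => ?_⟩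
  · have h1 : v.valuation K (s : K) = 1 := by
      refine le_antisymm (v.valuation_le_one s) (not_lt.1 fun h => hv ?_)
      exact (hs v).1 ((v.valuation_lt_one_iff_mem s).1 h)
    rw [map_inv₀, h1, inv_one]
  · have hk : ∀ v ∈ S, ∃ k : ℕ, v.valuation K ((s : K) ^ k * x) ≤ 1 := by
      intro v hv
      have h1 : v.valuation K (s : K) < 1 := (v.valuation_lt_one_iff_mem s).2 ((hs v).2 hv)
      by_cases hx0 : x = 0
      · exact ⟨0, by simp [hx0]⟩
      have hvx : v.valuation K x ≠ 0 := (Valuation.ne_zero_iff _).2 hx0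
      obtain ⟨k, hk⟩ := exists_pow_lt₀ h1 (Units.mk0 _ (inv_ne_zero hvx))
      refine ⟨k, ?_⟩
      rw [map_mul, map_pow]
      calc _ ≤ (v.valuation K x)⁻¹ * v.valuation K x := mul_le_mul_left hk.le _
        _ = 1 := inv_mul_cancel₀ hvx
    choose! k hk using hk
    refine ⟨∑ v ∈ hS.toFinset, k v, ?_⟩
    have : ∀ v : HeightOneSpectrum (𝓞 K),
        v.valuation K ((s : K) ^ (∑ v ∈ hS.toFinset, k v) * x) ≤ 1 := by
      intro v
      by_cases hv : v ∈ S
      · have hle : k v ≤ ∑ v ∈ hS.toFinset, k v :=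
          Finset.single_le_sum (fun _ _ => Nat.zero_le _) (hS.mem_toFinset.2 hv)
        obtain ⟨d, hd⟩ := Nat.exists_eq_add_of_le' hle
        rw [hd, pow_add, mul_assoc, map_mul, map_pow]
        exact mul_le_one' (pow_le_one' (v.valuation_le_one s) _) (hk v hv)
      · rw [map_mul, map_pow]
        exact mul_le_one' (pow_le_one' (v.valuation_le_one s) _) (hx v hv)
    obtain ⟨y, hy⟩ := HeightOneSpectrum.mem_integers_of_valuation_le_one K _ this
    rw [← hy]
    exact y.isIntegral_coe

end SInteger

end SympRed

namespace SympRed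

open Sum NumberField

section Cover

variable {K : Type} [Field K] [NumberField K] {n : ℕ}
  {A : Subalgebra (𝓞 K) K} {s : 𝓞 K}

/-- The forms which have, for the lattice `L`, a reduced basis in the coset of `γ`. -/
def coverSet (N : ℕ) (C : ℝ) (R : Set (Matrix (Fin n ⊕ Fin n) (Fin n ⊕ Fin n) K)) (γ : Sp n A)
    (L : LatV K (Fin n) A s) : Set (FormSpace K (Fin n)) :=
  {G | ∃ r ∈ R, (∀ j, N • ((toK γ).1 * r)ᵀ j ∈ L.L) ∧ StrictReduced C G.1 ((toK γ).1 * r)}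

theorem isOpen_coverSet (N : ℕ) (C : ℝ) (R : Set (Matrix (Fin n ⊕ Fin n) (Fin n ⊕ Fin n) K))
    (γ : Sp n A) (L : LatV K (Fin n) A s) : IsOpen (coverSet N C R γ L) := by
  have : coverSet N C R γ L = ⋃ r ∈ {r ∈ R | ∀ j, N • ((toK γ).1 * r)ᵀ j ∈ L.L},
      {G | StrictReduced C G.1 ((toK γ).1 * r)} := by
    ext G
    simp only [coverSet, Set.mem_iUnion, Set.mem_ofPred_eq, exists_prop, and_assoc]
  rw [this]
  exact isOpen_biUnion fun r _ => isOpen_strictReduced _ _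

omit [NumberField K] in
theorem smul_mem_coverSet [HasDenominator A s] {N : ℕ} {C : ℝ}
    {R : Set (Matrix (Fin n ⊕ Fin n) (Fin n ⊕ Fin n) K)} (δ : Sp n A) {γ : Sp n A}
    {L : LatV K (Fin n) A s} {G : FormSpace K (Fin n)} (h : G ∈ coverSet N C R γ L) :
    δ • G ∈ coverSet N C R (δ * γ) (δ • L) := by
  obtain ⟨r, hr, h1, h2⟩ := h
  have h3 : (toK δ⁻¹).1 * ((toK (δ * γ)).1 * r) = (toK γ).1 * r := by
    rw [toK_mul, mul_assoc, ← mul_assoc, toK_inv_mul, one_mul]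
  refine ⟨r, hr, fun j => ?_, ?_⟩
  · rw [LatV.mem_smul, natCast_smul, mulVec_smul, ← natCast_smul, ← mul_transpose_apply, h3]
    exact h1 j
  · rw [FormSpace.smul_val, strictReduced_cong, h3]
    exact h2

theorem mem_coverSet [HasDenominator A s] {N : ℕ} {C : ℝ} (hred : HasReducedBases n K 1 N C)
    {R : Set (Matrix (Fin n ⊕ Fin n) (Fin n ⊕ Fin n) K)}
    (hR : ∀ b ∈ symplecticGroup (Fin n) K, (∀ i j, (N : K) * b i j ∈ A) →
        ∃ γ : Sp n A, ∃ r ∈ R, b = (toK γ).1 * r)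
    (L : LatV K (Fin n) A s) (G : FormSpace K (Fin n)) :
    ∃ γ : Sp n A, G ∈ coverSet N (C + 1) R γ L := by
  obtain ⟨b, hb, hbL, t, ht, hsw, hle⟩ := hred G.1 L.L G.2 L.lat
  obtain ⟨γ, r, hr, rfl⟩ := hR b hb fun i j => by
    have := L.ent _ (hbL j) i
    rwa [natCast_smul] at this
  refine ⟨γ, r, hr, hbL, t, ht, hsw, fun σ i j => (hle σ i j).trans_lt ?_⟩
  exact mul_lt_mul_of_pos_right (lt_add_one C) (lt_min (ht i) (ht j))

omit [NumberField K] in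
theorem isIntegral_transition {N : ℕ} {L L' : LatV K (Fin n) A s} (h : LatV.Adj 2 L L')
    {b b' : Matrix (Fin n ⊕ Fin n) (Fin n ⊕ Fin n) K} (hb : b ∈ symplecticGroup (Fin n) K)
    (hbL : ∀ j, N • bᵀ j ∈ L.L) (hbL' : ∀ j, N • b'ᵀ j ∈ L'.L) (i j) :
    IsIntegral ℤ (((s ^ 2 * (N : 𝓞 K) ^ 2 : 𝓞 K) : K) * (b⁻¹ * b') i j) := by
  have hu := SymplecticGroup.symplectic_det hb
  have h1 : ∀ k, IsIntegral ℤ (((s ^ 2 * (N : 𝓞 K) ^ 2 : 𝓞 K) : K) *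
      om ((b⁻¹ * b')ᵀ j) (Pi.single k 1)) := by
    intro k
    have h2 := L.lat.integral _ (h.2 _ (hbL' j)) _ (hbL k)
    rw [om_osmul_left, natCast_smul, natCast_smul, ← mulVec_single b] at h2
    have h3 : b'ᵀ j = b *ᵥ (b⁻¹ * b')ᵀ j := by
      rw [← mul_transpose_apply, ← mul_assoc, mul_nonsing_inv _ hu, one_mul]
    rw [h3, ← mulVec_smul, ← mulVec_smul, om_mulVec hb] at h2
    simp only [map_smul, LinearMap.smul_apply, smul_eq_mul] at h2
    convert h2 using 1
    push_cast
    ring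
  rcases i with i | i
  · have := h1 (inr i)
    rwa [om_single_inr] at this
  · have := h1 (inl i)
    rw [om_single_inl, mul_neg] at this
    simpa using this.neg

theorem finite_coverSet_diffs [HasDenominator A s] {N : ℕ} (hN : 1 ≤ N) {C : ℝ} (hC : 0 ≤ C)
    {R : Set (Matrix (Fin n ⊕ Fin n) (Fin n ⊕ Fin n) K)} (hR : R.Finite)
    (hRs : ∀ r ∈ R, r ∈ symplecticGroup (Fin n) K) :
    {δ : Sp n A | ∃ γ γ' : Sp n A, ∃ L L' : LatV K (Fin n) A s, ∃ G, LatV.Adj 2 L L' ∧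
      G ∈ coverSet N C R γ L ∧ G ∈ coverSet N C R γ' L' ∧ δ = γ⁻¹ * γ'}.Finite := by
  have hm : s ^ 2 * (N : 𝓞 K) ^ 2 ≠ 0 := by
    refine mul_ne_zero (pow_ne_zero _ (HasDenominator.ne_zero A)) (pow_ne_zero _ ?_)
    exact_mod_cast (by omega : N ≠ 0)
  have hE := finite_strictReduced (K := K) n hC hm
  have hfin := (hR.prod (hE.prod hR)).image fun p => p.1 * p.2.1 * p.2.2⁻¹
  have hinj : Function.Injective fun δ : Sp n A => (toK δ).1 :=
    Subtype.val_injective.comp toK_injective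
  refine (hfin.preimage hinj.injOn).subset ?_
  rintro _ ⟨γ, γ', L, L', G, hL, ⟨r, hr, h1, h2⟩, ⟨r', hr', h1', h2'⟩, rfl⟩
  have hb : (toK γ).1 * r ∈ symplecticGroup (Fin n) K := mul_mem (toK γ).2 (hRs r hr)
  have hb' : (toK γ').1 * r' ∈ symplecticGroup (Fin n) K := mul_mem (toK γ').2 (hRs r' hr')
  have hu := SymplecticGroup.symplectic_det hb
  refine ⟨(r, ((toK γ).1 * r)⁻¹ * ((toK γ').1 * r'), r'),
    ⟨hr, ⟨mul_mem ?_ hb', ?_, cong G.1 ((toK γ).1 * r), G.2.cong hb, ?_, ?_⟩, hr'⟩, ?_⟩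
  · rw [SymplecticGroup.inv_eq_symplectic_inv _ hb]
    exact (⟨_, hb⟩⁻¹ : symplecticGroup (Fin n) K).2
  · exact isIntegral_transition hL hb h1 h1'
  · rw [strictReduced_cong, mul_one]
    exact h2
  · rw [strictReduced_cong, ← mul_assoc, mul_nonsing_inv _ hu, one_mul]
    exact h2'
  · have hγ : (toK γ).1⁻¹ = (toK γ⁻¹).1 := inv_eq_left_inv (toK_inv_mul γ)
    change r * (((toK γ).1 * r)⁻¹ * ((toK γ').1 * r')) * r'⁻¹ = (toK (γ⁻¹ * γ')).1
    have e := mul_nonsing_inv _ (SymplecticGroup.symplectic_det (hRs r hr))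
    have e' := mul_nonsing_inv _ (SymplecticGroup.symplectic_det (hRs r' hr'))
    rw [Matrix.mul_inv_rev, hγ, toK_mul]
    calc r * (r⁻¹ * (toK γ⁻¹).1 * ((toK γ').1 * r')) * r'⁻¹
        = (r * r⁻¹) * ((toK γ⁻¹).1 * (toK γ').1) * (r' * r'⁻¹) := by simp only [mul_assoc]
      _ = (toK γ⁻¹).1 * (toK γ').1 := by rw [e, e', one_mul, mul_one]

/-- The covers of the contractible space of forms by reduced forms. -/
def coverData [HasDenominator A s] {N : ℕ} {C : ℝ} (hred : HasReducedBases n K 1 N C)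
    (R : Set (Matrix (Fin n ⊕ Fin n) (Fin n ⊕ Fin n) K))
    (hR : ∀ b ∈ symplecticGroup (Fin n) K, (∀ i j, (N : K) * b i j ∈ A) →
        ∃ γ : Sp n A, ∃ r ∈ R, b = (toK γ).1 * r) :
    GpH2.CoverData (Sp n A) (FormSpace K (Fin n)) (LatV K (Fin n) A s) where
  H := contraction
  x₀ := ⟨fun _ => 1, compat_one⟩
  H_zero x := Subtype.ext (contract_zero x.1)
  H_one x := Subtype.ext x.2.contract_one
  adj₁ := LatV.Adj 1
  adj₂ := LatV.Adj 2
  adj₁_refl := LatV.Adj.refl 1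
  adj₁_trans _ _ _ h h' := LatV.Adj.trans h h'
  adj₁_smul γ _ _ h := h.smul γ
  L₀ := LatV.std A s
  clip := LatV.clip (HasDenominator.ne_zero A)
  clip_zero := LatV.clip_zero _
  clip_eventually := LatV.clip_eventually _
  clip_succ := LatV.clip_succ _
  clip_adj _ _ k h := LatV.clip_adj _ h k
  W := coverSet N (C + 1) R
  W_open := isOpen_coverSet N (C + 1) R
  W_cover := mem_coverSet hred hR
  W_smul δ _ _ _ h := smul_mem_coverSet δ h

variable (n A s) in
theorem H2_fg_of_hasDenominator [HasDenominator A s] : AddGroup.FG (GpH2.H2 (Sp n A)) := by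
  obtain ⟨N, hN, C, hC, hred⟩ := exists_hasReducedBases K n 1 le_rfl
  obtain ⟨R, hR, hRs, hcos⟩ := exists_finite_cosets n A s hN
  exact (coverData (s := s) hred R hcos).H2_fg
    (finite_coverSet_diffs (s := s) hN (by positivity) hR hRs)

end Cover

end SympRed

open GpH2 SpAux IsDedekindDomain NumberField in
/-- **Theorem (Statement 5).** Let `K` be a number field, `S` a finite set of places
containing all archimedean ones (encoded by its finite set of finite places), and `𝔄` the
ring of `S`-integers. For every `g ≥ 1`, the second integral homology of `Sp(2g, 𝔄)` is a
finitely generated abelian group. -/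
theorem H2_S_integers_fg (K : Type) [Field K] [NumberField K]
    (S : Set (HeightOneSpectrum (𝓞 K))) (hS : S.Finite) (g : ℕ) (hg : 1 ≤ g) :
    AddGroup.FG (H2 ↥(Sp g ↥(S.integer K))) := by
  obtain ⟨s, hs⟩ := SympRed.exists_hasDenominator_integer hS
  exact SympRed.H2_fg_of_hasDenominator g (S.integer K) s
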